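/- Let ψ: ℕ → [0,1/2] be a function such that Ψ(Q) = 2∑_{q≤Q} φ(q)ψ(q)/q tends to infinity as Q → ∞. Then there exists a set B ⊆ ℝ of Lebesgue measure 0 such that for all α ∈ ℝ \ B and every ε > 0, one has #{(a,q) ∈ ℤ×ℕ : q ≤ Q, |α − a/q| < ψ(q)/q, gcd(a,q) = 1} = Ψ(Q) + O_ε(Ψ(Q)^{1/2+ε}) for all Q sufficiently large in terms of α and ψ. -/

import Mathlib

open Filter MeasureTheory

/-- `Ψ(Q) = 2 ∑_{q ≤ Q} φ(q) ψ(q) / q`. -/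
noncomputable def Psi (ψ : ℕ → ℝ) (Q : ℕ) : ℝ :=
  2 * ∑ q ∈ Finset.Icc 1 Q, (Nat.totient q : ℝ) * ψ q / q

/-- `N(α; Q)`: the number of pairs `(a, q) ∈ ℤ × ℕ` with `1 ≤ q ≤ Q`,
`|α - a/q| < ψ(q)/q` and `gcd(a, q) = 1`. -/
noncomputable def Ncount (ψ : ℕ → ℝ) (α : ℝ) (Q : ℕ) : ℕ :=
  Nat.card {x : ℤ × ℕ | 1 ≤ x.2 ∧ x.2 ≤ Q ∧
    |α - (x.1 : ℝ) / (x.2 : ℝ)| < ψ x.2 / (x.2 : ℝ) ∧ Int.gcd x.1 (x.2 : ℤ) = 1}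

namespace QDS
open Finset

def nd (i j : ℕ) : ℕ := (i - j) + (j - i)

lemma nd_comm (i j : ℕ) : nd i j = nd j i := by unfold nd; omega

lemma geo_inj {ρ : ℝ} (h0 : 0 ≤ ρ) (h1 : ρ < 1) (J : Finset ℕ) (d : ℕ → ℕ)
    (hi : Set.InjOn d J) (hd : ∀ j ∈ J, 1 ≤ d j) : ∑ j ∈ J, ρ ^ d j ≤ ρ / (1 - ρ) := by
  rw [← Finset.sum_image (f := fun k => ρ ^ k) (g := d) (s := J) hi]
  have hsub : J.image d ⊆ Ico 1 ((J.image d).sup id + 1) := by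
    intro k hk
    rw [mem_Ico]
    refine ⟨?_, Nat.lt_succ_of_le (Finset.le_sup (f := id) hk)⟩
    obtain ⟨j, hj, rfl⟩ := mem_image.1 hk
    exact hd j hj
  calc ∑ k ∈ J.image d, ρ ^ k ≤ ∑ k ∈ Ico 1 ((J.image d).sup id + 1), ρ ^ k :=
        sum_le_sum_of_subset_of_nonneg hsub (fun _ _ _ => pow_nonneg h0 _)
    _ ≤ ρ ^ 1 / (1 - ρ) := geom_sum_Ico_le_of_lt_one h0 h1
    _ = _ := by rw [pow_one]

lemma geo_lt {ρ : ℝ} (h0 : 0 ≤ ρ) (h1 : ρ < 1) (J : Finset ℕ) (i : ℕ) (hJ : ∀ j ∈ J, j < i) :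
    ∑ j ∈ J, ρ ^ nd i j ≤ ρ / (1 - ρ) := by
  apply geo_inj h0 h1
  · intro a ha b hb hab
    have := hJ a ha; have := hJ b hb
    simp only [nd] at hab; omega
  · intro j hj; have := hJ j hj; unfold nd; omega

lemma geo_gt {ρ : ℝ} (h0 : 0 ≤ ρ) (h1 : ρ < 1) (J : Finset ℕ) (i : ℕ) (hJ : ∀ j ∈ J, i < j) :
    ∑ j ∈ J, ρ ^ nd i j ≤ ρ / (1 - ρ) := by
  apply geo_inj h0 h1
  · intro a ha b hb hab
    have := hJ a ha; have := hJ b hb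
    simp only [nd] at hab; omega
  · intro j hj; have := hJ j hj; unfold nd; omega

lemma geo_ne {ρ : ℝ} (h0 : 0 ≤ ρ) (h1 : ρ < 1) (J : Finset ℕ) (i : ℕ) (hJ : ∀ j ∈ J, j ≠ i) :
    ∑ j ∈ J, ρ ^ nd i j ≤ 2 * (ρ / (1 - ρ)) := by
  rw [← sum_filter_add_sum_filter_not J (fun j => j < i)]
  have A := geo_lt h0 h1 (J.filter (fun j => j < i)) i (by simp)
  have B := geo_gt h0 h1 (J.filter (fun j => ¬ j < i)) i (by
    intro j hj; rw [mem_filter] at hj; have := hJ j hj.1; omega)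
  linarith

lemma geo_all {ρ : ℝ} (h0 : 0 ≤ ρ) (h1 : ρ < 1) (J : Finset ℕ) (i : ℕ) :
    ∑ j ∈ J, ρ ^ nd i j ≤ 1 + 2 * (ρ / (1 - ρ)) := by
  rw [← sum_filter_add_sum_filter_not J (fun j => j = i)]
  have B := geo_ne h0 h1 (J.filter (fun j => ¬ j = i)) i (by simp)
  have A : ∑ j ∈ J.filter (fun j => j = i), ρ ^ nd i j ≤ 1 := by
    have : ∑ j ∈ J.filter (fun j => j = i), ρ ^ nd i j ≤ ∑ j ∈ ({i} : Finset ℕ), ρ ^ nd i j :=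
      sum_le_sum_of_subset_of_nonneg (by intro j; simp) (fun _ _ _ => pow_nonneg h0 _)
    simpa [nd] using this
  linarith

lemma schur {r G : ℝ} (I J : Finset ℕ) (x y : ℕ → ℝ) (g : ℕ → ℕ → ℝ)
    (hx : ∀ i, 0 ≤ x i) (hy : ∀ i, 0 ≤ y i) (hg : ∀ i ∈ I, ∀ j ∈ J, 0 ≤ g i j)
    (h1 : ∀ i ∈ I, ∑ j ∈ J, g i j ≤ G) (h2 : ∀ j ∈ J, ∑ i ∈ I, g i j ≤ G) :
    ∑ i ∈ I, ∑ j ∈ J, (x i * y j) ^ r * g i j ≤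
      G / 2 * (∑ i ∈ I, x i ^ (2 * r) + ∑ j ∈ J, y j ^ (2 * r)) := by
  have key : ∀ i ∈ I, ∀ j ∈ J, (x i * y j) ^ r * g i j ≤
      x i ^ (2*r) / 2 * g i j + y j ^ (2*r) / 2 * g i j := by
    intro i hi j hj
    have : (x i * y j) ^ r ≤ x i ^ (2*r) / 2 + y j ^ (2*r) / 2 := by
      rw [Real.mul_rpow (hx i) (hy j), mul_comm 2 r, Real.rpow_mul (hx i), Real.rpow_mul (hy j)]
      simp only [Real.rpow_two]
      nlinarith [sq_nonneg (x i ^ r - y j ^ r)]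
    nlinarith [hg i hi j hj]
  calc _ ≤ ∑ i ∈ I, ∑ j ∈ J, (x i ^ (2*r) / 2 * g i j + y j ^ (2*r) / 2 * g i j) :=
        sum_le_sum fun i hi => sum_le_sum fun j hj => key i hi j hj
    _ = ∑ i ∈ I, x i ^ (2*r) / 2 * ∑ j ∈ J, g i j + ∑ j ∈ J, y j ^ (2*r) / 2 * ∑ i ∈ I, g i j := by
        simp_rw [sum_add_distrib, mul_sum]
        congr 1
        rw [sum_comm]
    _ ≤ ∑ i ∈ I, x i ^ (2*r) / 2 * G + ∑ j ∈ J, y j ^ (2*r) / 2 * G := by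
        gcongr with i hi j hj
        · have := hx i; positivity
        · exact h1 i hi
        · have := hy j; positivity
        · exact h2 j hj
    _ = _ := by rw [← sum_mul, ← sum_mul, ← sum_div, ← sum_div]; ring

lemma pow_sum {r : ℝ} (hr : 1 / 2 ≤ r) (I : Finset ℕ) (x : ℕ → ℝ) (hx : ∀ i, 0 ≤ x i) :
    ∑ i ∈ I, x i ^ (2 * r) ≤ (∑ i ∈ I, x i) ^ (2 * r - 1) * ∑ i ∈ I, x i := by
  rw [mul_sum]
  apply sum_le_sum
  intro i hi
  rcases (hx i).eq_or_lt with h | h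
  · rw [← h, Real.zero_rpow (by linarith)]; simp
  · have : x i ^ (2*r) = x i ^ (2*r - 1) * x i := by
      rw [← Real.rpow_add_one h.ne']; ring_nf
    rw [this]
    gcongr
    · linarith
    · exact single_le_sum (fun j _ => hx j) hi

lemma young {r a b : ℝ} (h0 : 0 < r) (h1 : r < 1) (ha : 0 ≤ a) (hb : 0 ≤ b) :
    a ^ r * b ^ (1 - r) ≤ r * a + (1 - r) * b :=
  Real.geom_mean_le_arith_mean2_weighted h0.le (by linarith) ha hb (by ring)

lemma young4 {r a b : ℝ} (h0 : 0 < r) (h1 : r < 1) (ha : 0 ≤ a) (hb : 0 ≤ b) :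
    a ^ r * b ^ (1 - r) ≤ a / 4 + 4 ^ (r / (1 - r)) * b := by
  have hu : 0 < 1 - r := by linarith
  have h := young h0 h1 (show 0 ≤ a / 4 by positivity)
    (show 0 ≤ (4:ℝ) ^ (r / (1 - r)) * b by positivity)
  have e : (a / 4) ^ r * ((4:ℝ) ^ (r / (1 - r)) * b) ^ (1 - r) = a ^ r * b ^ (1 - r) := by
    rw [Real.div_rpow ha (by norm_num), Real.mul_rpow (by positivity) hb, ← Real.rpow_mul (by norm_num),
      div_mul_cancel₀ _ hu.ne']
    have : (4:ℝ) ^ r ≠ 0 := by positivity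
    field_simp
  rw [e] at h
  have : 0 ≤ (4:ℝ) ^ (r / (1 - r)) * b := by positivity
  nlinarith

def LocalOK (r : ℝ) (c : ℕ → ℕ → ℝ) : Prop :=
  ∀ (M : ℕ) (x y : ℕ → ℝ) (e : ℕ → ℕ → ℝ), (∀ i, 0 ≤ x i) → (∀ i, 0 ≤ y i) →
    ∑ i ∈ range M, x i = 1 → ∑ i ∈ range M, y i = 1 →
    (∀ i ∈ range M, ∀ j ∈ range M, i ≠ j → e i j ≤ (x i * y j) ^ r * c i j) →
    (∀ k ∈ range M, ∑ i ∈ range M, ∑ j ∈ range M, (if min i j = k then e i j else 0) ≤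
      ((∑ i ∈ (range M).filter (fun i => k ≤ i), x i) *
        (∑ i ∈ (range M).filter (fun i => k ≤ i), y i)) ^ r * c k k) →
    (∀ k ∈ range M, e k k ≤ (x k * y k) ^ r * c k k) →
    ∑ i ∈ range M, ∑ j ∈ range M, e i j < 1

noncomputable def cS (r B : ℝ) (P k l : ℕ) : ℝ := (1 / B * (1 / (P:ℝ)) ^ nd k l) ^ (1 - r)

lemma rho_pow {r a b : ℝ} (ha : 0 ≤ a) (hb : 0 ≤ b) (n : ℕ) :
    (a * b ^ n) ^ (1 - r) = a ^ (1 - r) * (b ^ (1 - r)) ^ n := by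
  rw [Real.mul_rpow ha (by positivity), ← Real.rpow_natCast, ← Real.rpow_natCast,
    ← Real.rpow_mul hb, ← Real.rpow_mul hb, mul_comm]
  ring_nf

lemma localSmall {r : ℝ} (h0 : 1 / 2 < r) (h1 : r < 1) :
    ∃ B : ℝ, 1 ≤ B ∧ ∀ P : ℕ, 2 ≤ P → LocalOK r (cS r B P) := by
  set ρ : ℝ := (1 / 2 : ℝ) ^ (1 - r) with hρ
  have hρ0 : 0 ≤ ρ := by positivity
  have hρ1 : ρ < 1 := Real.rpow_lt_one (by norm_num) (by norm_num) (by linarith)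
  set G : ℝ := 1 + 2 * (ρ / (1 - ρ)) with hG
  have hG1 : 1 ≤ G := by
    have : 0 ≤ ρ / (1 - ρ) := div_nonneg hρ0 (by linarith)
    linarith
  set B : ℝ := (2 * G) ^ (1 / (1 - r)) with hB
  have hu : 0 < 1 - r := by linarith
  refine ⟨B, Real.one_le_rpow (by linarith) (by positivity), ?_⟩
  intro P hP M x y e hx hy sx sy he1 he2 he3
  have hc : ∀ i j, cS r B P i j ≤ 1 / (2 * G) * ρ ^ nd i j := by
    intro i j
    unfold cS
    rw [rho_pow (by positivity) (by positivity)]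
    have : (1 / B) ^ (1 - r) = 1 / (2 * G) := by
      rw [Real.div_rpow (by norm_num) (by positivity), hB, ← Real.rpow_mul (by linarith),
        one_div_mul_cancel hu.ne', Real.rpow_one, Real.one_rpow]
    rw [this]
    have hP' : (2:ℝ) ≤ P := by exact_mod_cast hP
    have hle : (1 / (P:ℝ)) ^ (1 - r) ≤ ρ :=
      Real.rpow_le_rpow (by positivity) (one_div_le_one_div_of_le (by norm_num) hP') hu.le
    gcongr
  have he : ∀ i ∈ range M, ∀ j ∈ range M, e i j ≤ (x i * y j) ^ r * (1 / (2 * G) * ρ ^ nd i j) := by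
    intro i hi j hj
    have hxy : 0 ≤ (x i * y j) ^ r := Real.rpow_nonneg (mul_nonneg (hx i) (hy j)) _
    by_cases h : i = j
    · subst h
      exact (he3 i hi).trans (mul_le_mul_of_nonneg_left (hc i i) hxy)
    · exact (he1 i hi j hj h).trans (mul_le_mul_of_nonneg_left (hc i j) hxy)
  have hs := schur (r := r) (G := 1 / (2 * G) * G) (range M) (range M) x y (fun i j => 1 / (2 * G) * ρ ^ nd i j)
    hx hy (fun _ _ _ _ => by positivity)
    (fun i _ => by rw [← mul_sum]; gcongr; exact geo_all hρ0 hρ1 _ _)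
    (fun j _ => by
      rw [← mul_sum]; simp_rw [nd_comm _ j]; gcongr; exact geo_all hρ0 hρ1 _ _)
  have p1 := pow_sum h0.le (range M) x hx
  have p2 := pow_sum h0.le (range M) y hy
  rw [sx] at p1; rw [sy] at p2
  simp only [Real.one_rpow, mul_one] at p1 p2
  have : ∑ i ∈ range M, ∑ j ∈ range M, e i j ≤ _ :=
    (sum_le_sum fun i hi => sum_le_sum fun j hj => he i hi j hj).trans hs
  have hg : 1 / (2 * G) * G = 1 / 2 := by field_simp
  rw [hg] at this
  linarith

end QDS

namespace QDS
open Finset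

noncomputable def cL (r C θ ε : ℝ) (k l : ℕ) : ℝ :=
  if k = l then (if k = 0 then 1 - C * ε ^ (2 * r) else 1 - (2 * (1 - r) * θ * ε + C * ε ^ (2 * r)))
  else (θ * ε ^ nd k l) ^ (1 - r)

lemma sum_split (I : Finset ℕ) (k : ℕ) (hk : k ∈ I) (e : ℕ → ℕ → ℝ) :
    ∑ i ∈ I, ∑ j ∈ I, e i j = e k k + ∑ i ∈ I.erase k, e i k + ∑ j ∈ I.erase k, e k j +
      ∑ i ∈ I.erase k, ∑ j ∈ I.erase k, e i j := by
  rw [← add_sum_erase _ _ hk, ← add_sum_erase _ _ hk]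
  have : ∀ i, ∑ j ∈ I, e i j = e i k + ∑ j ∈ I.erase k, e i j := fun i => (add_sum_erase _ _ hk).symm
  simp_rw [this, sum_add_distrib]
  ring

lemma sum_split2 (I : Finset ℕ) (k : ℕ) (hk : k ∈ I) (e : ℕ → ℕ → ℝ) :
    ∑ i ∈ I, ∑ j ∈ I, e i j = ∑ i ∈ I, ∑ j ∈ I, (if min i j = k then e i j else 0) +
      ∑ i ∈ I.filter (· < k), e i k + ∑ j ∈ I.filter (· < k), e k j +
      ∑ i ∈ I.erase k, ∑ j ∈ I.erase k, e i j := by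
  have h1 : ∑ i ∈ I.filter (· < k), e i k = ∑ i ∈ I, ∑ j ∈ I, if i < k ∧ j = k then e i j else 0 := by
    rw [sum_filter]
    apply sum_congr rfl; intro i _
    by_cases h : i < k
    · simp [h, hk]
    · simp [h]
  have h2 : ∑ j ∈ I.filter (· < k), e k j = ∑ i ∈ I, ∑ j ∈ I, if i = k ∧ j < k then e i j else 0 := by
    rw [sum_comm, sum_filter]
    apply sum_congr rfl; intro i _
    by_cases h : i < k
    · simp [h, hk]
    · simp [h]
  have h3 : ∑ i ∈ I.erase k, ∑ j ∈ I.erase k, e i j = ∑ i ∈ I, ∑ j ∈ I, if i ≠ k ∧ j ≠ k then e i j else 0 := by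
    rw [← filter_ne', sum_filter]
    apply sum_congr rfl; intro i _
    by_cases h : i = k
    · simp [h]
    · simp [h, sum_filter]
  rw [h1, h2, h3]
  simp_rw [← sum_add_distrib]
  apply sum_congr rfl; intro i _
  apply sum_congr rfl; intro j _
  by_cases hi : i = k
  · subst hi
    rcases lt_trichotomy j i with h | h | h
    · have : min i j ≠ i := by omega
      simp [h, this]
    · simp [h]
    · have : ¬ j < i := by omega
      have h2 : min i j = i := by omega
      simp [this, h2]
  · by_cases hj : j = k
    · subst hj
      rcases lt_trichotomy i j with h | h | h
      · have : min i j ≠ j := by omega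
        simp [h, this, hi]
      · simp [h]
      · have : ¬ i < j := by omega
        have h2 : min i j = j := by omega
        simp [this, h2, hi]
    · have : min i j ≠ k := by omega
      simp [hi, hj, this]

lemma geo_half {ρ : ℝ} (h0 : 0 ≤ ρ) (h : ρ ≤ 1 / 2) : ρ / (1 - ρ) ≤ 2 * ρ := by
  rw [div_le_iff₀ (by linarith)]; nlinarith

lemma geo_half2 {ε : ℝ} (h0 : 0 ≤ ε) (h : ε ≤ 1 / 2) : ε / (1 - ε) ≤ ε + 2 * ε ^ 2 := by
  rw [div_le_iff₀ (by linarith)]; nlinarith [sq_nonneg ε]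

lemma sqrt_amgm {a b : ℝ} (ha : 0 ≤ a) (hb : 0 ≤ b) : (a * b) ^ (1 / 2 : ℝ) ≤ (a + b) / 2 := by
  rw [← Real.sqrt_eq_rpow, Real.sqrt_le_iff]
  exact ⟨by positivity, by nlinarith [sq_nonneg (a - b)]⟩

lemma fineX {r a b : ℝ} (h0 : 1 / 2 < r) (h1 : r < 1) (ha0 : 0 ≤ a) (ha1 : a ≤ 1) (hb0 : 0 ≤ b)
    (hb1 : b ≤ 1) : ((1 - a) * (1 - b)) ^ r ≤ 1 - r * (a + b) + a * b := by
  have hb4 : ∀ s, 0 ≤ s → s ≤ 1 → (1 - s) ^ r ≤ 1 - r * s := by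
    intro s hs0 hs1
    have := rpow_one_add_le_one_add_mul_self (s := -s) (by linarith) (by linarith : 0 ≤ r) h1.le
    have e' : 1 + -s = 1 - s := by ring
    rw [e'] at this; linarith
  rw [Real.mul_rpow (by linarith) (by linarith)]
  have q1 := hb4 a ha0 ha1
  have q2 := hb4 b hb0 hb1
  have q3 : 0 ≤ (1 - b) ^ r := Real.rpow_nonneg (by linarith) _
  calc (1 - a) ^ r * (1 - b) ^ r ≤ (1 - r * a) * (1 - r * b) := by
        apply mul_le_mul q1 q2 q3; nlinarith
    _ ≤ _ := by
        have : r * r * (a * b) ≤ 1 * (a * b) := by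
          gcongr; nlinarith
        linarith

lemma fineX2 {r a b : ℝ} (h0 : 1 / 2 < r) (h1 : r < 1) (ha0 : 0 ≤ a) (ha1 : a ≤ 1) (hb0 : 0 ≤ b)
    (hb1 : b ≤ 1) : 1 - (a + b) ≤ ((1 - a) * (1 - b)) ^ r := by
  have : 1 - (a+b) ≤ (1 - a) * (1 - b) := by nlinarith
  have h3 : (1 - a) * (1 - b) ≤ ((1 - a) * (1 - b)) ^ r := by
    have := Real.rpow_le_rpow_of_exponent_ge' (x := (1-a)*(1-b)) (mul_nonneg (by linarith) (by linarith))
      (mul_le_one₀ (by linarith) (by linarith) (by linarith)) (by linarith : 0 ≤ r) h1.le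
    simpa using this
  linarith

set_option maxHeartbeats 2000000 in
lemma localLarge_core {r θ Θ ε s0 C1 C3 : ℝ} (h0 : 1 / 2 < r) (h1 : r < 1)
    (hθ1 : 1 ≤ θ) (hθ : θ ≤ Θ) (hε0 : 0 < ε) (hε : ε ≤ 1 / 2)
    (hs0 : 0 < s0) (hs01 : s0 < 1) (hs : s0 ^ (2 * r - 1) ≤ 1 / 8)
    (hC1 : C1 = 64 * 4 ^ (r / (1 - r)) * Θ)
    (hC3 : 2 * (2 * C1 ^ (2 * r) + C1 ^ 2 / 4 + 2 * Θ * C1 + 4 * Θ) < C3)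
    (hC1ε : C1 * ε ≤ 1 / 2)
    (hρ : ε ^ (1 - r) ≤ 1 / 2) (hρ1 : 4 * Θ * ε ^ (1 - r) ≤ 1)
    (hρ2 : 4 * Θ * ε ^ (1 - r) < 1 - (1 - s0) ^ (r - 1 / 2)) :
    LocalOK r (cL r C3 θ ε) := by
  intro M x y e hx hy sx sy he1 he2 he3
  by_contra hcon
  push Not at hcon
  set I := range M with hI
  have hu : 0 < 1 - r := by linarith
  have hθ0 : 0 ≤ θ := by linarith
  have hΘ1 : 1 ≤ Θ := by linarith
  have hK : 0 < (4:ℝ) ^ (r / (1 - r)) := by positivity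
  have hC1p : 0 < C1 := by rw [hC1]; positivity
  have hC3p : 0 < C3 := lt_of_le_of_lt (by positivity) hC3
  set ρ : ℝ := ε ^ (1 - r) with hρd
  have hρ0 : 0 < ρ := by positivity
  set g : ℕ → ℝ := fun n => (θ * ε ^ n) ^ (1 - r) with hg
  have hg0 : ∀ n, 0 ≤ g n := fun n => by positivity
  have hgle : ∀ n, g n ≤ Θ * ρ ^ n := by
    intro n
    simp only [hg]
    rw [rho_pow hθ0 hε0.le]
    have : θ ^ (1 - r) ≤ Θ := (Real.rpow_le_rpow hθ0 hθ hu.le).trans (by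
      calc Θ ^ (1 - r) ≤ Θ ^ (1:ℝ) := Real.rpow_le_rpow_of_exponent_le hΘ1 (by linarith)
        _ = Θ := Real.rpow_one _)
    gcongr
  have hcoff : ∀ i j, i ≠ j → cL r C3 θ ε i j = g (nd i j) := fun i j h => by simp [cL, h, hg]
  have hcd : ∀ k, cL r C3 θ ε k k ≤ 1 := by
    intro k
    have : 0 < C3 * ε ^ (2 * r) := by positivity
    have : 0 ≤ 2 * (1 - r) * θ * ε := by positivity
    unfold cL; simp only [if_true]; split_ifs <;> linarith
  have hgeo : ρ / (1 - ρ) ≤ 2 * ρ := geo_half hρ0.le hρ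
  -- row sums of g off-diagonal
  have hrow : ∀ (J : Finset ℕ) (i : ℕ), (∀ j ∈ J, j ≠ i) → ∑ j ∈ J, g (nd i j) ≤ 4 * Θ * ρ := by
    intro J i hJ
    calc _ ≤ ∑ j ∈ J, Θ * ρ ^ nd i j := sum_le_sum fun j _ => hgle _
      _ = Θ * ∑ j ∈ J, ρ ^ nd i j := by rw [mul_sum]
      _ ≤ Θ * (2 * (ρ / (1 - ρ))) := by
          gcongr; exact geo_ne hρ0.le (by linarith) J i hJ
      _ ≤ Θ * (2 * (2 * ρ)) := by gcongr
      _ = _ := by ring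
  have hxI : ∀ i ∈ I, x i ≤ 1 := fun i hi => sx ▸ single_le_sum (fun j _ => hx j) hi
  have hyI : ∀ i ∈ I, y i ≤ 1 := fun i hi => sy ▸ single_le_sum (fun j _ => hy j) hi
  -- coarse
  have coarse : ∃ k ∈ I, 1 - s0 < x k * y k := by
    by_contra hno
    push Not at hno
    have hd : ∀ k ∈ I, e k k ≤ (1 - s0) ^ (r - 1 / 2) * ((x k + y k) / 2) := by
      intro k hk
      have hxy : 0 ≤ x k * y k := mul_nonneg (hx k) (hy k)
      have a1 : e k k ≤ (x k * y k) ^ r := (he3 k hk).trans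
        (mul_le_of_le_one_right (by positivity) (hcd k))
      have a2 : (x k * y k) ^ r ≤ (1 - s0) ^ (r - 1 / 2) * (x k * y k) ^ (1 / 2 : ℝ) := by
        rcases hxy.eq_or_lt with h | h
        · rw [← h, Real.zero_rpow (by linarith), Real.zero_rpow (by norm_num)]; simp
        · have : (x k * y k) ^ r = (x k * y k) ^ (r - 1/2) * (x k * y k) ^ (1/2:ℝ) := by
            rw [← Real.rpow_add h]; ring_nf
          rw [this]
          gcongr
          exact hno k hk
      have a3 : (x k * y k) ^ (1 / 2 : ℝ) ≤ (x k + y k) / 2 := sqrt_amgm (hx k) (hy k)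
      refine a1.trans (a2.trans ?_)
      gcongr
    have hoff : ∀ i ∈ I, ∀ j ∈ I, e i j ≤ (if i = j then e i j else 0) +
        (x i * y j) ^ r * (if i = j then 0 else g (nd i j)) := by
      intro i hi j hj
      by_cases h : i = j
      · simp [h]
      · simp only [h, if_false, zero_add]; rw [← hcoff i j h]; exact he1 i hi j hj h
    have hs := schur (r := r) (G := 4 * Θ * ρ) I I x y (fun i j => if i = j then 0 else g (nd i j))
      hx hy (fun i _ j _ => by split_ifs; exacts [le_rfl, hg0 _])
      (fun i _ => by
        rw [← sum_filter_add_sum_filter_not I (fun j => i = j)]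
        rw [sum_congr rfl (g := fun _ => (0:ℝ)) (fun j hj => by simp [(mem_filter.1 hj).2]),
          sum_const_zero, zero_add,
          sum_congr rfl (g := fun j => g (nd i j)) (fun j hj => by simp [(mem_filter.1 hj).2])]
        exact hrow _ i (fun j hj => fun h => (mem_filter.1 hj).2 h.symm))
      (fun i _ => by
        rw [← sum_filter_add_sum_filter_not I (fun j => j = i)]
        rw [sum_congr rfl (g := fun _ => (0:ℝ)) (fun j hj => by simp [(mem_filter.1 hj).2]),
          sum_const_zero, zero_add,
          sum_congr rfl (g := fun j => g (nd i j)) (fun j hj => by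
            simp [(mem_filter.1 hj).2, nd_comm])]
        exact hrow _ i (fun j hj => fun h => (mem_filter.1 hj).2 h))
    have p1 := pow_sum h0.le I x hx
    have p2 := pow_sum h0.le I y hy
    rw [sx] at p1; rw [sy] at p2
    simp only [Real.one_rpow, mul_one] at p1 p2
    have tot : ∑ i ∈ I, ∑ j ∈ I, e i j ≤ ∑ i ∈ I, e i i + ∑ i ∈ I, ∑ j ∈ I, (x i * y j) ^ r * (if i = j then 0 else g (nd i j)) := by
      rw [← sum_add_distrib]
      apply sum_le_sum; intro i hi
      refine (sum_le_sum fun j hj => hoff i hi j hj).trans ?_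
      rw [sum_add_distrib]; simp [hi]
    have hdsum : ∑ i ∈ I, e i i ≤ (1 - s0) ^ (r - 1 / 2) := by
      refine (sum_le_sum hd).trans ?_
      rw [← mul_sum, ← sum_div, sum_add_distrib, sx, sy]; norm_num
    have hpos : 0 ≤ 4 * Θ * ρ := by positivity
    have := mul_le_mul_of_nonneg_left (add_le_add p1 p2) (show 0 ≤ 4 * Θ * ρ / 2 by positivity)
    linarith
  obtain ⟨k, hk, hkk⟩ := coarse
  set ξ := 1 - x k with hξ
  set υ := 1 - y k with hυ
  have hξ0 : 0 ≤ ξ := by have := hxI k hk; linarith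
  have hυ0 : 0 ≤ υ := by have := hyI k hk; linarith
  have hξs : ξ ≤ s0 := by
    have := mul_le_mul_of_nonneg_left (hyI k hk) (hx k)
    linarith
  have hυs : υ ≤ s0 := by
    have := mul_le_mul_of_nonneg_right (hxI k hk) (hy k)
    linarith
  have sxe : ∑ i ∈ I.erase k, x i = ξ := by have := add_sum_erase I x hk; linarith
  have sye : ∑ i ∈ I.erase k, y i = υ := by have := add_sum_erase I y hk; linarith
  have mino : ∑ i ∈ I.erase k, ∑ j ∈ I.erase k, e i j ≤ ξ ^ (2 * r) + υ ^ (2 * r) := by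
    have hs := schur (r := r) (G := 2) (I.erase k) (I.erase k) x y (fun i j => if i = j then 1 else g (nd i j))
      hx hy (fun i _ j _ => by split_ifs; exacts [zero_le_one, hg0 _])
      (fun i hi => by
        rw [← add_sum_erase _ _ hi]
        rw [sum_congr rfl (g := fun j => g (nd i j)) (fun j hj => by
          simp [(ne_of_mem_erase hj).symm])]
        have := hrow ((I.erase k).erase i) i (fun j hj => ne_of_mem_erase hj)
        simp only [if_true]; linarith)
      (fun i hi => by
        rw [← add_sum_erase _ _ hi]
        rw [sum_congr rfl (g := fun j => g (nd i j)) (fun j hj => by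
          simp [(ne_of_mem_erase hj), nd_comm])]
        have := hrow ((I.erase k).erase i) i (fun j hj => ne_of_mem_erase hj)
        simp only [if_true]; linarith)
    have pw : ∀ (z : ℕ → ℝ) (s : ℝ), (∀ i, 0 ≤ z i) → ∑ i ∈ I.erase k, z i = s → 0 ≤ s →
        ∑ i ∈ I.erase k, z i ^ (2 * r) ≤ s ^ (2 * r) := by
      intro z s hz hsum hs0
      have := pow_sum h0.le (I.erase k) z hz
      rw [hsum] at this
      refine this.trans (le_of_eq ?_)
      rcases hs0.eq_or_lt with h | h
      · rw [← h, Real.zero_rpow (by linarith : 2 * r ≠ 0)]; simp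
      · rw [← Real.rpow_add_one h.ne']; ring_nf
    have p1 := pw x ξ hx sxe hξ0
    have p2 := pw y υ hy sye hυ0
    have : ∑ i ∈ I.erase k, ∑ j ∈ I.erase k, e i j ≤ ∑ i ∈ I.erase k, ∑ j ∈ I.erase k,
        (x i * y j) ^ r * (if i = j then 1 else g (nd i j)) := by
      apply sum_le_sum; intro i hi; apply sum_le_sum; intro j hj
      have hi := mem_of_mem_erase hi
      have hj := mem_of_mem_erase hj
      by_cases h : i = j
      · subst h
        simp only [if_true]
        exact (he3 i hi).trans (mul_le_mul_of_nonneg_left (hcd i)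
          (Real.rpow_nonneg (mul_nonneg (hx i) (hy i)) _))
      · simp only [h, if_false]; rw [← hcoff i j h]; exact he1 i hi j hj h
    linarith
  -- e i k ≤ x_i^r g
  have hik : ∀ i ∈ I, i ≠ k → e i k ≤ x i ^ r * (θ * ε ^ nd k i) ^ (1 - r) := by
    intro i hi hne
    refine (he1 i hi k hk hne).trans ?_
    rw [hcoff i k hne, nd_comm]
    simp only [hg]
    have := hx i; have := hy k
    gcongr
    exact mul_le_of_le_one_right (hx i) (hyI k hk)
  have hki : ∀ i ∈ I, i ≠ k → e k i ≤ y i ^ r * (θ * ε ^ nd k i) ^ (1 - r) := by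
    intro i hi hne
    refine (he1 k hk i hi hne.symm).trans ?_
    rw [hcoff k i hne.symm]
    simp only [hg]
    have := hy i; have := hx k
    gcongr
    exact mul_le_of_le_one_left (hy i) (hxI k hk)
  have hgε : ε / (1 - ε) ≤ ε + 2 * ε ^ 2 := geo_half2 hε0.le hε
  -- mid
  have midx : ∀ (z : ℕ → ℝ) (f : ℕ → ℝ) (s : ℝ), (∀ i, 0 ≤ z i) → ∑ i ∈ I.erase k, z i = s →
      (∀ i ∈ I, i ≠ k → f i ≤ z i ^ r * (θ * ε ^ nd k i) ^ (1 - r)) →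
      ∑ i ∈ I.erase k, f i ≤ s / 4 + 4 ^ (r / (1 - r)) * θ * (4 * ε) := by
    intro z f s hz hs hf
    calc ∑ i ∈ I.erase k, f i ≤ ∑ i ∈ I.erase k, (z i / 4 + 4 ^ (r / (1 - r)) * (θ * ε ^ nd k i)) :=
          sum_le_sum fun i hi => (hf i (mem_of_mem_erase hi) (ne_of_mem_erase hi)).trans
            (young4 (by linarith) h1 (hz i) (by positivity))
      _ = s / 4 + 4 ^ (r / (1 - r)) * θ * ∑ i ∈ I.erase k, ε ^ nd k i := by
          rw [sum_add_distrib, ← sum_div, hs, ← mul_sum, ← mul_sum]; ring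
      _ ≤ _ := by
          gcongr
          have := geo_ne hε0.le (by linarith) (I.erase k) k (fun j hj => ne_of_mem_erase hj)
          have : ε * ε ≤ ε * (1 / 2) := by gcongr
          linarith
  have m1 := midx x (fun i => e i k) ξ hx sxe hik
  have m2 := midx y (fun i => e k i) υ hy sye hki
  have ekk : e k k ≤ 1 - (ξ + υ) / 2 := by
    have hxy : 0 ≤ x k * y k := mul_nonneg (hx k) (hy k)
    have a1 : e k k ≤ (x k * y k) ^ r := (he3 k hk).trans
      (mul_le_of_le_one_right (by positivity) (hcd k))
    have a2 : (x k * y k) ^ r ≤ (x k * y k) ^ (1 / 2 : ℝ) := by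
      apply Real.rpow_le_rpow_of_exponent_ge (by linarith) _ h0.le
      exact mul_le_one₀ (hxI k hk) (hy k) (hyI k hk)
    have a3 : (x k * y k) ^ (1 / 2 : ℝ) ≤ (x k + y k) / 2 := sqrt_amgm (hx k) (hy k)
    linarith
  have small : ∀ s, 0 ≤ s → s ≤ s0 → s ^ (2 * r) ≤ s / 8 := by
    intro s h hs'
    rcases h.eq_or_lt with h | h
    · rw [← h, Real.zero_rpow (by linarith)]; simp
    · have : s ^ (2 * r) = s ^ (2 * r - 1) * s := by rw [← Real.rpow_add_one h.ne']; ring_nf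
      rw [this]
      have : s ^ (2 * r - 1) ≤ 1 / 8 := (Real.rpow_le_rpow h.le hs' (by linarith)).trans hs
      have := mul_le_mul_of_nonneg_right this h.le
      linarith
  have hξυ : ξ + υ ≤ C1 * ε := by
    have s1 := small ξ hξ0 hξs
    have s2 := small υ hυ0 hυs
    rw [sum_split I k hk] at hcon
    have hh : 4 ^ (r / (1 - r)) * θ * (4 * ε) ≤ C1 * ε / 16 := by
      have : (4:ℝ) ^ (r / (1 - r)) * θ * (4 * ε) ≤ 4 ^ (r / (1 - r)) * Θ * (4 * ε) := by gcongr
      rw [hC1]; linarith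
    linarith
  have mino2 : ξ ^ (2 * r) + υ ^ (2 * r) ≤ 2 * C1 ^ (2 * r) * ε ^ (2 * r) := by
    have a1 : ξ ^ (2 * r) ≤ (C1 * ε) ^ (2 * r) := Real.rpow_le_rpow hξ0 (by linarith) (by linarith)
    have a2 : υ ^ (2 * r) ≤ (C1 * ε) ^ (2 * r) := Real.rpow_le_rpow hυ0 (by linarith) (by linarith)
    rw [Real.mul_rpow hC1p.le hε0.le] at a1 a2
    linarith
  have hE : 0 < ε ^ (2 * r) := by positivity
  have hE2 : ε ^ 2 ≤ ε ^ (2 * r) := by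
    rw [← Real.rpow_two]
    exact Real.rpow_le_rpow_of_exponent_ge hε0 (by linarith) (by linarith)
  -- fine
  have fsx : ∀ (z : ℕ → ℝ), ∑ i ∈ I, z i = 1 → ∑ i ∈ I.filter (fun i => k ≤ i), z i =
      1 - ∑ i ∈ I.filter (fun i => i < k), z i := by
    intro z hz
    have := sum_filter_add_sum_filter_not I (fun i => i < k) z
    simp only [not_lt] at this
    linarith
  have hmin := he2 k hk
  rw [fsx x sx, fsx y sy] at hmin
  set a := ∑ i ∈ I.filter (fun i => i < k), x i with ha
  set b := ∑ i ∈ I.filter (fun i => i < k), y i with hb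
  have ha0 : 0 ≤ a := sum_nonneg fun i _ => hx i
  have hb0 : 0 ≤ b := sum_nonneg fun i _ => hy i
  have hsub : I.filter (fun i => i < k) ⊆ I.erase k := by
    intro i hi; rw [mem_filter] at hi; exact mem_erase.2 ⟨by omega, hi.1⟩
  have haξ : a ≤ ξ := sxe ▸ sum_le_sum_of_subset_of_nonneg hsub fun i _ _ => hx i
  have hbυ : b ≤ υ := sye ▸ sum_le_sum_of_subset_of_nonneg hsub fun i _ _ => hy i
  have finx : ∀ (z : ℕ → ℝ) (f : ℕ → ℝ), (∀ i, 0 ≤ z i) →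
      (∀ i ∈ I, i ≠ k → f i ≤ z i ^ r * (θ * ε ^ nd k i) ^ (1 - r)) →
      ∑ i ∈ I.filter (fun i => i < k), f i ≤ r * ∑ i ∈ I.filter (fun i => i < k), z i +
        (1 - r) * θ * (ε + 2 * ε ^ 2) := by
    intro z f hz hf
    calc ∑ i ∈ I.filter (fun i => i < k), f i ≤
          ∑ i ∈ I.filter (fun i => i < k), (r * z i + (1 - r) * (θ * ε ^ nd k i)) :=
          sum_le_sum fun i hi => (hf i (mem_of_mem_filter i hi)
            (by have := (mem_filter.1 hi).2; omega)).trans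
            (young (by linarith) h1 (hz i) (by positivity))
      _ = r * ∑ i ∈ I.filter (fun i => i < k), z i +
          (1 - r) * θ * ∑ i ∈ I.filter (fun i => i < k), ε ^ nd k i := by
          rw [sum_add_distrib, ← mul_sum, ← mul_sum, ← mul_sum]; ring
      _ ≤ _ := by
          gcongr
          exact (geo_lt hε0.le (by linarith) _ k (by simp)).trans hgε
  have f1 := finx x (fun i => e i k) hx hik
  have f2 := finx y (fun i => e k i) hy hki
  rw [← ha] at f1; rw [← hb] at f2
  rw [sum_split2 I k hk] at hcon
  by_cases hk0 : k = 0
  · have e1 : I.filter (fun i => i < k) = ∅ := by ext i; simp [hk0]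
    have ha' : a = 0 := by rw [ha, e1]; simp
    have hb' : b = 0 := by rw [hb, e1]; simp
    rw [e1] at hcon
    rw [ha', hb'] at hmin
    have hc : cL r C3 θ ε k k = 1 - C3 * ε ^ (2 * r) := by simp [cL, hk0]
    rw [hc] at hmin
    simp only [sub_zero, mul_one, Real.one_rpow, one_mul, sum_empty, add_zero] at hmin hcon
    have : 2 * C1 ^ (2 * r) * ε ^ (2 * r) < C3 * ε ^ (2 * r) := by
      apply mul_lt_mul_of_pos_right _ hE
      have : 0 < C1 ^ (2 * r) := by positivity
      have : 0 < C1 ^ 2 / 4 + 2 * Θ * C1 + 4 * Θ := by positivity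
      linarith
    linarith
  · set h := 2 * (1 - r) * θ * ε + C3 * ε ^ (2 * r) with hh
    have hc : cL r C3 θ ε k k = 1 - h := by simp [cL, hk0, hh]
    rw [hc] at hmin
    have ha1 : a ≤ 1 := by linarith
    have hb1 : b ≤ 1 := by linarith
    have hh0 : 0 ≤ h := by positivity
    have X := fineX h0 h1 ha0 ha1 hb0 hb1
    have X2 := fineX2 h0 h1 ha0 ha1 hb0 hb1
    have hab : a + b ≤ C1 * ε := by linarith
    have Z1 : h * (a + b) ≤ 2 * Θ * C1 * ε ^ (2*r) + C3 / 2 * ε ^ (2 * r) := by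
      have : h * (a + b) ≤ h * (C1 * ε) := by gcongr
      have z1 : 2 * (1 - r) * θ * ε * (C1 * ε) ≤ 2 * 1 * Θ * ε * (C1 * ε) := by gcongr; linarith
      have z2 : C3 * ε ^ (2 * r) * (C1 * ε) ≤ C3 * ε ^ (2 * r) * (1 / 2) := by gcongr
      have z3 : 2 * Θ * C1 * ε ^ 2 ≤ 2 * Θ * C1 * ε ^ (2 * r) := by gcongr
      rw [hh] at this ⊢
      linarith
    have Z2 : a * b ≤ C1 ^ 2 / 4 * ε ^ (2 * r) := by
      have : (a + b) ^ 2 ≤ (C1 * ε) ^ 2 := by gcongr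
      have z3 : C1 ^ 2 / 4 * ε ^ 2 ≤ C1 ^ 2 / 4 * ε ^ (2 * r) := by gcongr
      have := sq_nonneg (a - b)
      linarith
    have Z3 : 2 * ((1 - r) * θ * (2 * ε ^ 2)) ≤ 4 * Θ * ε ^ (2 * r) := by
      have : (1 - r) * θ * ε ^ 2 ≤ 1 * Θ * ε ^ (2 * r) := by gcongr; linarith
      linarith
    have Z4 : 2 * (2 * C1 ^ (2 * r) + C1 ^ 2 / 4 + 2 * Θ * C1 + 4 * Θ) * ε ^ (2*r) < C3 * ε ^ (2*r) :=
      mul_lt_mul_of_pos_right hC3 hE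
    have W : ((1 - a) * (1 - b)) ^ r * (1 - h) ≤ 1 - r * (a + b) + a * b - h + h * (a + b) := by
      have := mul_le_mul_of_nonneg_left X2 hh0
      linarith
    rw [hh] at W
    linarith

lemma localLarge {r Θ : ℝ} (h0 : 1 / 2 < r) (h1 : r < 1) (hΘ : 1 ≤ Θ) :
    ∃ P0 : ℕ, ∃ C3 : ℝ, 2 ≤ P0 ∧ 0 < C3 ∧ ∀ P : ℕ, P0 ≤ P →
      2 * (1 - r) * Θ * (1 / (P:ℝ)) + C3 * (1 / (P:ℝ)) ^ (2 * r) ≤ 1 / 2 ∧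
      ∀ θ, 1 ≤ θ → θ ≤ Θ → LocalOK r (cL r C3 θ (1 / (P:ℝ))) := by
  set C1 := 64 * 4 ^ (r / (1 - r)) * Θ with hC1
  set C3 := 2 * (2 * C1 ^ (2 * r) + C1 ^ 2 / 4 + 2 * Θ * C1 + 4 * Θ) + 1 with hC3
  set s0 : ℝ := min (1 / 2) ((1 / 8) ^ (1 / (2 * r - 1))) with hs0
  have hC1p : 0 < C1 := by positivity
  have hC3p : 0 < C3 := by positivity
  have hs0p : 0 < s0 := lt_min (by norm_num) (by positivity)
  have hs01 : s0 < 1 := (min_le_left _ _).trans_lt (by norm_num)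
  have hs : s0 ^ (2 * r - 1) ≤ 1 / 8 := by
    calc s0 ^ (2 * r - 1) ≤ ((1 / 8 : ℝ) ^ (1 / (2 * r - 1))) ^ (2 * r - 1) :=
          Real.rpow_le_rpow hs0p.le (min_le_right _ _) (by linarith)
      _ = 1 / 8 := by
          rw [← Real.rpow_mul (by norm_num), one_div_mul_cancel (by linarith), Real.rpow_one]
  have heta : 0 < 1 - (1 - s0) ^ (r - 1 / 2) := by
    have := Real.rpow_lt_one (by linarith : 0 ≤ 1 - s0) (by linarith) (by linarith : 0 < r - 1 / 2)
    linarith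
  have tP : Filter.Tendsto (fun P : ℕ => 1 / (P:ℝ)) Filter.atTop (nhds 0) := tendsto_one_div_atTop_nhds_zero_nat
  have tpow : ∀ s : ℝ, 0 < s → ∀ c : ℝ, Filter.Tendsto (fun P : ℕ => c * (1 / (P:ℝ)) ^ s) Filter.atTop (nhds 0) := by
    intro s hs c
    have := (tP.rpow_const (p := s) (Or.inr hs.le)).const_mul c
    rwa [Real.zero_rpow hs.ne', mul_zero] at this
  have tlin : ∀ c : ℝ, Filter.Tendsto (fun P : ℕ => c * (1 / (P:ℝ))) Filter.atTop (nhds 0) := by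
    intro c; simpa using tP.const_mul c
  have ev := ((tlin 1).eventually_le_const (show (0:ℝ) < 1 / 2 by norm_num)).and
    (((tlin C1).eventually_le_const (show (0:ℝ) < 1 / 2 by norm_num)).and
    (((tpow (1 - r) (by linarith) 1).eventually_le_const (show (0:ℝ) < 1 / 2 by norm_num)).and
    (((tpow (1 - r) (by linarith) (4 * Θ)).eventually_le_const (show (0:ℝ) < 1 by norm_num)).and
    (((tpow (1 - r) (by linarith) (4 * Θ)).eventually_lt_const heta).and
    (((tlin (2 * (1 - r) * Θ)).eventually_le_const (show (0:ℝ) < 1 / 4 by norm_num)).and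
    ((tpow (2 * r) (by linarith) C3).eventually_le_const (show (0:ℝ) < 1 / 4 by norm_num)))))))
  obtain ⟨N, hN⟩ := Filter.eventually_atTop.1 ev
  refine ⟨max N 2, C3, le_max_right _ _, hC3p, ?_⟩
  intro P hP
  have hP2 : 2 ≤ P := (le_max_right _ _).trans hP
  obtain ⟨e1, e2, e3, e4, e5, e6, e7⟩ := hN P ((le_max_left _ _).trans hP)
  refine ⟨by linarith, ?_⟩
  intro θ hθ1 hθ
  rw [one_mul] at e1 e3
  exact localLarge_core h0 h1 hθ1 hθ (by positivity) e1 hs0p hs01 hs hC1 (by rw [hC3]; linarith) e2 e3 e4 e5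

end QDS

namespace QDS
open Finset

noncomputable def me (μ : ℕ → ℝ) (E : Finset (ℕ × ℕ)) : ℝ := ∑ p ∈ E, μ p.1 * μ p.2

lemma me_nonneg {μ : ℕ → ℝ} (hμ : ∀ v, 0 ≤ μ v) (E : Finset (ℕ × ℕ)) : 0 ≤ me μ E :=
  sum_nonneg fun _ _ => mul_nonneg (hμ _) (hμ _)

lemma me_le_mul {μ : ℕ → ℝ} (hμ : ∀ v, 0 ≤ μ v) {E : Finset (ℕ × ℕ)} {V W : Finset ℕ}
    (h : E ⊆ V ×ˢ W) : me μ E ≤ (∑ v ∈ V, μ v) * ∑ w ∈ W, μ w := by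
  unfold me
  rw [sum_mul_sum, ← sum_product']
  exact sum_le_sum_of_subset_of_nonneg h fun _ _ _ => mul_nonneg (hμ _) (hμ _)

lemma indStep {r : ℝ} {c : ℕ → ℕ → ℝ} (hL : LocalOK r c) (hc : ∀ k l, 0 ≤ c k l)
    {μ : ℕ → ℝ} (hμ : ∀ v, 0 ≤ μ v) (P : ℕ) (V W : Finset ℕ) (E : Finset (ℕ × ℕ))
    (hE : E ⊆ V ×ˢ W) (hpos : 0 < me μ E) :
    ∃ k l : ℕ, ∃ V' ⊆ V, ∃ W' ⊆ W, ∃ E' ⊆ E, E' ⊆ V' ×ˢ W' ∧ (∀ v ∈ V', P ^ k ∣ v) ∧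
      (∀ w ∈ W', P ^ l ∣ w) ∧
      (∀ p ∈ E', min (p.1.factorization P) (p.2.factorization P) = min k l) ∧ 0 < me μ E' ∧
      me μ E * ((∑ v ∈ V', μ v) * ∑ w ∈ W', μ w) ^ r * c k l ≤
        me μ E' * ((∑ v ∈ V, μ v) * ∑ w ∈ W, μ w) ^ r := by
  by_contra hcon
  have fail : ∀ k l : ℕ, ∀ V' ⊆ V, ∀ W' ⊆ W, ∀ E' ⊆ E, E' ⊆ V' ×ˢ W' → (∀ v ∈ V', P ^ k ∣ v) →
      (∀ w ∈ W', P ^ l ∣ w) →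
      (∀ p ∈ E', min (p.1.factorization P) (p.2.factorization P) = min k l) →
      me μ E' * ((∑ v ∈ V, μ v) * ∑ w ∈ W, μ w) ^ r ≤
      me μ E * ((∑ v ∈ V', μ v) * ∑ w ∈ W', μ w) ^ r * c k l := by
    intro k l V' hV' W' hW' E' hE' h1 h2 h3 h4
    by_contra hlt
    push Not at hlt
    refine hcon ⟨k, l, V', hV', W', hW', E', hE', h1, h2, h3, h4, ?_, hlt.le⟩
    rcases (me_nonneg hμ E').eq_or_lt with h | h
    · rw [← h, zero_mul] at hlt
      have : 0 ≤ me μ E * ((∑ v ∈ V', μ v) * ∑ w ∈ W', μ w) ^ r * c k l :=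
        mul_nonneg (mul_nonneg hpos.le (Real.rpow_nonneg
          (mul_nonneg (sum_nonneg fun _ _ => hμ _) (sum_nonneg fun _ _ => hμ _)) _)) (hc k l)
      linarith
    · exact h
  set mV := ∑ v ∈ V, μ v with hmV
  set mW := ∑ w ∈ W, μ w with hmW
  have hmV0 : 0 ≤ mV := sum_nonneg fun _ _ => hμ _
  have hmW0 : 0 ≤ mW := sum_nonneg fun _ _ => hμ _
  have hVW : 0 < mV * mW := hpos.trans_le (me_le_mul hμ hE)
  have hVp : 0 < mV := by by_contra h; have : mV = 0 := le_antisymm (not_lt.1 h) hmV0; rw [this] at hVW; simp at hVW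
  have hWp : 0 < mW := by by_contra h; have : mW = 0 := le_antisymm (not_lt.1 h) hmW0; rw [this] at hVW; simp at hVW
  obtain ⟨M, hMV, hMW⟩ : ∃ M, (∀ v ∈ V, v.factorization P < M) ∧ (∀ v ∈ W, v.factorization P < M) := by
    refine ⟨(V ∪ W).sup (fun v => v.factorization P) + 1, ?_, ?_⟩
    · intro v hv
      exact Nat.lt_succ_of_le (le_sup (f := fun v => v.factorization P) (mem_union_left _ hv))
    · intro v hv
      exact Nat.lt_succ_of_le (le_sup (f := fun v => v.factorization P) (mem_union_right _ hv))
  let x : ℕ → ℝ := fun i => (∑ v ∈ V.filter (fun v => v.factorization P = i), μ v) / mV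
  let y : ℕ → ℝ := fun i => (∑ v ∈ W.filter (fun v => v.factorization P = i), μ v) / mW
  let Eij : ℕ → ℕ → Finset (ℕ × ℕ) := fun i j =>
    E.filter (fun p => p.1.factorization P = i ∧ p.2.factorization P = j)
  let e : ℕ → ℕ → ℝ := fun i j => me μ (Eij i j) / me μ E
  have key : ∀ k l : ℕ, ∀ V' ⊆ V, ∀ W' ⊆ W, ∀ E' ⊆ E, E' ⊆ V' ×ˢ W' → (∀ v ∈ V', P ^ k ∣ v) →
      (∀ w ∈ W', P ^ l ∣ w) →
      (∀ p ∈ E', min (p.1.factorization P) (p.2.factorization P) = min k l) →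
      me μ E' / me μ E ≤
      ((∑ v ∈ V', μ v) / mV * ((∑ w ∈ W', μ w) / mW)) ^ r * c k l := by
    intro k l V' hV' W' hW' E' hE' h1 h2 h3 h4
    have := fail k l V' hV' W' hW' E' hE' h1 h2 h3 h4
    have hr : 0 < (mV * mW) ^ r := by positivity
    rw [div_mul_div_comm, Real.div_rpow (mul_nonneg (sum_nonneg fun _ _ => hμ _) (sum_nonneg fun _ _ => hμ _)) hVW.le,
      div_mul_eq_mul_div, div_le_div_iff₀ hpos hr]
    linarith
  have h := hL M x y e (fun i => div_nonneg (sum_nonneg fun _ _ => hμ _) hmV0)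
    (fun i => div_nonneg (sum_nonneg fun _ _ => hμ _) hmW0) ?_ ?_ ?_ ?_ ?_
  · have htot : ∑ i ∈ range M, ∑ j ∈ range M, e i j = 1 := by
      simp only [e]
      simp_rw [← sum_div]
      rw [div_eq_one_iff_eq hpos.ne']
      simp only [Eij, me]
      rw [← sum_fiberwise_of_maps_to (s := E) (t := range M ×ˢ range M)
        (g := fun p => (p.1.factorization P, p.2.factorization P)), sum_product]
      · simp only [Prod.mk.injEq]
      · intro p hp
        have := mem_product.1 (hE hp)
        simp only [mem_product, mem_range]
        exact ⟨hMV _ this.1, hMW _ this.2⟩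
    linarith
  · simp only [x]
    rw [← sum_div, div_eq_one_iff_eq hVp.ne']
    exact sum_fiberwise_of_maps_to (fun v hv => mem_range.2 (hMV v hv)) _
  · simp only [y]
    rw [← sum_div, div_eq_one_iff_eq hWp.ne']
    exact sum_fiberwise_of_maps_to (fun v hv => mem_range.2 (hMW v hv)) _
  · intro i _ j _ _
    apply key i j _ (filter_subset _ _) _ (filter_subset _ _) _ (filter_subset _ _)
    · intro p hp
      rw [mem_filter] at hp
      have := mem_product.1 (hE hp.1)
      simp [this, hp.2]
    · intro v hv
      rw [← (mem_filter.1 hv).2]; exact Nat.ordProj_dvd _ _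
    · intro v hv
      rw [← (mem_filter.1 hv).2]; exact Nat.ordProj_dvd _ _
    · intro p hp
      rw [(mem_filter.1 hp).2.1, (mem_filter.1 hp).2.2]
  · intro k hk
    have hx : ∑ i ∈ (range M).filter (fun i => k ≤ i), x i =
        (∑ v ∈ V.filter (fun v => k ≤ v.factorization P), μ v) / mV := by
      simp only [x]
      rw [← sum_div]
      congr 1
      rw [← sum_fiberwise_of_maps_to (s := V.filter (fun v => k ≤ v.factorization P))
        (t := (range M).filter (fun i => k ≤ i)) (g := fun v => v.factorization P)]
      · apply sum_congr rfl; intro i hi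
        rw [filter_filter]
        apply sum_congr _ (fun _ _ => rfl)
        apply filter_congr; intro v _
        have := (mem_filter.1 hi).2
        constructor
        · intro h; exact ⟨by omega, h⟩
        · intro h; exact h.2
      · intro v hv
        rw [mem_filter] at hv ⊢
        exact ⟨mem_range.2 (hMV v hv.1), hv.2⟩
    have hy : ∑ i ∈ (range M).filter (fun i => k ≤ i), y i =
        (∑ v ∈ W.filter (fun v => k ≤ v.factorization P), μ v) / mW := by
      simp only [y]
      rw [← sum_div]
      congr 1
      rw [← sum_fiberwise_of_maps_to (s := W.filter (fun v => k ≤ v.factorization P))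
        (t := (range M).filter (fun i => k ≤ i)) (g := fun v => v.factorization P)]
      · apply sum_congr rfl; intro i hi
        rw [filter_filter]
        apply sum_congr _ (fun _ _ => rfl)
        apply filter_congr; intro v _
        have := (mem_filter.1 hi).2
        constructor
        · intro h; exact ⟨by omega, h⟩
        · intro h; exact h.2
      · intro v hv
        rw [mem_filter] at hv ⊢
        exact ⟨mem_range.2 (hMW v hv.1), hv.2⟩
    have he : ∑ i ∈ range M, ∑ j ∈ range M, (if min i j = k then e i j else 0) =
        me μ (E.filter (fun p => min (p.1.factorization P) (p.2.factorization P) = k)) / me μ E := by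
      have : ∀ i j, (if min i j = k then e i j else 0) = (if min i j = k then me μ (Eij i j) else 0) / me μ E := by
        intro i j; split_ifs <;> simp [e]
      simp_rw [this, ← sum_div]
      congr 1
      simp only [Eij, me]
      rw [← sum_fiberwise_of_maps_to
        (s := E.filter (fun p => min (p.1.factorization P) (p.2.factorization P) = k)) (t := range M ×ˢ range M)
        (g := fun p => (p.1.factorization P, p.2.factorization P)), sum_product]
      · apply sum_congr rfl; intro i _
        apply sum_congr rfl; intro j _
        rw [filter_filter]
        simp only [Prod.mk.injEq]
        split_ifs with h
        · apply sum_congr _ (fun _ _ => rfl)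
          apply filter_congr; intro p _
          constructor
          · rintro ⟨h1, h2⟩; exact ⟨by rw [h1, h2]; exact h, h1, h2⟩
          · intro h; exact h.2
        · symm; apply sum_eq_zero
          intro p hp
          obtain ⟨h1, h2, h3⟩ := (mem_filter.1 hp).2
          rw [h2, h3] at h1; exact absurd h1 h
      · intro p hp
        have := mem_product.1 (hE (mem_filter.1 hp).1)
        simp only [mem_product, mem_range]
        exact ⟨hMV _ this.1, hMW _ this.2⟩
    rw [hx, hy, he]
    apply key k k _ (filter_subset _ _) _ (filter_subset _ _) _ (filter_subset _ _)
    · intro p hp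
      rw [mem_filter] at hp
      have := mem_product.1 (hE hp.1)
      simp only [mem_product, mem_filter, this, true_and]
      have := hp.2
      omega
    · intro v hv
      exact (pow_dvd_pow _ (mem_filter.1 hv).2).trans (Nat.ordProj_dvd _ _)
    · intro v hv
      exact (pow_dvd_pow _ (mem_filter.1 hv).2).trans (Nat.ordProj_dvd _ _)
    · intro p hp
      rw [(mem_filter.1 hp).2, min_self]
  · intro k _
    apply key k k _ (filter_subset _ _) _ (filter_subset _ _) _ (filter_subset _ _)
    · intro p hp
      rw [mem_filter] at hp
      have := mem_product.1 (hE hp.1)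
      simp [this, hp.2]
    · intro v hv
      rw [← (mem_filter.1 hv).2]; exact Nat.ordProj_dvd _ _
    · intro v hv
      rw [← (mem_filter.1 hv).2]; exact Nat.ordProj_dvd _ _
    · intro p hp
      rw [(mem_filter.1 hp).2.1, (mem_filter.1 hp).2.2]

lemma induct {r : ℝ} {c : ℕ → ℕ → ℕ → ℝ} (hL : ∀ P, P.Prime → LocalOK r (c P))
    (hc : ∀ P, P.Prime → ∀ k l, 0 ≤ c P k l)
    {μ : ℕ → ℝ} (hμ : ∀ v, 0 ≤ μ v) (S : Finset ℕ) (E0 : Finset (ℕ × ℕ))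
    (hE0 : E0 ⊆ S ×ˢ S) (hpos : 0 < me μ E0) (T : Finset ℕ) (hT : ∀ P ∈ T, P.Prime) :
    ∃ V ⊆ S, ∃ W ⊆ S, ∃ E ⊆ E0, ∃ a b : ℕ, E ⊆ V ×ˢ W ∧ a ≠ 0 ∧ b ≠ 0 ∧
      (∀ P, P ∉ T → a.factorization P = 0) ∧ (∀ P, P ∉ T → b.factorization P = 0) ∧
      (∀ v ∈ V, a ∣ v) ∧ (∀ w ∈ W, b ∣ w) ∧
      (∀ p ∈ E, ∀ P ∈ T, min (p.1.factorization P) (p.2.factorization P) =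
        min (a.factorization P) (b.factorization P)) ∧ 0 < me μ E ∧
      me μ E0 * ((∑ v ∈ V, μ v) * ∑ w ∈ W, μ w) ^ r *
        ∏ P ∈ T, c P (a.factorization P) (b.factorization P) ≤
        me μ E * ((∑ v ∈ S, μ v) * ∑ w ∈ S, μ w) ^ r := by
  induction T using Finset.induction_on with
  | empty =>
    exact ⟨S, Subset.rfl, S, Subset.rfl, E0, Subset.rfl, 1, 1, hE0, one_ne_zero, one_ne_zero,
      by simp, by simp, by simp, by simp, by simp, hpos, by simp⟩
  | insert P T hPT ih =>
    obtain ⟨V, hV, W, hW, E, hE, a, b, hEVW, ha, hb, haT, hbT, hav, hbw, hmin, hp, hle⟩ :=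
      ih (fun Q hQ => hT Q (mem_insert_of_mem hQ))
    have hP : P.Prime := hT P (mem_insert_self _ _)
    obtain ⟨k, l, V', hV', W', hW', E', hE', hEVW', hk, hl, hmin', hp', hle'⟩ :=
      indStep (hL P hP) (hc P hP) hμ P V W E hEVW hp
    have fac : ∀ (a k : ℕ), a ≠ 0 → ∀ Q, (a * P ^ k).factorization Q =
        a.factorization Q + if Q = P then k else 0 := by
      intro a k ha Q
      rw [Nat.factorization_mul ha (pow_ne_zero _ hP.ne_zero), Nat.factorization_pow, hP.factorization]
      simp only [Finsupp.add_apply, Finsupp.smul_apply, Finsupp.single_apply, smul_eq_mul]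
      by_cases h : Q = P
      · simp [h]
      · simp [h, Ne.symm h]
    have cop : ∀ a : ℕ, a ≠ 0 → a.factorization P = 0 → ∀ k, Nat.Coprime a (P ^ k) := by
      intro a ha h k
      apply Nat.Coprime.pow_right
      rw [Nat.coprime_comm, hP.coprime_iff_not_dvd]
      intro hd
      have := (hP.factorization_pos_of_dvd ha hd); omega
    refine ⟨V', hV'.trans hV, W', hW'.trans hW, E', hE'.trans hE, a * P ^ k, b * P ^ l, hEVW',
      mul_ne_zero ha (pow_ne_zero _ hP.ne_zero), mul_ne_zero hb (pow_ne_zero _ hP.ne_zero),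
      ?_, ?_, ?_, ?_, ?_, hp', ?_⟩
    · intro Q hQ
      rw [mem_insert, not_or] at hQ
      rw [fac a k ha, haT Q hQ.2]; simp [hQ.1]
    · intro Q hQ
      rw [mem_insert, not_or] at hQ
      rw [fac b l hb, hbT Q hQ.2]; simp [hQ.1]
    · intro v hv
      exact (cop a ha (haT P hPT) k).mul_dvd_of_dvd_of_dvd (hav v (hV' hv)) (hk v hv)
    · intro v hv
      exact (cop b hb (hbT P hPT) l).mul_dvd_of_dvd_of_dvd (hbw v (hW' hv)) (hl v hv)
    · intro p hp Q hQ
      rw [fac a k ha, fac b l hb]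
      rcases mem_insert.1 hQ with h | h
      · subst h
        rw [haT _ hPT, hbT _ hPT, hmin' p hp]; simp
      · have : Q ≠ P := by rintro rfl; exact hPT h
        simp only [this, if_false, add_zero]
        exact hmin p (hE' hp) Q h
    · rw [prod_insert hPT]
      have e1 : ∏ Q ∈ T, c Q ((a * P ^ k).factorization Q) ((b * P ^ l).factorization Q) =
          ∏ Q ∈ T, c Q (a.factorization Q) (b.factorization Q) := by
        apply prod_congr rfl; intro Q hQ
        have : Q ≠ P := by rintro rfl; exact hPT hQ
        rw [fac a k ha, fac b l hb]; simp [this]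
      rw [e1, fac a k ha, fac b l hb, haT P hPT, hbT P hPT]
      simp only [if_true, zero_add]
      set pi0 := ∏ Q ∈ T, c Q (a.factorization Q) (b.factorization Q) with hpi
      have hpi0 : 0 ≤ pi0 := prod_nonneg fun Q hQ => hc Q (hT Q (mem_insert_of_mem hQ)) _ _
      set X := ((∑ v ∈ V, μ v) * ∑ w ∈ W, μ w) ^ r with hX
      set X' := ((∑ v ∈ V', μ v) * ∑ w ∈ W', μ w) ^ r with hX'
      set XS := ((∑ v ∈ S, μ v) * ∑ w ∈ S, μ w) ^ r with hXS
      have hXp : 0 < X := by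
        apply Real.rpow_pos_of_pos
        exact hp.trans_le (me_le_mul hμ hEVW)
      have hX'0 : 0 ≤ X' := Real.rpow_nonneg
        (mul_nonneg (sum_nonneg fun _ _ => hμ _) (sum_nonneg fun _ _ => hμ _)) _
      have hXS0 : 0 ≤ XS := Real.rpow_nonneg
        (mul_nonneg (sum_nonneg fun _ _ => hμ _) (sum_nonneg fun _ _ => hμ _)) _
      have hck := hc P hP k l
      have hmul : (me μ E0 * X' * (c P k l * pi0)) * (me μ E * X) ≤ (me μ E' * XS) * (me μ E * X) := by
        have := mul_le_mul hle hle' (mul_nonneg (mul_nonneg hp.le hX'0) hck) (mul_nonneg hp.le hXS0)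
        linarith
      exact le_of_mul_le_mul_right hmul (mul_pos hp hXp)

end QDS

namespace QDS
open Finset

lemma sumMult (h : ℕ → ℝ) (T : Finset ℕ) (hT : ∀ P ∈ T, P.Prime) (hh : ∀ P ∈ T, 1 ≤ h P)
    (N : ℕ) (M : Finset ℕ) (hM : ∀ m ∈ M, 1 ≤ m ∧ m ≤ N) (hMT : ∀ m ∈ M, m.primeFactors ⊆ T) :
    ∑ m ∈ M, ∏ P ∈ m.primeFactors, h P ≤ N * ∏ P ∈ T, (1 + (h P - 1) / P) := by
  have e1 : ∀ m ∈ M, ∏ P ∈ m.primeFactors, h P =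
      ∑ D ∈ T.powerset, if (∏ P ∈ D, P) ∣ m then ∏ P ∈ D, (h P - 1) else 0 := by
    intro m hm
    have : ∏ P ∈ m.primeFactors, h P = ∏ P ∈ T, ((if P ∣ m then h P - 1 else 0) + 1) := by
      rw [← prod_subset (hMT m hm)]
      · apply prod_congr rfl; intro P hP
        simp [Nat.dvd_of_mem_primeFactors hP]
      · intro P hP hn
        have : ¬ P ∣ m := fun hd => hn (Nat.mem_primeFactors.2 ⟨hT P hP, hd, by have := (hM m hm).1; omega⟩)
        simp [this]
    rw [this, prod_add_one]
    apply sum_congr rfl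
    intro D hD
    have hD' := mem_powerset.1 hD
    split_ifs with hd
    · apply prod_congr rfl; intro P hP
      have : P ∣ m := (dvd_prod_of_mem (fun P => P) hP).trans hd
      simp [this]
    · by_contra hne
      apply hd
      apply prod_primes_dvd
      · intro P hP; exact (hT P (hD' hP)).prime
      · intro P hP
        by_contra hn
        apply hne
        apply prod_eq_zero hP; simp [hn]
  rw [sum_congr rfl e1, sum_comm]
  have e2 : ∏ P ∈ T, (1 + (h P - 1) / P) = ∑ D ∈ T.powerset, ∏ P ∈ D, ((h P - 1) / P) := by
    rw [← prod_add_one]; apply prod_congr rfl; intro P _; ring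
  rw [e2, mul_sum]
  apply sum_le_sum
  intro D hD
  have hD' := mem_powerset.1 hD
  rw [← sum_filter, sum_const, prod_div_distrib, nsmul_eq_mul]
  have hp : 0 ≤ ∏ P ∈ D, (h P - 1) := prod_nonneg fun P hP => by have := hh P (hD' hP); linarith
  have hcard : ((M.filter (fun m => (∏ P ∈ D, P) ∣ m)).card : ℝ) ≤ N / (∏ P ∈ D, (P:ℝ)) := by
    have : (M.filter (fun m => (∏ P ∈ D, P) ∣ m)).card ≤ N / (∏ P ∈ D, P) := by
      rw [← Nat.Ioc_filter_dvd_card_eq_div]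
      apply card_le_card
      intro m hm
      rw [mem_filter] at hm ⊢
      have := hM m hm.1
      exact ⟨mem_Ioc.2 ⟨by omega, this.2⟩, hm.2⟩
    calc ((M.filter (fun m => (∏ P ∈ D, P) ∣ m)).card : ℝ) ≤ ((N / (∏ P ∈ D, P) : ℕ) : ℝ) := by exact_mod_cast this
      _ ≤ (N:ℝ) / ((∏ P ∈ D, P : ℕ) : ℝ) := Nat.cast_div_le
      _ = _ := by push_cast; rfl
  calc _ ≤ (N / (∏ P ∈ D, (P:ℝ))) * ∏ P ∈ D, (h P - 1) := mul_le_mul_of_nonneg_right hcard hp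
    _ = _ := by ring

lemma minDegree {μ : ℕ → ℝ} (V W : Finset ℕ) (hV : ∀ v ∈ V, 0 < μ v) (hW : ∀ v ∈ W, 0 < μ v)
    (E : Finset (ℕ × ℕ)) (hE : E ⊆ V ×ˢ W) (hpos : 0 < me μ E) :
    ∃ V' ⊆ V, ∃ W' ⊆ W, W'.Nonempty ∧
      (∀ w ∈ W', me μ E / (3 * ∑ w ∈ W, μ w) ≤ ∑ v ∈ V'.filter (fun v => (v, w) ∈ E), μ v) ∧
      (∀ v ∈ V', me μ E / (3 * ∑ v ∈ V, μ v) ≤ ∑ w ∈ W'.filter (fun w => (v, w) ∈ E), μ w) := by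
  set mV := ∑ v ∈ V, μ v with hmV
  set mW := ∑ w ∈ W, μ w with hmW
  obtain ⟨p0, hp0⟩ : E.Nonempty := by
    rw [nonempty_iff_ne_empty]; rintro rfl; simp [me] at hpos
  have hp0' := mem_product.1 (hE hp0)
  have hVp : 0 < mV := sum_pos hV ⟨_, hp0'.1⟩
  have hWp : 0 < mW := sum_pos hW ⟨_, hp0'.2⟩
  set c1 := me μ E / (3 * mV) with hc1
  set c2 := me μ E / (3 * mW) with hc2
  let f : ℕ → ℕ → ℝ := fun v w => if (v, w) ∈ E then μ v * μ w else 0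
  let G : Finset ℕ × Finset ℕ → ℝ := fun p => ∑ v ∈ p.1, ∑ w ∈ p.2, f v w - c1 * ∑ v ∈ p.1, μ v - c2 * ∑ w ∈ p.2, μ w
  obtain ⟨⟨V', W'⟩, hmem, hmax⟩ := exists_max_image (V.powerset ×ˢ W.powerset) G
    ⟨(∅, ∅), by simp⟩
  simp only [mem_product, mem_powerset] at hmem
  have hG : 0 < G (V', W') := by
    have h1 := hmax (V, W) (by simp)
    have h2 : G (V, W) = me μ E / 3 := by
      simp only [G, f]
      have : ∑ v ∈ V, ∑ w ∈ W, (if (v, w) ∈ E then μ v * μ w else 0) = me μ E := by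
        rw [← sum_product' V W (fun v w => if (v, w) ∈ E then μ v * μ w else 0), ← sum_filter,
          filter_mem_eq_inter, inter_eq_right.2 hE]
        rfl
      rw [this, ← hmV, ← hmW, hc1, hc2]
      field_simp; ring
    rw [h2] at h1; linarith
  have c1p : 0 < c1 := by positivity
  have c2p : 0 < c2 := by positivity
  refine ⟨V', hmem.1, W', hmem.2, ?_, ?_, ?_⟩
  · rw [nonempty_iff_ne_empty]; rintro rfl
    simp only [G, sum_empty, sum_const_zero, mul_zero, sub_zero, zero_sub] at hG
    have : 0 ≤ ∑ v ∈ V', μ v := sum_nonneg fun v hv => (hV v (hmem.1 hv)).le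
    have := mul_nonneg c1p.le this
    linarith
  · intro w hw
    have h := hmax (V', W'.erase w) (by
      simp only [mem_product, mem_powerset]; exact ⟨hmem.1, (erase_subset _ _).trans hmem.2⟩)
    simp only [G] at h
    have e1 : ∑ v ∈ V', ∑ w ∈ W', f v w = ∑ v ∈ V', f v w + ∑ v ∈ V', ∑ w ∈ W'.erase w, f v w := by
      rw [← sum_add_distrib]; apply sum_congr rfl; intro v _; rw [add_sum_erase _ _ hw]
    have e2 := add_sum_erase W' μ hw
    have e3 : ∑ v ∈ V', f v w = μ w * ∑ v ∈ V'.filter (fun v => (v, w) ∈ E), μ v := by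
      simp only [f]; rw [← sum_filter, mul_sum]; apply sum_congr rfl; intros; ring
    rw [e1, ← e2, e3] at h
    have : μ w * c2 ≤ μ w * ∑ v ∈ V'.filter (fun v => (v, w) ∈ E), μ v := by linarith
    exact le_of_mul_le_mul_left this (hW w (hmem.2 hw))
  · intro v hv
    have h := hmax (V'.erase v, W') (by
      simp only [mem_product, mem_powerset]; exact ⟨(erase_subset _ _).trans hmem.1, hmem.2⟩)
    simp only [G] at h
    have e1 := add_sum_erase V' (fun v => ∑ w ∈ W', f v w) hv
    have e2 := add_sum_erase V' μ hv
    have e3 : ∑ w ∈ W', f v w = μ v * ∑ w ∈ W'.filter (fun w => (v, w) ∈ E), μ w := by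
      simp only [f]; rw [← sum_filter, mul_sum]
    rw [← e1, ← e2, e3] at h
    have : μ v * c1 ≤ μ v * ∑ w ∈ W'.filter (fun w => (v, w) ∈ E), μ w := by linarith
    exact le_of_mul_le_mul_left this (hV v (hmem.1 hv))

lemma phi_div {v : ℕ} (hv : v ≠ 0) :
    (Nat.totient v : ℝ) / v = ∏ P ∈ v.primeFactors, (1 - 1 / (P:ℝ)) := by
  have h := Nat.totient_eq_mul_prod_factors v
  have h' : (Nat.totient v : ℝ) = v * ∏ p ∈ v.primeFactors, (1 - (p:ℝ)⁻¹) := by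
    have := congrArg (fun q : ℚ => (q : ℝ)) h
    push_cast at this
    exact this
  have hv' : (v:ℝ) ≠ 0 := by exact_mod_cast hv
  rw [h', mul_div_cancel_left₀ _ hv']
  simp

lemma one_sub_inv_mem {P : ℕ} (hP : P.Prime) : 0 ≤ 1 - 1 / (P:ℝ) ∧ 1 - 1 / (P:ℝ) ≤ 1 := by
  have : (1:ℝ) ≤ P := by exact_mod_cast hP.one_lt.le
  have h1 : 1 / (P:ℝ) ≤ 1 := by rw [div_le_one (by linarith)]; exact this
  have : 0 ≤ 1 / (P:ℝ) := by positivity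
  constructor <;> linarith

lemma phi_ratio {a v : ℕ} (hv : v ≠ 0) (h : a ∣ v) :
    (Nat.totient v : ℝ) / v ≤ (Nat.totient a : ℝ) / a := by
  have ha : a ≠ 0 := fun h0 => hv (by rw [h0] at h; exact zero_dvd_iff.1 h)
  rw [phi_div hv, phi_div ha]
  have hs := Nat.primeFactors_mono h hv
  rw [← prod_sdiff hs]
  apply mul_le_of_le_one_left
  · exact prod_nonneg fun P hP => (one_sub_inv_mem (Nat.prime_of_mem_primeFactors hP)).1
  · apply prod_le_one
    · exact fun P hP => (one_sub_inv_mem (Nat.prime_of_mem_primeFactors (mem_sdiff.1 hP).1)).1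
    · exact fun P hP => (one_sub_inv_mem (Nat.prime_of_mem_primeFactors (mem_sdiff.1 hP).1)).2

noncomputable def fk (κ : ℕ → ℝ) (m : ℕ) : ℝ := ∏ P ∈ m.primeFactors, κ P

noncomputable def muw (ψ : ℕ → ℝ) (v : ℕ) : ℝ := ψ v * ((Nat.totient v : ℝ) / v)

lemma finalCount {ψ κ : ℕ → ℝ} {t K : ℝ} {g a b : ℕ} (A : ℕ) (T V W : Finset ℕ) (E : Finset (ℕ × ℕ))
    (hT : ∀ P ∈ T, P.Prime) (hκ : ∀ P ∈ T, 1 ≤ κ P) (hK : 0 < K) (ht : 0 < t)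
    (ha : a ≠ 0) (hb : b ≠ 0)
    (hV0 : ∀ v ∈ V, v ≠ 0) (hW0 : ∀ v ∈ W, v ≠ 0)
    (hVψ : ∀ v ∈ V, 0 < ψ v) (hWψ : ∀ v ∈ W, 0 < ψ v)
    (hVT : ∀ v ∈ V, v.primeFactors ⊆ T)
    (hE : E ⊆ V ×ˢ W) (haV : ∀ v ∈ V, a ∣ v) (hbW : ∀ w ∈ W, b ∣ w)
    (h1 : ∀ p ∈ E, p.1 * ψ p.2 ≤ t * g) (h2 : ∀ p ∈ E, p.2 * ψ p.1 ≤ t * g)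
    (hk : ∀ p ∈ E, K ≤ fk κ (p.1 / a) ^ 2) :
    me (muw ψ) E ^ 2 * K ^ A * (a * b) ≤ 9 * t ^ 2 * g ^ 2 * (∏ P ∈ T, (1 + (κ P ^ (2 * A) - 1) / P)) *
      ((Nat.totient a : ℝ) / a) * ((Nat.totient b : ℝ) / b) *
      ((∑ v ∈ V, muw ψ v) * ∑ w ∈ W, muw ψ w) := by
  set μ := muw ψ with hμ
  have hmu : ∀ v, v ≠ 0 → 0 < ψ v → 0 < μ v := by
    intro v hv h
    have : 0 < Nat.totient v := Nat.totient_pos.2 (Nat.pos_of_ne_zero hv)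
    simp only [hμ, muw]; positivity
  set Z := ∏ P ∈ T, (1 + (κ P ^ (2 * A) - 1) / P) with hZ
  have hZ0 : 0 ≤ Z := prod_nonneg fun P hP => by
    have : 1 ≤ κ P ^ (2 * A) := one_le_pow₀ (hκ P hP)
    have : 0 ≤ (κ P ^ (2 * A) - 1) / P := div_nonneg (by linarith) (by positivity)
    linarith
  have he0 : 0 ≤ me μ E := sum_nonneg fun p hp => mul_nonneg
    (hmu p.1 (hV0 _ (mem_product.1 (hE hp)).1) (hVψ _ (mem_product.1 (hE hp)).1)).le
    (hmu p.2 (hW0 _ (mem_product.1 (hE hp)).2) (hWψ _ (mem_product.1 (hE hp)).2)).le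
  rcases he0.eq_or_lt with he | he
  · rw [← he]
    have : 0 ≤ ∑ v ∈ V, μ v := sum_nonneg fun v hv => (hmu v (hV0 v hv) (hVψ v hv)).le
    have : 0 ≤ ∑ v ∈ W, μ v := sum_nonneg fun v hv => (hmu v (hW0 v hv) (hWψ v hv)).le
    simp only [ne_eq, OfNat.ofNat_ne_zero, not_false_eq_true, zero_pow, zero_mul]
    positivity
  obtain ⟨V', hV', W', hW', hne, hd2, hd1⟩ := minDegree V W
    (fun v hv => hmu v (hV0 v hv) (hVψ v hv)) (fun v hv => hmu v (hW0 v hv) (hWψ v hv)) E hE he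
  set mV := ∑ v ∈ V, μ v with hmV
  set mW := ∑ w ∈ W, μ w with hmW
  obtain ⟨p0, hp0⟩ : E.Nonempty := by
    rw [nonempty_iff_ne_empty]; rintro rfl; simp [me] at he
  have hp0' := mem_product.1 (hE hp0)
  have hVp : 0 < mV := sum_pos (fun v hv => hmu v (hV0 v hv) (hVψ v hv)) ⟨_, hp0'.1⟩
  have hWp : 0 < mW := sum_pos (fun v hv => hmu v (hW0 v hv) (hWψ v hv)) ⟨_, hp0'.2⟩
  set w1 := W'.max' hne with hw1
  have hw1m : w1 ∈ W' := max'_mem _ _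
  have hw1p : (0:ℝ) < w1 := by have := hW0 w1 (hW' hw1m); positivity
  set N2 := V'.filter (fun v => (v, w1) ∈ E) with hN2
  have hN2ne : N2.Nonempty := by
    rw [nonempty_iff_ne_empty]; intro h
    have := hd2 w1 hw1m
    rw [← hN2, h, sum_empty] at this
    have : 0 < me μ E / (3 * mW) := by positivity
    linarith
  set v1 := N2.max' hN2ne with hv1
  have hv1m : v1 ∈ N2 := max'_mem _ _
  have hv1V : v1 ∈ V' := (mem_filter.1 hv1m).1
  have hv1p : (0:ℝ) < v1 := by have := hV0 v1 (hV' hv1V); positivity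
  have hap : (0:ℝ) < a := by positivity
  have hbp : (0:ℝ) < b := by positivity
  have B2 : me μ E / (3 * mW) * K ^ A ≤ t * g / w1 * ((Nat.totient a : ℝ) / a) * (v1 / a * Z) := by
    have s1 : ∀ v ∈ N2, μ v * K ^ A ≤ t * g / w1 * ((Nat.totient a : ℝ) / a) * ∏ P ∈ (v / a).primeFactors, κ P ^ (2 * A) := by
      intro v hv
      obtain ⟨hvV', hvE⟩ := mem_filter.1 hv
      have hvV := hV' hvV'
      have hψ : ψ v ≤ t * g / w1 := by
        rw [le_div_iff₀ hw1p]; have := h2 _ hvE; simp only at this; linarith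
      have hφ := phi_ratio (hV0 v hvV) (haV v hvV)
      have hK' : K ^ A ≤ ∏ P ∈ (v / a).primeFactors, κ P ^ (2 * A) := by
        rw [prod_pow, pow_mul]
        exact pow_le_pow_left₀ hK.le (hk _ hvE) A
      simp only [hμ, muw]
      have := hVψ v hvV
      gcongr
    have s2 : ∑ v ∈ N2, ∏ P ∈ (v / a).primeFactors, κ P ^ (2 * A) ≤ v1 / a * Z := by
      have inj : Set.InjOn (fun v => v / a) (N2 : Set ℕ) := by
        intro v hv v' hv' h
        have d1 := haV v (hV' (mem_filter.1 hv).1)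
        have d2 := haV v' (hV' (mem_filter.1 hv').1)
        rw [← Nat.div_mul_cancel d1, ← Nat.div_mul_cancel d2]
        simp only at h; rw [h]
      rw [← sum_image (f := fun m => ∏ P ∈ m.primeFactors, κ P ^ (2 * A)) inj]
      have := sumMult (fun P => κ P ^ (2 * A)) T hT (fun P hP => one_le_pow₀ (hκ P hP)) (v1 / a)
        (N2.image (fun v => v / a)) ?_ ?_
      · refine this.trans ?_
        gcongr
        exact Nat.cast_div_le
      · intro m hm
        obtain ⟨v, hv, rfl⟩ := mem_image.1 hm
        have hvV := hV' (mem_filter.1 hv).1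
        refine ⟨Nat.div_pos (Nat.le_of_dvd (Nat.pos_of_ne_zero (hV0 v hvV)) (haV v hvV)) (Nat.pos_of_ne_zero ha), ?_⟩
        exact Nat.div_le_div_right (le_max' _ _ hv)
      · intro m hm
        obtain ⟨v, hv, rfl⟩ := mem_image.1 hm
        have hvV := hV' (mem_filter.1 hv).1
        exact (Nat.primeFactors_mono (Nat.div_dvd_of_dvd (haV v hvV)) (hV0 v hvV)).trans (hVT v hvV)
    calc me μ E / (3 * mW) * K ^ A ≤ (∑ v ∈ N2, μ v) * K ^ A := by
          gcongr; exact hd2 w1 hw1m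
      _ ≤ ∑ v ∈ N2, t * g / w1 * ((Nat.totient a : ℝ) / a) * ∏ P ∈ (v / a).primeFactors, κ P ^ (2 * A) := by
          rw [sum_mul]; exact sum_le_sum s1
      _ ≤ _ := by rw [← mul_sum]; gcongr
  have B1 : me μ E / (3 * mV) ≤ t * g / v1 * ((Nat.totient b : ℝ) / b) * (w1 / b) := by
    set N1 := W'.filter (fun w => (v1, w) ∈ E) with hN1
    have s1 : ∀ w ∈ N1, μ w ≤ t * g / v1 * ((Nat.totient b : ℝ) / b) := by
      intro w hw
      obtain ⟨hwW', hwE⟩ := mem_filter.1 hw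
      have hwW := hW' hwW'
      have hψ : ψ w ≤ t * g / v1 := by
        rw [le_div_iff₀ hv1p]; have := h1 _ hwE; simp only at this; linarith
      have hφ := phi_ratio (hW0 w hwW) (hbW w hwW)
      simp only [hμ, muw]
      have := hWψ w hwW
      gcongr
    have hcard : (N1.card : ℝ) ≤ w1 / b := by
      have : N1.card ≤ w1 / b := by
        rw [← Nat.Ioc_filter_dvd_card_eq_div]
        apply card_le_card
        intro w hw
        have hwW' := (mem_filter.1 hw).1
        rw [mem_filter, mem_Ioc]
        exact ⟨⟨Nat.pos_of_ne_zero (hW0 w (hW' hwW')), le_max' _ _ hwW'⟩, hbW w (hW' hwW')⟩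
      calc (N1.card : ℝ) ≤ ((w1 / b : ℕ) : ℝ) := by exact_mod_cast this
        _ ≤ _ := Nat.cast_div_le
    calc me μ E / (3 * mV) ≤ ∑ w ∈ N1, μ w := hd1 v1 hv1V
      _ ≤ N1.card • (t * g / v1 * ((Nat.totient b : ℝ) / b)) := sum_le_card_nsmul _ _ _ s1
      _ = N1.card * (t * g / v1 * ((Nat.totient b : ℝ) / b)) := nsmul_eq_mul _ _
      _ ≤ w1 / b * (t * g / v1 * ((Nat.totient b : ℝ) / b)) := by gcongr
      _ = _ := by ring
  have B := mul_le_mul B1 B2 (by positivity) (by positivity)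
  have L : me μ E ^ 2 * K ^ A * (a * b) = (me μ E / (3 * mV) * (me μ E / (3 * mW) * K ^ A)) * (9 * mV * mW * (a * b)) := by
    field_simp; ring
  have R : 9 * t ^ 2 * g ^ 2 * Z * ((Nat.totient a : ℝ) / a) * ((Nat.totient b : ℝ) / b) * (mV * mW) =
      (t * g / v1 * ((Nat.totient b : ℝ) / b) * (w1 / b) * (t * g / w1 * ((Nat.totient a : ℝ) / a) * (v1 / a * Z))) * (9 * mV * mW * (a * b)) := by
    field_simp
  rw [L, R]
  gcongr

end QDS

namespace QDS
open Finset

lemma blockRecip (T : Finset ℕ) (hT : ∀ P ∈ T, P.Prime) (k : ℕ) :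
    (∑ P ∈ T.filter (fun P => Nat.log 2 P = k), 1 / (P:ℝ)) ≤ 1 ∧
    (∑ P ∈ T.filter (fun P => Nat.log 2 P = k), 1 / (P:ℝ)) * k ≤ 4 := by
  set B := T.filter (fun P => Nat.log 2 P = k) with hB
  have hmem : ∀ P ∈ B, P.Prime ∧ 2 ^ k ≤ P ∧ P < 2 ^ (k + 1) := by
    intro P hP
    obtain ⟨h1, h2⟩ := mem_filter.1 hP
    have hp := hT P h1
    exact ⟨hp, h2 ▸ Nat.pow_log_le_self 2 hp.ne_zero, h2 ▸ Nat.lt_pow_succ_log_self (by norm_num) P⟩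
  have s1 : ∑ P ∈ B, 1 / (P:ℝ) ≤ B.card / 2 ^ k := by
    have : ∀ P ∈ B, 1 / (P:ℝ) ≤ 1 / 2 ^ k := by
      intro P hP
      apply one_div_le_one_div_of_le (by positivity)
      exact_mod_cast (hmem P hP).2.1
    refine (sum_le_card_nsmul _ _ _ this).trans (le_of_eq ?_)
    rw [nsmul_eq_mul]; ring
  have hc1 : B.card ≤ 2 ^ k := by
    have : B ⊆ Ico (2 ^ k) (2 ^ (k + 1)) := fun P hP => mem_Ico.2 (hmem P hP).2
    have := card_le_card this
    rw [Nat.card_Ico, pow_succ] at this; omega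
  have hc2 : (B.card : ℝ) * (k * Real.log 2) ≤ Real.log 4 * 2 ^ (k + 1) := by
    have h1 : (B.card : ℝ) * (k * Real.log 2) ≤ ∑ P ∈ B, Real.log P := by
      rw [← nsmul_eq_mul]
      apply card_nsmul_le_sum
      intro P hP
      rw [← Real.log_pow]
      apply Real.log_le_log (by positivity)
      exact_mod_cast (hmem P hP).2.1
    have h2 : ∑ P ∈ B, Real.log P ≤ Chebyshev.theta ((2 ^ (k + 1) : ℕ) : ℝ) := by
      rw [Chebyshev.theta_eq_sum_Icc, Nat.floor_natCast]
      apply sum_le_sum_of_subset_of_nonneg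
      · intro P hP
        have := hmem P hP
        rw [mem_filter, mem_Icc]
        exact ⟨⟨by omega, by omega⟩, this.1⟩
      · intro P hP _
        exact Real.log_natCast_nonneg _
    have h3 := Chebyshev.theta_le_log4_mul_x (x := ((2 ^ (k + 1) : ℕ) : ℝ)) (by positivity)
    push_cast at h2 h3
    linarith
  have hl : Real.log 4 = 2 * Real.log 2 := by
    rw [show (4:ℝ) = 2 ^ 2 by norm_num, Real.log_pow]; norm_num
  have hl2 : 0 < Real.log 2 := Real.log_pos (by norm_num)
  have hpk : (0:ℝ) < 2 ^ k := by positivity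
  constructor
  · refine s1.trans ?_
    rw [div_le_one hpk]; exact_mod_cast hc1
  · have hk0 : (0:ℝ) ≤ k := by positivity
    refine (mul_le_mul_of_nonneg_right s1 hk0).trans ?_
    rw [div_mul_eq_mul_div, div_le_iff₀ hpk]
    rw [hl, pow_succ] at hc2
    have : (B.card : ℝ) * k * Real.log 2 ≤ 4 * 2 ^ k * Real.log 2 := by linarith
    exact le_of_mul_le_mul_right this hl2

lemma primeRecip {δ : ℝ} (hδ : 0 < δ) : ∃ C : ℝ, 0 ≤ C ∧ ∀ y : ℝ, 1 ≤ y → ∀ T : Finset ℕ,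
    (∀ P ∈ T, P.Prime) → (∀ P ∈ T, (P:ℝ) ≤ y) → ∑ P ∈ T, 1 / (P:ℝ) ≤ C + δ * Real.log y := by
  have hl2 : 0 < Real.log 2 := Real.log_pos (by norm_num)
  set δ' := δ * Real.log 2 with hδ'
  have hδ'p : 0 < δ' := by positivity
  obtain ⟨k0, hk0⟩ := exists_nat_ge (4 / δ')
  have hk0' : 4 ≤ k0 * δ' := by rwa [div_le_iff₀ hδ'p] at hk0
  refine ⟨k0 + δ', by positivity, ?_⟩
  intro y hy T hT hTy
  set L := Nat.log 2 ⌊y⌋₊ with hL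
  have hfib := sum_fiberwise_of_maps_to (s := T) (t := range (L + 1)) (g := fun P => Nat.log 2 P)
    (fun P hP => by
      rw [mem_range]
      exact Nat.lt_succ_of_le (Nat.log_mono_right (Nat.le_floor (hTy P hP)))) (fun P => 1 / (P:ℝ))
  rw [← hfib]
  have hb : ∀ k ∈ range (L + 1), ∑ P ∈ T.filter (fun P => Nat.log 2 P = k), 1 / (P:ℝ) ≤
      (if k < k0 then 1 else 0) + δ' := by
    intro k _
    obtain ⟨b1, b2⟩ := blockRecip T hT k
    split_ifs with h
    · linarith
    · push Not at h
      have hk : (k0:ℝ) ≤ k := by exact_mod_cast h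
      rw [zero_add]
      by_contra hcon
      push Not at hcon
      have hk0p : (0:ℝ) < k0 := lt_of_lt_of_le (by positivity) hk0
      have h1 : δ' * k < (∑ P ∈ T.filter (fun P => Nat.log 2 P = k), 1 / (P:ℝ)) * k :=
        mul_lt_mul_of_pos_right hcon (by linarith)
      have h2 : δ' * k0 ≤ δ' * k := by gcongr
      linarith
  refine (sum_le_sum hb).trans ?_
  rw [sum_add_distrib, sum_const, card_range, ← sum_filter, sum_const, nsmul_eq_mul, nsmul_eq_mul, mul_one]
  have hc : (((range (L + 1)).filter (fun k => k < k0)).card : ℝ) ≤ k0 := by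
    have : ((range (L + 1)).filter (fun k => k < k0)).card ≤ (range k0).card := card_le_card (by
      intro k hk; exact mem_range.2 (mem_filter.1 hk).2)
    rw [card_range] at this; exact_mod_cast this
  have hLy : L * Real.log 2 ≤ Real.log y := by
    rw [← Real.log_pow]
    apply Real.log_le_log (by positivity)
    have h1 : 2 ^ L ≤ ⌊y⌋₊ := Nat.pow_log_le_self 2 (by
      have : 1 ≤ ⌊y⌋₊ := Nat.le_floor (by simpa using hy)
      omega)
    calc ((2:ℝ) ^ L) = ((2 ^ L : ℕ) : ℝ) := by push_cast; rfl
      _ ≤ (⌊y⌋₊ : ℝ) := by exact_mod_cast h1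
      _ ≤ y := Nat.floor_le (by linarith)
  have : L * δ' ≤ δ * Real.log y := by
    rw [hδ']
    have := mul_le_mul_of_nonneg_left hLy hδ.le
    linarith
  push_cast
  linarith

lemma euler {c ε s : ℝ} (hc : 0 ≤ c) (hε : 0 < ε) (hs : 1 < s) : ∃ C : ℝ, 1 ≤ C ∧ ∀ y : ℝ, 1 ≤ y →
    ∀ T : Finset ℕ, (∀ P ∈ T, P.Prime) →
    ∏ P ∈ T, (1 + ((if (P:ℝ) ≤ y then c / P else 0) + c * (P:ℝ) ^ (-s))) ≤ C * y ^ ε := by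
  obtain ⟨C, hC, hrec⟩ := primeRecip (δ := ε / (c + 1)) (by positivity)
  have hsum : Summable (fun n : ℕ => (n:ℝ) ^ (-s)) := Real.summable_nat_rpow.2 (by linarith)
  set Z := ∑' n : ℕ, (n:ℝ) ^ (-s) with hZ
  have hZ0 : 0 ≤ Z := tsum_nonneg fun n => by positivity
  refine ⟨Real.exp (c * C + c * Z), Real.one_le_exp (by positivity), ?_⟩
  intro y hy T hT
  have h1 : ∏ P ∈ T, (1 + ((if (P:ℝ) ≤ y then c / P else 0) + c * (P:ℝ) ^ (-s))) ≤
      Real.exp (∑ P ∈ T, ((if (P:ℝ) ≤ y then c / P else 0) + c * (P:ℝ) ^ (-s))) := by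
    rw [Real.exp_sum]
    apply Finset.prod_le_prod
    · intro P _
      split_ifs <;> positivity
    · intro P _
      rw [add_comm 1]; exact Real.add_one_le_exp _
  refine h1.trans ?_
  have hy0 : 0 < y := by linarith
  rw [Real.rpow_def_of_pos hy0, ← Real.exp_add]
  apply Real.exp_le_exp.2
  rw [sum_add_distrib, ← mul_sum, ← sum_filter]
  have h2 : ∑ P ∈ T.filter (fun P : ℕ => (P:ℝ) ≤ y), c / (P:ℝ) ≤ c * (C + ε / (c + 1) * Real.log y) := by
    have := hrec y hy (T.filter (fun P : ℕ => (P:ℝ) ≤ y)) (fun P hP => hT P (mem_filter.1 hP).1)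
      (fun P hP => (mem_filter.1 hP).2)
    have := mul_le_mul_of_nonneg_left this hc
    rw [mul_sum] at this
    simp only [mul_one_div] at this
    exact this
  have h3 : ∑ P ∈ T, (P:ℝ) ^ (-s) ≤ Z := hsum.sum_le_tsum T (fun n _ => by positivity)
  have h4 := mul_le_mul_of_nonneg_left h3 hc
  have hlog : 0 ≤ Real.log y := Real.log_nonneg hy
  have h5 : c * (ε / (c + 1) * Real.log y) ≤ Real.log y * ε := by
    have : c / (c + 1) ≤ 1 := by rw [div_le_one (by linarith)]; linarith
    calc c * (ε / (c + 1) * Real.log y) = (c / (c + 1)) * (Real.log y * ε) := by ring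
      _ ≤ 1 * (Real.log y * ε) := by gcongr
      _ = _ := one_mul _
  linarith

end QDS

namespace QDS
open Finset

noncomputable def kap (t : ℝ) (P : ℕ) : ℝ := if (P:ℝ) ≤ t ^ 2 then 4 else 1 + 2 / Real.sqrt P

lemma one_le_kap (t : ℝ) (P : ℕ) : 1 ≤ kap t P := by
  unfold kap; split_ifs
  · norm_num
  · have : 0 ≤ 2 / Real.sqrt P := by positivity
    linarith

lemma pow_lin {x : ℝ} (h0 : 0 ≤ x) (h2 : x ≤ 2) (n : ℕ) : (1 + x) ^ n ≤ 1 + x * 4 ^ n := by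
  induction n with
  | zero => simpa using h0
  | succ n ih =>
    have h4 : (1:ℝ) ≤ 4 ^ n := one_le_pow₀ (by norm_num)
    rw [pow_succ, pow_succ]
    have := mul_le_mul_of_nonneg_right ih (by linarith : 0 ≤ 1 + x)
    have h5 : x * 4 ^ n * x ≤ x * 4 ^ n * 2 := mul_le_mul_of_nonneg_left h2 (by positivity)
    have h6 : x * 1 ≤ x * 4 ^ n := mul_le_mul_of_nonneg_left h4 h0
    linarith

lemma kap_pow (t : ℝ) {P : ℕ} (hP : 1 ≤ P) (n : ℕ) :
    kap t P ^ n ≤ 4 ^ n ∧ kap t P ^ n - 1 ≤ (if (P:ℝ) ≤ t ^ 2 then 4 ^ n else 0) + 2 * 4 ^ n * (P:ℝ) ^ (-(1/2) : ℝ) := by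
  have hP' : (1:ℝ) ≤ P := by exact_mod_cast hP
  have hs : 1 ≤ Real.sqrt P := Real.one_le_sqrt.2 hP'
  have hx : 2 / Real.sqrt P ≤ 2 := div_le_self (by norm_num) hs
  have hx0 : 0 ≤ 2 / Real.sqrt P := by positivity
  have e : (P:ℝ) ^ (-(1/2) : ℝ) = 1 / Real.sqrt P := by
    rw [Real.rpow_neg (by linarith), Real.sqrt_eq_rpow, one_div (_ ^ _)]
  rw [e]
  unfold kap
  split_ifs
  · refine ⟨le_rfl, ?_⟩
    have : 0 ≤ 2 * 4 ^ n * (1 / Real.sqrt P) := by positivity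
    linarith
  · constructor
    · gcongr; linarith
    · have := pow_lin hx0 hx n
      have e2 : 2 * 4 ^ n * (1 / Real.sqrt P) = 2 / Real.sqrt P * 4 ^ n := by ring
      linarith

noncomputable def loc (θ : ℝ) (P k l : ℕ) : ℝ := (if k = l then 1 else θ) * (1 / (P:ℝ)) ^ nd k l *
  (if k = 0 then 1 else 1 - 1 / (P:ℝ)) * (if l = 0 then 1 else 1 - 1 / (P:ℝ))

lemma loc_nonneg {θ : ℝ} (hθ : 1 ≤ θ) {P : ℕ} (hP : P.Prime) (k l : ℕ) : 0 ≤ loc θ P k l := by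
  have := (one_sub_inv_mem hP).1
  unfold loc
  have a1 : 0 ≤ (if k = l then 1 else θ) := by split_ifs <;> linarith
  have a2 : 0 ≤ (if k = 0 then 1 else 1 - 1 / (P:ℝ)) := by split_ifs <;> linarith
  have a3 : 0 ≤ (if l = 0 then 1 else 1 - 1 / (P:ℝ)) := by split_ifs <;> linarith
  positivity

lemma loc_le {θ : ℝ} (hθ : 1 ≤ θ) {P : ℕ} (hP : P.Prime) (k l : ℕ) :
    loc θ P k l ≤ θ * (1 / (P:ℝ)) ^ nd k l := by
  obtain ⟨h1, h2⟩ := one_sub_inv_mem hP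
  unfold loc
  have a1 : (if k = l then 1 else θ) ≤ θ := by split_ifs <;> linarith
  have a2 : (if k = 0 then 1 else 1 - 1 / (P:ℝ)) ≤ 1 := by split_ifs <;> linarith
  have a2' : 0 ≤ (if k = 0 then 1 else 1 - 1 / (P:ℝ)) := by split_ifs <;> linarith
  have a3 : (if l = 0 then 1 else 1 - 1 / (P:ℝ)) ≤ 1 := by split_ifs <;> linarith
  have a3' : 0 ≤ (if l = 0 then 1 else 1 - 1 / (P:ℝ)) := by split_ifs <;> linarith
  calc _ ≤ θ * (1 / (P:ℝ)) ^ nd k l * 1 * 1 := by gcongr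
    _ = _ := by ring

lemma locSmall {r B θ : ℝ} (h1 : r < 1) (hB : 1 ≤ B) (hθ : 1 ≤ θ) {P : ℕ} (hP : P.Prime) (k l : ℕ) :
    loc θ P k l ^ (1 - r) ≤ (θ * B) ^ (1 - r) * cS r B P k l := by
  unfold cS
  rw [← Real.mul_rpow (by positivity) (by positivity)]
  apply Real.rpow_le_rpow (loc_nonneg hθ hP k l) _ (by linarith)
  refine (loc_le hθ hP k l).trans (le_of_eq ?_)
  field_simp

lemma locLarge {r C θ ε : ℝ} (h0 : 1 / 2 < r) (h1 : r < 1) (hC : 0 < C) (hθ : 1 ≤ θ) {P : ℕ} (hP : P.Prime)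
    (hε : ε = 1 / (P:ℝ)) (hh : 2 * (1 - r) * θ * ε + C * ε ^ (2 * r) ≤ 1 / 2) (k l : ℕ) :
    0 ≤ cL r C θ ε k l ∧
    loc θ P k l ^ (1 - r) ≤ (1 + 2 * ((θ - 1) * ε + C * ε ^ (2 * r))) * cL r C θ ε k l := by
  have hp := hP.two_le
  have hε0 : 0 ≤ ε := by rw [hε]; positivity
  have hε1 : ε ≤ 1 := by have := (one_sub_inv_mem hP).1; rw [hε]; linarith
  set X := C * ε ^ (2 * r) with hX
  have hX0 : 0 ≤ X := by positivity
  have hu : 0 < 1 - r := by linarith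
  have hθε : 0 ≤ (θ - 1) * ε := mul_nonneg (by linarith) hε0
  have hY : 0 ≤ 2 * ((θ - 1) * ε + X) := by positivity
  have hz : 0 ≤ 2 * (1 - r) * θ * ε := by positivity
  by_cases hkl : k = l
  · subst hkl
    by_cases hk : k = 0
    · subst hk
      have e1 : loc θ P 0 0 = 1 := by simp [loc, nd]
      have e2 : cL r C θ ε 0 0 = 1 - X := by simp [cL, hX]
      rw [e1, e2, Real.one_rpow]
      have hXh : X ≤ 1 / 2 := by linarith
      refine ⟨by linarith, ?_⟩
      have : (1 + 2 * X) * (1 - X) ≤ (1 + 2 * ((θ - 1) * ε + X)) * (1 - X) := by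
        apply mul_le_mul_of_nonneg_right _ (by linarith); linarith
      have h3 : X * X ≤ X * (1/2) := mul_le_mul_of_nonneg_left hXh hX0
      linarith
    · have e1 : loc θ P k k = (1 - ε) ^ (2:ℝ) := by
        rw [Real.rpow_two]; simp [loc, nd, hk, hε]; ring
      have e2 : cL r C θ ε k k = 1 - (2 * (1 - r) * θ * ε + X) := by simp [cL, hX, hk]
      rw [e1, e2, ← Real.rpow_mul (by linarith)]
      have hb : (1 + (-ε)) ^ (2 * (1 - r)) ≤ 1 + 2 * (1 - r) * (-ε) :=
        rpow_one_add_le_one_add_mul_self (by linarith) (by linarith) (by linarith)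
      rw [← sub_eq_add_neg] at hb
      refine ⟨by linarith, hb.trans ?_⟩
      set h := 2 * (1 - r) * θ * ε + X with hh'
      have h3 : 2 * ((θ - 1) * ε + X) * h ≤ 2 * ((θ - 1) * ε + X) * (1/2) := mul_le_mul_of_nonneg_left hh hY
      have h4 : 2 * (1 - r) * ((θ - 1) * ε) ≤ 1 * ((θ - 1) * ε) :=
        mul_le_mul_of_nonneg_right (by linarith) hθε
      linarith
  · have e2 : cL r C θ ε k l = (θ * ε ^ nd k l) ^ (1 - r) := by simp [cL, hkl]
    rw [e2]
    refine ⟨by positivity, ?_⟩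
    have h3 : loc θ P k l ^ (1 - r) ≤ (θ * ε ^ nd k l) ^ (1 - r) := by
      apply Real.rpow_le_rpow (loc_nonneg hθ hP k l) _ hu.le
      rw [hε]; exact loc_le hθ hP k l
    refine h3.trans (le_mul_of_one_le_left (by positivity) (by linarith))

lemma one_le_prodR {κ : ℕ → ℝ} (X : Finset ℕ) (h : ∀ P ∈ X, 1 ≤ κ P) : 1 ≤ ∏ P ∈ X, κ P := by
  calc (1:ℝ) = ∏ P ∈ X, 1 := by simp
    _ ≤ _ := Finset.prod_le_prod (fun _ _ => zero_le_one) h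

lemma prod_monoR {κ : ℕ → ℝ} {X Y : Finset ℕ} (hXY : X ⊆ Y) (h : ∀ P ∈ Y, 1 ≤ κ P) :
    ∏ P ∈ X, κ P ≤ ∏ P ∈ Y, κ P := by
  rw [← prod_sdiff hXY]
  exact le_mul_of_one_le_left (prod_nonneg fun P hP => zero_le_one.trans (h P (hXY hP)))
    (one_le_prodR _ fun P hP => h P (mem_sdiff.1 hP).1)

/-- Primes where valuations differ. -/
def nset (v w : ℕ) : Finset ℕ :=
  (v.primeFactors ∪ w.primeFactors).filter (fun P => v.factorization P ≠ w.factorization P)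

noncomputable def kapn (t : ℝ) (v w : ℕ) : ℝ := ∏ P ∈ nset v w, kap t P

lemma kapn_le {κ : ℕ → ℝ} (hκ : ∀ P, 1 ≤ κ P) {T : Finset ℕ} {v w a b : ℕ} (hv : v ≠ 0) (hw : w ≠ 0)
    (hvT : v.primeFactors ⊆ T) (hwT : w.primeFactors ⊆ T) (ha : a ∣ v) (hb : b ∣ w) :
    ∏ P ∈ nset v w, κ P ≤ (∏ P ∈ T.filter (fun P => a.factorization P ≠ b.factorization P), κ P) *
      (fk κ (v / a) * fk κ (w / b)) := by
  classical
  set O := T.filter (fun P => a.factorization P ≠ b.factorization P) with hO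
  have hsub : nset v w ⊆ O ∪ ((v / a).primeFactors ∪ (w / b).primeFactors) := by
    intro P hP
    obtain ⟨h1, h2⟩ := mem_filter.1 hP
    have hPT : P ∈ T := by
      rcases mem_union.1 h1 with h | h
      · exact hvT h
      · exact hwT h
    by_contra hcon
    simp only [mem_union, not_or] at hcon
    obtain ⟨c1, c2, c3⟩ := hcon
    have d1 : a.factorization P = b.factorization P := by
      by_contra h; exact c1 (mem_filter.2 ⟨hPT, h⟩)
    rw [← Nat.support_factorization, Finsupp.notMem_support_iff, Nat.factorization_div ha] at c2
    rw [← Nat.support_factorization, Finsupp.notMem_support_iff, Nat.factorization_div hb] at c3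
    have ha' := (Nat.factorization_le_iff_dvd (ne_zero_of_dvd_ne_zero hv ha) hv).2 ha P
    have hb' := (Nat.factorization_le_iff_dvd (ne_zero_of_dvd_ne_zero hw hb) hw).2 hb P
    simp only [Finsupp.coe_tsub, Pi.sub_apply] at c2 c3
    omega
  have hun : ∀ X Y : Finset ℕ, ∏ P ∈ X ∪ Y, κ P ≤ (∏ P ∈ X, κ P) * ∏ P ∈ Y, κ P := by
    intro X Y
    rw [← prod_union_inter]
    apply le_mul_of_one_le_right (prod_nonneg fun P _ => zero_le_one.trans (hκ P))
    exact one_le_prodR _ fun P _ => hκ P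
  calc ∏ P ∈ nset v w, κ P ≤ ∏ P ∈ O ∪ ((v / a).primeFactors ∪ (w / b).primeFactors), κ P :=
        prod_monoR hsub fun P _ => hκ P
    _ ≤ (∏ P ∈ O, κ P) * ∏ P ∈ ((v / a).primeFactors ∪ (w / b).primeFactors), κ P := hun _ _
    _ ≤ _ := mul_le_mul_of_nonneg_left (hun _ _) (prod_nonneg fun P _ => zero_le_one.trans (hκ P))

end QDS

namespace QDS
open Finset

lemma fac_prod {a : ℕ} (ha : a ≠ 0) {T : Finset ℕ} (h : ∀ P, P ∉ T → a.factorization P = 0) :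
    (a:ℝ) = ∏ P ∈ T, (P:ℝ) ^ a.factorization P := by
  conv_lhs => rw [← Nat.prod_factorization_pow_eq_self ha]
  rw [Finsupp.prod_of_support_subset (s := T)]
  · push_cast; rfl
  · intro P hP
    by_contra hc
    exact (Finsupp.mem_support_iff.1 hP) (h P hc)
  · simp

lemma phi_prod {a : ℕ} (ha : a ≠ 0) {T : Finset ℕ} (h : ∀ P, P ∉ T → a.factorization P = 0) :
    (Nat.totient a : ℝ) / a = ∏ P ∈ T, (if a.factorization P = 0 then 1 else 1 - 1 / (P:ℝ)) := by
  rw [phi_div ha]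
  have hs : a.primeFactors ⊆ T := by
    intro P hP
    rw [← Nat.support_factorization] at hP
    by_contra hc
    exact (Finsupp.mem_support_iff.1 hP) (h P hc)
  rw [← prod_subset hs]
  · apply prod_congr rfl
    intro P hP
    rw [← Nat.support_factorization, Finsupp.mem_support_iff] at hP
    rw [if_neg hP]
  · intro P _ hP
    rw [← Nat.support_factorization, Finsupp.notMem_support_iff] at hP
    rw [if_pos hP]

lemma prodLoc (κ : ℕ → ℝ) (A : ℕ) {T : Finset ℕ} (hT : ∀ P ∈ T, P.Prime) {a b : ℕ} (ha : a ≠ 0) (hb : b ≠ 0)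
    (haT : ∀ P, P ∉ T → a.factorization P = 0) (hbT : ∀ P, P ∉ T → b.factorization P = 0) :
    (∏ P ∈ T.filter (fun P => a.factorization P ≠ b.factorization P), κ P) ^ A *
      (((Nat.gcd a b : ℕ):ℝ) ^ 2 * ((Nat.totient a : ℝ) / a) * ((Nat.totient b : ℝ) / b)) =
      (∏ P ∈ T, loc (κ P ^ A) P (a.factorization P) (b.factorization P)) * (a * b) := by
  have hg : Nat.gcd a b ≠ 0 := fun h => ha (Nat.gcd_eq_zero_iff.1 h).1
  have hgT : ∀ P, (Nat.gcd a b).factorization P = min (a.factorization P) (b.factorization P) := by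
    intro P; rw [Nat.factorization_gcd ha hb]; rfl
  rw [phi_prod ha haT, phi_prod hb hbT, fac_prod hg (T := T) (by
    intro P hP; rw [hgT, haT P hP]; simp)]
  conv_rhs => rw [fac_prod ha haT, fac_prod hb hbT]
  rw [prod_filter, ← prod_pow, ← prod_pow, ← prod_mul_distrib, ← prod_mul_distrib, ← prod_mul_distrib,
    ← prod_mul_distrib, ← prod_mul_distrib]
  apply prod_congr rfl
  intro P hP
  rw [hgT]
  have hP0 : (P:ℝ) ≠ 0 := by have := (hT P hP).ne_zero; positivity
  unfold loc
  set k := a.factorization P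
  set l := b.factorization P
  have e1 : (if k ≠ l then κ P else 1) ^ A = if k = l then 1 else κ P ^ A := by
    by_cases h : k = l <;> simp [h]
  have e2 : ((P:ℝ) ^ min k l) ^ 2 = (1 / (P:ℝ)) ^ nd k l * ((P:ℝ) ^ k * (P:ℝ) ^ l) := by
    have e3 : k + l = nd k l + 2 * min k l := by unfold nd; omega
    rw [← pow_add, e3, pow_add, ← mul_assoc, ← mul_pow, one_div, inv_mul_cancel₀ hP0, one_pow, one_mul]
    ring
  rw [e1, e2]; ring

lemma combine {ψ κ : ℕ → ℝ} {t K : ℝ} (A : ℕ) {T V W : Finset ℕ} {E : Finset (ℕ × ℕ)} {a b : ℕ}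
    (hψ : ∀ v, 0 ≤ ψ v)
    (hT : ∀ P ∈ T, P.Prime) (hκ : ∀ P, 1 ≤ κ P) (hK : 0 < K) (ht : 0 < t)
    (ha : a ≠ 0) (hb : b ≠ 0)
    (haT : ∀ P, P ∉ T → a.factorization P = 0) (hbT : ∀ P, P ∉ T → b.factorization P = 0)
    (hV0 : ∀ v ∈ V, v ≠ 0) (hW0 : ∀ v ∈ W, v ≠ 0)
    (hVψ : ∀ v ∈ V, 0 < ψ v) (hWψ : ∀ v ∈ W, 0 < ψ v)
    (hVT : ∀ v ∈ V, v.primeFactors ⊆ T) (hWT : ∀ v ∈ W, v.primeFactors ⊆ T)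
    (hE : E ⊆ V ×ˢ W) (haV : ∀ v ∈ V, a ∣ v) (hbW : ∀ w ∈ W, b ∣ w)
    (hmin : ∀ p ∈ E, ∀ P ∈ T, min (p.1.factorization P) (p.2.factorization P) =
        min (a.factorization P) (b.factorization P))
    (h1 : ∀ p ∈ E, p.1 * ψ p.2 ≤ t * Nat.gcd p.1 p.2) (h2 : ∀ p ∈ E, p.2 * ψ p.1 ≤ t * Nat.gcd p.1 p.2)
    (hk : ∀ p ∈ E, K ≤ ∏ P ∈ nset p.1 p.2, κ P) :
    me (muw ψ) E ^ 2 * K ^ A ≤ 36 * t ^ 2 * (∏ P ∈ T, (1 + (κ P ^ (2 * A) - 1) / P)) *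
      (∏ P ∈ T, loc (κ P ^ A) P (a.factorization P) (b.factorization P)) *
      ((∑ v ∈ V, muw ψ v) * ∑ w ∈ W, muw ψ w) := by
  classical
  have hgcd : ∀ p ∈ E, Nat.gcd p.1 p.2 = Nat.gcd a b := by
    intro p hp
    have hp' := mem_product.1 (hE hp)
    have z1 := hV0 _ hp'.1
    have z2 := hW0 _ hp'.2
    apply Nat.eq_of_factorization_eq (fun h => z1 (Nat.gcd_eq_zero_iff.1 h).1)
      (fun h => ha (Nat.gcd_eq_zero_iff.1 h).1)
    intro P
    rw [Nat.factorization_gcd z1 z2, Nat.factorization_gcd ha hb]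
    simp only [Finsupp.inf_apply]
    by_cases hP : P ∈ T
    · exact hmin p hp P hP
    · rw [haT P hP]
      have : p.1.factorization P = 0 := by
        by_contra h
        exact hP (hVT _ hp'.1 (by rw [← Nat.support_factorization]; exact Finsupp.mem_support_iff.2 h))
      rw [this]; simp
  set g := Nat.gcd a b with hg
  set Ko := ∏ P ∈ T.filter (fun P => a.factorization P ≠ b.factorization P), κ P with hKo
  have hKo1 : 1 ≤ Ko := one_le_prodR _ fun P _ => hκ P
  have hKo0 : 0 < Ko := by linarith
  have hmu : ∀ v, 0 ≤ muw ψ v := fun v => mul_nonneg (hψ v) (by positivity)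
  set E1 := E.filter (fun p => K / Ko ≤ fk κ (p.1 / a) ^ 2) with hE1
  set E2 := E.filter (fun p => K / Ko ≤ fk κ (p.2 / b) ^ 2) with hE2
  have hfk : ∀ m, 1 ≤ fk κ m := fun m => one_le_prodR _ fun P _ => hκ P
  have hcov : E ⊆ E1 ∪ E2 := by
    intro p hp
    have hp' := mem_product.1 (hE hp)
    have q1 := (hk p hp).trans (kapn_le hκ (hV0 _ hp'.1) (hW0 _ hp'.2) (hVT _ hp'.1) (hWT _ hp'.2)
      (haV _ hp'.1) (hbW _ hp'.2))
    rw [← hKo, ← div_le_iff₀' hKo0] at q1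
    rw [mem_union]
    have f1 := hfk (p.1 / a)
    have f2 := hfk (p.2 / b)
    rcases le_total (fk κ (p.1 / a)) (fk κ (p.2 / b)) with h | h
    · right
      refine mem_filter.2 ⟨hp, q1.trans ?_⟩
      rw [sq]; exact mul_le_mul_of_nonneg_right h (by linarith)
    · left
      refine mem_filter.2 ⟨hp, q1.trans ?_⟩
      rw [sq]; exact mul_le_mul_of_nonneg_left h (by linarith)
  have hme : me (muw ψ) E ≤ me (muw ψ) E1 + me (muw ψ) E2 := by
    have hnn : ∀ p : ℕ × ℕ, 0 ≤ muw ψ p.1 * muw ψ p.2 := fun p => mul_nonneg (hmu _) (hmu _)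
    unfold me
    rw [← sum_union_inter]
    have := sum_le_sum_of_subset_of_nonneg hcov (f := fun p : ℕ × ℕ => muw ψ p.1 * muw ψ p.2)
      (fun p _ _ => hnn p)
    have h3 : 0 ≤ ∑ p ∈ E1 ∩ E2, muw ψ p.1 * muw ψ p.2 := sum_nonneg fun p _ => hnn p
    linarith
  have hKK : 0 < K / Ko := by positivity
  have s1 : ∀ p ∈ E, p.1 * ψ p.2 ≤ t * g := fun p hp => by
    have := h1 p hp; rwa [hgcd p hp] at this
  have s2 : ∀ p ∈ E, p.2 * ψ p.1 ≤ t * g := fun p hp => by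
    have := h2 p hp; rwa [hgcd p hp] at this
  have F1 := finalCount (g := g) A T V W E1 hT (fun P _ => hκ P) hKK ht ha hb hV0 hW0 hVψ hWψ hVT
    ((filter_subset _ _).trans hE) haV hbW (fun p hp => s1 p (mem_filter.1 hp).1)
    (fun p hp => s2 p (mem_filter.1 hp).1) (fun p hp => (mem_filter.1 hp).2)
  have F2 := finalCount (g := g) A T W V (E2.image Prod.swap) hT (fun P _ => hκ P) hKK ht hb ha hW0 hV0 hWψ hVψ hWT
    (by
      intro p hp
      obtain ⟨q, hq, rfl⟩ := mem_image.1 hp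
      have := mem_product.1 (hE (mem_filter.1 hq).1)
      exact mem_product.2 ⟨this.2, this.1⟩) hbW haV
    (by
      intro p hp
      obtain ⟨q, hq, rfl⟩ := mem_image.1 hp
      exact s2 q (mem_filter.1 hq).1)
    (by
      intro p hp
      obtain ⟨q, hq, rfl⟩ := mem_image.1 hp
      exact s1 q (mem_filter.1 hq).1)
    (by
      intro p hp
      obtain ⟨q, hq, rfl⟩ := mem_image.1 hp
      exact (mem_filter.1 hq).2)
  have hsw : me (muw ψ) (E2.image Prod.swap) = me (muw ψ) E2 := by
    unfold me
    rw [sum_image (fun x _ y _ h => Prod.swap_injective h)]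
    exact sum_congr rfl fun p _ => mul_comm _ _
  rw [hsw] at F2
  have PL := prodLoc κ A hT ha hb haT hbT
  rw [← hKo, ← hg] at PL
  clear_value Ko E1 E2
  generalize (∏ P ∈ T, (1 + (κ P ^ (2 * A) - 1) / (P:ℝ))) = Z at *
  generalize (∏ P ∈ T, loc (κ P ^ A) P (a.factorization P) (b.factorization P)) = L at *
  generalize (∑ v ∈ V, muw ψ v) = mV at *
  generalize (∑ w ∈ W, muw ψ w) = mW at *
  have he0 := me_nonneg hmu E
  have hab : (0:ℝ) < (a:ℝ) * b := by positivity
  generalize me (muw ψ) E = e at *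
  generalize me (muw ψ) E1 = e1 at *
  generalize me (muw ψ) E2 = e2 at *
  have hsq : e ^ 2 ≤ 2 * (e1 ^ 2 + e2 ^ 2) := by
    have : e ^ 2 ≤ (e1 + e2) ^ 2 := pow_le_pow_left₀ he0 hme 2
    have := sq_nonneg (e1 - e2)
    linarith
  generalize (Nat.totient a : ℝ) / a = fa at *
  generalize (Nat.totient b : ℝ) / b = fb at *
  have hfin : e ^ 2 * (K / Ko) ^ A * (a * b) ≤ 36 * t ^ 2 * Z * (mV * mW) * ((g:ℝ) ^ 2 * fa * fb) := by
    have hx : 0 ≤ (K / Ko) ^ A * (a * b) := by positivity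
    have := mul_le_mul_of_nonneg_right hsq hx
    linarith
  have hKA : 0 < Ko ^ A := by positivity
  have := mul_le_mul_of_nonneg_left hfin hKA.le
  have e4 : Ko ^ A * (e ^ 2 * (K / Ko) ^ A * (a * b)) = (e ^ 2 * K ^ A) * (a * b) := by
    rw [div_pow]; field_simp
  have e5 : Ko ^ A * (36 * t ^ 2 * Z * (mV * mW) * ((g:ℝ) ^ 2 * fa * fb)) =
      (36 * t ^ 2 * Z * L * (mV * mW)) * (a * b) := by
    calc _ = 36 * t ^ 2 * Z * (mV * mW) * (Ko ^ A * ((g:ℝ) ^ 2 * fa * fb)) := by ring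
      _ = _ := by rw [PL]; ring
  rw [e4, e5] at this
  exact le_of_mul_le_mul_right this hab

end QDS

namespace QDS
open Finset

lemma kapEuler (n : ℕ) {c0 C3 s0 ε : ℝ} (hc0 : 0 ≤ c0) (hC3 : 0 ≤ C3) (hs0 : 1 < s0) (hε : 0 < ε) :
    ∃ C : ℝ, 1 ≤ C ∧ ∀ t : ℝ, 1 ≤ t → ∀ T : Finset ℕ, (∀ P ∈ T, P.Prime) →
    ∏ P ∈ T, (1 + c0 * ((kap t P ^ n - 1) * (1 / (P:ℝ)) + C3 * (1 / (P:ℝ)) ^ s0)) ≤ C * t ^ ε := by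
  obtain ⟨C, hC, h⟩ := euler (c := c0 * (2 * 4 ^ n + C3)) (ε := ε / 2) (s := min (3/2) s0) (by positivity)
    (by positivity) (lt_min (by norm_num) hs0)
  refine ⟨C, hC, ?_⟩
  intro t ht T hT
  have := h (t ^ 2) (one_le_pow₀ ht) T hT
  have e : ((t ^ 2 : ℝ)) ^ (ε / 2) = t ^ ε := by
    rw [← Real.rpow_natCast, ← Real.rpow_mul (by linarith)]; congr 1; push_cast; ring
  rw [e] at this
  refine le_trans ?_ this
  apply Finset.prod_le_prod
  · intro P _
    have := one_le_pow₀ (n := n) (one_le_kap t P)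
    have h0 : 0 ≤ kap t P ^ n - 1 := by linarith
    positivity
  · intro P hP
    have hP1 : (1:ℝ) ≤ P := by exact_mod_cast (hT P hP).one_le
    have hP0 : (0:ℝ) < P := by linarith
    have k := (kap_pow t (hT P hP).one_le n).2
    have k1 := mul_le_mul_of_nonneg_right k (by positivity : 0 ≤ 1 / (P:ℝ))
    have a1 : (P:ℝ) ^ (-(1/2) : ℝ) * (1 / (P:ℝ)) ≤ (P:ℝ) ^ (-(min (3/2) s0)) := by
      have : (P:ℝ) ^ (-(1/2) : ℝ) * (1 / (P:ℝ)) = (P:ℝ) ^ (-(3/2) : ℝ) := by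
        rw [show (1 / (P:ℝ)) = (P:ℝ) ^ (-1:ℝ) by rw [Real.rpow_neg_one, one_div], ← Real.rpow_add hP0]
        norm_num
      rw [this]
      exact Real.rpow_le_rpow_of_exponent_le hP1 (neg_le_neg (min_le_left _ _))
    have a2 : (1 / (P:ℝ)) ^ s0 ≤ (P:ℝ) ^ (-(min (3/2) s0)) := by
      rw [one_div, Real.inv_rpow hP0.le, ← Real.rpow_neg hP0.le]
      exact Real.rpow_le_rpow_of_exponent_le hP1 (neg_le_neg (min_le_right _ _))
    set R := (P:ℝ) ^ (-(min (3/2) s0))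
    have b1 := mul_le_mul_of_nonneg_left a1 (by positivity : (0:ℝ) ≤ 2 * 4 ^ n)
    have b2 := mul_le_mul_of_nonneg_left a2 hC3
    have hb : (kap t P ^ n - 1) * (1 / (P:ℝ)) + C3 * (1 / (P:ℝ)) ^ s0 ≤
        (if (P:ℝ) ≤ t ^ 2 then (2 * 4 ^ n + C3) * (1 / (P:ℝ)) else 0) + (2 * 4 ^ n + C3) * R := by
      have : (if (P:ℝ) ≤ t ^ 2 then (4:ℝ) ^ n else 0) * (1 / (P:ℝ)) ≤
        (if (P:ℝ) ≤ t ^ 2 then (2 * 4 ^ n + C3) * (1 / (P:ℝ)) else 0) := by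
        split_ifs
        · gcongr
          have : (0:ℝ) < 4 ^ n := by positivity
          linarith
        · simp
      linarith
    have := mul_le_mul_of_nonneg_left hb hc0
    have e2 : (if (P:ℝ) ≤ t ^ 2 then c0 * (2 * 4 ^ n + C3) / (P:ℝ) else 0) =
        c0 * (if (P:ℝ) ≤ t ^ 2 then (2 * 4 ^ n + C3) * (1 / (P:ℝ)) else 0) := by
      split_ifs
      · ring
      · simp
    rw [e2]
    linarith

lemma star_calc {e0 e M S L c G X r : ℝ} (h0 : 1 / 2 < r) (h1 : r < 1) (hM : 0 < M) (he : 0 ≤ e)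
    (heM : e ≤ M) (hS : 0 ≤ S) (hL : 0 ≤ L) (hX : 0 ≤ X)
    (hind : e0 * M ^ r * c ≤ e * S ^ r) (hfin : e ^ 2 ≤ X * L * M) (hLc : L ^ (1 - r) ≤ G * c)
    (hc : 0 < c) : e0 ≤ X ^ (1 - r) * G * S ^ r := by
  have hu : 0 < 1 - r := by linarith
  have k1 : e ≤ M ^ r * (X * L) ^ (1 - r) := by
    have d1 : e / M ≤ 1 := (div_le_one hM).2 heM
    have d0 : 0 ≤ e / M := by positivity
    have d2 : e / M ≤ (e / M) ^ (2 * (1 - r)) := by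
      rcases d0.eq_or_lt with h | h
      · rw [← h]; positivity
      · conv_lhs => rw [← Real.rpow_one (e / M)]
        exact Real.rpow_le_rpow_of_exponent_ge h d1 (by linarith)
    have d3 : (e / M) ^ (2 * (1 - r)) ≤ (X * L / M) ^ (1 - r) := by
      rw [Real.rpow_mul d0, Real.rpow_two]
      apply Real.rpow_le_rpow (by positivity) _ hu.le
      rw [div_pow, div_le_div_iff₀ (by positivity) hM]
      have := mul_le_mul_of_nonneg_right hfin hM.le
      linarith
    have d4 := d2.trans d3
    rw [Real.div_rpow (by positivity) hM.le, div_le_iff₀ hM] at d4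
    refine d4.trans (le_of_eq ?_)
    have : M = M ^ r * M ^ (1 - r) := by
      rw [← Real.rpow_add hM]; simp
    have hne : M ^ (1 - r) ≠ 0 := by positivity
    calc (X * L) ^ (1 - r) / M ^ (1 - r) * M = (X * L) ^ (1 - r) / M ^ (1 - r) * (M ^ r * M ^ (1 - r)) := by
          rw [← this]
      _ = _ := by field_simp
  have hMr : 0 < M ^ r := by positivity
  have k2 : e0 * M ^ r * c ≤ M ^ r * (X ^ (1 - r) * (G * c)) * S ^ r := by
    refine hind.trans (mul_le_mul_of_nonneg_right (k1.trans ?_) (by positivity))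
    rw [Real.mul_rpow hX hL]
    gcongr
  have k3 : e0 * (M ^ r * c) ≤ (X ^ (1 - r) * G * S ^ r) * (M ^ r * c) := by linarith
  exact le_of_mul_le_mul_right k3 (by positivity)

theorem star {r ε : ℝ} (h0 : 1 / 2 < r) (h1 : r < 1) (hε : 0 < ε) (A : ℕ) :
    ∃ C : ℝ, 1 ≤ C ∧ ∀ (t K : ℝ), 1 ≤ t → 1 ≤ K → ∀ (ψ : ℕ → ℝ), (∀ v, 0 ≤ ψ v) →
    ∀ (S : Finset ℕ), (∀ v ∈ S, v ≠ 0) → (∀ v ∈ S, 0 < ψ v) → ∀ (E0 : Finset (ℕ × ℕ)), E0 ⊆ S ×ˢ S →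
    (∀ p ∈ E0, p.1 * ψ p.2 ≤ t * Nat.gcd p.1 p.2) → (∀ p ∈ E0, p.2 * ψ p.1 ≤ t * Nat.gcd p.1 p.2) →
    (∀ p ∈ E0, K ≤ kapn t p.1 p.2) →
    me (muw ψ) E0 ≤ C * (t ^ (2 + ε) / K ^ A) ^ (1 - r) * (∑ v ∈ S, muw ψ v) ^ (2 * r) := by
  have hu : 0 < 1 - r := by linarith
  have hΘ : (1:ℝ) ≤ 4 ^ A := one_le_pow₀ (by norm_num)
  obtain ⟨B, hB, hSm⟩ := localSmall h0 h1
  obtain ⟨P0, C3, hP0, hC3, hLg⟩ := localLarge h0 h1 hΘ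
  set ε1 : ℝ := ε * (1 - r) / 2 with hε1
  have hε1p : 0 < ε1 := by positivity
  obtain ⟨CZ, hCZ, hZ⟩ := kapEuler (2 * A) (c0 := 1) (C3 := 0) (s0 := 2) (ε := ε / 2) zero_le_one le_rfl (by norm_num)
    (by positivity)
  obtain ⟨CG, hCG, hG⟩ := kapEuler A (c0 := 2) (C3 := C3) (s0 := 2 * r) (ε := ε1) zero_le_two hC3.le (by linarith)
    hε1p
  set G0 : ℝ := (4 ^ A * B) ^ (1 - r) with hG0
  have hG01 : 1 ≤ G0 := Real.one_le_rpow (by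
    calc (1:ℝ) = 1 * 1 := by ring
      _ ≤ _ := by gcongr) hu.le
  have h36 : 1 ≤ 36 * CZ := by linarith
  have hCp : 1 ≤ (36 * CZ) ^ (1 - r) * (G0 ^ P0 * CG) := by
    have a1 := Real.one_le_rpow h36 hu.le
    have a2 : 1 ≤ G0 ^ P0 := one_le_pow₀ hG01
    have a3 : 1 ≤ G0 ^ P0 * CG := by
      calc (1:ℝ) = 1 * 1 := by ring
        _ ≤ _ := by gcongr
    calc (1:ℝ) = 1 * 1 := by ring
        _ ≤ _ := by gcongr
  refine ⟨(36 * CZ) ^ (1 - r) * (G0 ^ P0 * CG), hCp, ?_⟩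
  intro t K ht hK ψ hψ S hS0 hSψ E0 hE0 hE1 hE2 hEK
  have ht0 : 0 < t := by linarith
  have hmu : ∀ v, 0 ≤ muw ψ v := fun v => mul_nonneg (hψ v) (by positivity)
  have hmS : 0 ≤ ∑ v ∈ S, muw ψ v := sum_nonneg fun v _ => hmu v
  rcases (me_nonneg hmu E0).eq_or_lt with he | he
  · rw [← he]; positivity
  set T := S.biUnion Nat.primeFactors with hTd
  have hT : ∀ P ∈ T, P.Prime := by
    intro P hP
    obtain ⟨v, _, hv⟩ := mem_biUnion.1 hP
    exact Nat.prime_of_mem_primeFactors hv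
  have hST : ∀ v ∈ S, v.primeFactors ⊆ T := fun v hv => subset_biUnion_of_mem _ hv
  set θ : ℕ → ℝ := fun P => kap t P ^ A with hθ
  have hθ1 : ∀ P, 1 ≤ θ P := fun P => one_le_pow₀ (one_le_kap t P)
  have hθ4 : ∀ P : ℕ, P.Prime → θ P ≤ 4 ^ A := fun P hP => (kap_pow t hP.one_le A).1
  set c : ℕ → ℕ → ℕ → ℝ := fun P => if P < P0 then cS r B P else cL r C3 (θ P) (1 / (P:ℝ)) with hc
  have hLarge : ∀ P : ℕ, P.Prime → P0 ≤ P →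
      2 * (1 - r) * θ P * (1 / (P:ℝ)) + C3 * (1 / (P:ℝ)) ^ (2 * r) ≤ 1 / 2 := by
    intro P hP hPP
    refine le_trans ?_ (hLg P hPP).1
    have := hθ4 P hP
    gcongr
  have hcpos : ∀ P : ℕ, P.Prime → ∀ k l, 0 < c P k l := by
    intro P hP k l
    have hPp : (0:ℝ) < 1 / (P:ℝ) := by have := hP.pos; positivity
    by_cases h : P < P0
    · simp only [hc, h, if_true]
      unfold cS; positivity
    · push Not at h
      simp only [hc, not_lt.2 h, if_false]
      have h5 := hLarge P hP h
      have h6 : 0 ≤ 2 * (1 - r) * θ P * (1 / (P:ℝ)) := by have := hθ1 P; positivity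
      have h7 : 0 < θ P := by linarith [hθ1 P]
      unfold cL
      split_ifs
      · linarith
      · linarith
      · positivity
  obtain ⟨V, hV, W, hW, E, hE, a, b, hEVW, ha, hb, haT, hbT, hav, hbw, hmin, hep, hle⟩ :=
    induct (r := r) (c := c) (by
      intro P hP
      by_cases h : P < P0
      · simp only [hc, h, if_true]; exact hSm P hP.two_le
      · simp only [hc, h, if_false]; exact (hLg P (not_lt.1 h)).2 _ (hθ1 P) (hθ4 P hP))
      (fun P hP k l => (hcpos P hP k l).le) hmu S E0 hE0 he T hT
  have F := combine (t := t) (K := K) (κ := kap t) A hψ hT (one_le_kap t) (by linarith) ht0 ha hb haT hbT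
    (fun v hv => hS0 v (hV hv)) (fun v hv => hS0 v (hW hv)) (fun v hv => hSψ v (hV hv))
    (fun v hv => hSψ v (hW hv)) (fun v hv => hST v (hV hv)) (fun v hv => hST v (hW hv)) hEVW hav hbw hmin
    (fun p hp => hE1 p (hE hp)) (fun p hp => hE2 p (hE hp)) (fun p hp => hEK p (hE hp))
  have hZt := hZ t ht T hT
  have hGt := hG t ht T hT
  have hZeq : ∏ P ∈ T, (1 + (kap t P ^ (2 * A) - 1) / (P:ℝ)) =
      ∏ P ∈ T, (1 + 1 * ((kap t P ^ (2 * A) - 1) * (1 / (P:ℝ)) + 0 * (1 / (P:ℝ)) ^ (2:ℝ))) := by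
    apply prod_congr rfl; intro P _; ring
  rw [hZeq] at F
  set Z := ∏ P ∈ T, (1 + 1 * ((kap t P ^ (2 * A) - 1) * (1 / (P:ℝ)) + 0 * (1 / (P:ℝ)) ^ (2:ℝ))) with hZd
  set L := ∏ P ∈ T, loc (kap t P ^ A) P (a.factorization P) (b.factorization P) with hL
  have hL0 : 0 ≤ L := prod_nonneg fun P hP => loc_nonneg (hθ1 P) (hT P hP) _ _
  set M := (∑ v ∈ V, muw ψ v) * ∑ w ∈ W, muw ψ w with hM
  have hM0 : 0 < M := hep.trans_le (me_le_mul hmu hEVW)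
  have hKA : 0 < K ^ A := by positivity
  have hfin : me (muw ψ) E ^ 2 ≤ (36 * CZ * (t ^ (2 + ε / 2) / K ^ A)) * L * M := by
    have q1 : 36 * t ^ 2 * Z * L * M ≤ 36 * t ^ 2 * (CZ * t ^ (ε / 2)) * L * M := by gcongr
    have q2 := F.trans q1
    rw [← le_div_iff₀ hKA] at q2
    refine q2.trans (le_of_eq ?_)
    rw [Real.rpow_add ht0, Real.rpow_two]; ring
  have hcp : 0 < ∏ P ∈ T, c P (a.factorization P) (b.factorization P) :=
    prod_pos fun P hP => hcpos P (hT P hP) _ _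
  have hLc : L ^ (1 - r) ≤ (G0 ^ P0 * (CG * t ^ ε1)) * ∏ P ∈ T, c P (a.factorization P) (b.factorization P) := by
    rw [hL, ← Real.finsetProd_rpow _ _ (fun P hP => loc_nonneg (hθ1 P) (hT P hP) _ _)]
    have st : ∀ P ∈ T, loc (kap t P ^ A) P (a.factorization P) (b.factorization P) ^ (1 - r) ≤
        (if P < P0 then G0 else 1) *
        (1 + 2 * ((kap t P ^ A - 1) * (1 / (P:ℝ)) + C3 * (1 / (P:ℝ)) ^ (2 * r))) *
        c P (a.factorization P) (b.factorization P) := by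
      intro P hP
      have hPp := hT P hP
      have hg0 : 0 ≤ (θ P - 1) * (1 / (P:ℝ)) := mul_nonneg (by linarith [hθ1 P]) (by positivity)
      have hg1 : 1 ≤ 1 + 2 * ((kap t P ^ A - 1) * (1 / (P:ℝ)) + C3 * (1 / (P:ℝ)) ^ (2 * r)) := by
        have : 0 ≤ C3 * (1 / (P:ℝ)) ^ (2 * r) := by positivity
        have h3 : (θ P - 1) * (1 / (P:ℝ)) = (kap t P ^ A - 1) * (1 / (P:ℝ)) := rfl
        rw [h3] at hg0
        linarith
      by_cases h : P < P0
      · simp only [hc, h, if_true]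
        refine (locSmall h1 hB (hθ1 P) hPp _ _).trans ?_
        have q0 : 0 ≤ cS r B P (a.factorization P) (b.factorization P) := by unfold cS; positivity
        apply mul_le_mul_of_nonneg_right _ q0
        have q1 : (kap t P ^ A * B) ^ (1 - r) ≤ G0 := by
          apply Real.rpow_le_rpow (by have := hθ1 P; positivity) _ hu.le
          exact mul_le_mul_of_nonneg_right (hθ4 P hPp) (by linarith)
        exact q1.trans (le_mul_of_one_le_right (by linarith) hg1)
      · simp only [hc, h, if_false, one_mul]
        exact (locLarge h0 h1 hC3 (hθ1 P) hPp rfl (hLarge P hPp (not_lt.1 h)) _ _).2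
    refine (Finset.prod_le_prod (fun P hP => Real.rpow_nonneg (loc_nonneg (hθ1 P) (hT P hP) _ _) _) st).trans ?_
    rw [prod_mul_distrib, prod_mul_distrib]
    apply mul_le_mul_of_nonneg_right _ hcp.le
    have q3 : ∏ P ∈ T, (if P < P0 then G0 else 1) ≤ G0 ^ P0 := by
      rw [← prod_filter, prod_const]
      apply pow_le_pow_right₀ hG01
      calc _ ≤ (range P0).card := card_le_card (fun P hP => mem_range.2 (mem_filter.1 hP).2)
        _ = P0 := card_range _
    apply mul_le_mul q3 hGt _ (by positivity)
    apply prod_nonneg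
    intro P _
    have : 0 ≤ kap t P ^ A - 1 := by have := hθ1 P; simp only [hθ] at this; linarith
    positivity
  have hfinal := star_calc h0 h1 hM0 hep.le (me_le_mul hmu hEVW) (mul_nonneg hmS hmS) hL0 (by positivity)
    hle hfin hLc hcp
  refine hfinal.trans (le_of_eq ?_)
  have e1 : ((∑ v ∈ S, muw ψ v) * ∑ v ∈ S, muw ψ v) ^ r = (∑ v ∈ S, muw ψ v) ^ (2 * r) := by
    rw [Real.rpow_mul hmS, Real.rpow_two, sq]
  rw [e1]
  have e2 : (36 * CZ * (t ^ (2 + ε / 2) / K ^ A)) ^ (1 - r) * t ^ ε1 =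
      (36 * CZ) ^ (1 - r) * (t ^ (2 + ε) / K ^ A) ^ (1 - r) := by
    rw [Real.mul_rpow (by positivity) (by positivity), Real.div_rpow (by positivity) hKA.le,
      Real.div_rpow (by positivity) hKA.le, ← Real.rpow_mul ht0.le, ← Real.rpow_mul ht0.le]
    have : (2 + ε) * (1 - r) = (2 + ε / 2) * (1 - r) + ε1 := by rw [hε1]; ring
    rw [this, Real.rpow_add ht0]; ring
  calc _ = ((36 * CZ * (t ^ (2 + ε / 2) / K ^ A)) ^ (1 - r) * t ^ ε1) * (G0 ^ P0 * CG) *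
        (∑ v ∈ S, muw ψ v) ^ (2 * r) := by ring
    _ = _ := by rw [e2]; ring

end QDS

namespace QDS
open Finset

lemma crt_exact (h : ℕ → ℕ → Prop) [∀ p, DecidablePred (h p)] (u : ℕ → ℕ) (X : Finset ℕ)
    (hX : ∀ p ∈ X, p.Prime) (hper : ∀ p ∈ X, ∀ s, h p (s % p) ↔ h p s)
    (hu : ∀ p ∈ X, ((range p).filter (h p)).card ≤ u p) :
    ((range (∏ p ∈ X, p)).filter (fun s => ∀ p ∈ X, h p s)).card ≤ ∏ p ∈ X, u p := by
  induction X using Finset.induction_on with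
  | empty => simp
  | insert p X hpX ih =>
    have ih' := ih (fun q hq => hX q (mem_insert_of_mem hq)) (fun q hq => hper q (mem_insert_of_mem hq))
      (fun q hq => hu q (mem_insert_of_mem hq))
    set N := ∏ q ∈ X, q with hN
    have hp := hX p (mem_insert_self _ _)
    have hN0 : 0 < N := prod_pos fun q hq => (hX q (mem_insert_of_mem hq)).pos
    have hcop : Nat.Coprime p N := by
      apply Nat.Coprime.prod_right
      intro q hq
      rw [Nat.coprime_primes hp (hX q (mem_insert_of_mem hq))]
      rintro rfl; exact hpX hq
    rw [prod_insert hpX, prod_insert hpX, ← hN]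
    have hdiv : ∀ q ∈ X, q ∣ N := fun q hq => dvd_prod_of_mem _ hq
    have hmap : ∀ s ∈ (range (p * N)).filter (fun s => ∀ q ∈ insert p X, h q s),
        s % N ∈ (range N).filter (fun s => ∀ q ∈ X, h q s) := by
      intro s hs
      rw [mem_filter] at hs ⊢
      refine ⟨mem_range.2 (Nat.mod_lt _ hN0), fun q hq => ?_⟩
      rw [← hper q (mem_insert_of_mem hq), Nat.mod_mod_of_dvd _ (hdiv q hq), hper q (mem_insert_of_mem hq)]
      exact hs.2 q (mem_insert_of_mem hq)
    rw [card_eq_sum_card_fiberwise hmap]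
    calc _ ≤ ∑ x ∈ (range N).filter (fun s => ∀ q ∈ X, h q s), u p := by
          apply sum_le_sum
          intro x _
          refine le_trans ?_ (hu p (mem_insert_self _ _))
          apply card_le_card_of_injOn (fun s => s % p)
          · intro s hs
            have hs' := mem_filter.1 (mem_coe.1 hs)
            have hs2 := mem_filter.1 hs'.1
            refine mem_coe.2 (mem_filter.2 ⟨mem_range.2 (Nat.mod_lt _ hp.pos), ?_⟩)
            exact (hper p (mem_insert_self _ _) s).2 (hs2.2 p (mem_insert_self _ _))
          · intro s hs s' hs' hss
            have hs1 := mem_filter.1 (mem_coe.1 hs)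
            have hs2 := mem_filter.1 (mem_coe.1 hs')
            have l1 := mem_range.1 (mem_filter.1 hs1.1).1
            have l2 := mem_range.1 (mem_filter.1 hs2.1).1
            have m1 : s ≡ s' [MOD p] := hss
            have m2 : s ≡ s' [MOD N] := hs1.2.trans hs2.2.symm
            have := (Nat.modEq_and_modEq_iff_modEq_mul hcop).1 ⟨m1, m2⟩
            exact Nat.ModEq.eq_of_lt_of_lt this l1 l2
      _ = _ := by rw [sum_const, smul_eq_mul]
      _ ≤ _ := by rw [mul_comm]; exact Nat.mul_le_mul_left _ ih'

lemma count_mul_periodic (Q : ℕ → Prop) [DecidablePred Q] (N k : ℕ) (hQ : ∀ s, Q (s % N) ↔ Q s) :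
    Nat.count Q (N * k) = k * Nat.count Q N := by
  induction k with
  | zero => simp
  | succ k ih =>
    rw [Nat.mul_succ, Nat.count_add, ih]
    have : (fun j => Q (N * k + j)) = Q := by
      funext j
      rw [← hQ, Nat.mul_add_mod, hQ]
    simp only [this]; ring

lemma crt_count (h : ℕ → ℕ → Prop) [∀ p, DecidablePred (h p)] (u : ℕ → ℕ) (X : Finset ℕ) (g : ℕ)
    (hX : ∀ p ∈ X, p.Prime) (hper : ∀ p ∈ X, ∀ s, h p (s % p) ↔ h p s)
    (hu : ∀ p ∈ X, ((range p).filter (h p)).card ≤ u p) (hg : ∏ p ∈ X, p ∣ g) :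
    (((range g).filter (fun s => ∀ p ∈ X, h p s)).card : ℝ) ≤ g * ∏ p ∈ X, ((u p : ℝ) / p) := by
  have h1 := crt_exact h u X hX hper hu
  obtain ⟨k, hk⟩ := hg
  set N := ∏ p ∈ X, p with hN
  have hN0 : 0 < N := prod_pos fun q hq => (hX q hq).pos
  have h2 := count_mul_periodic (fun s => ∀ p ∈ X, h p s) N k (by
    intro s
    refine forall₂_congr fun p hp => ?_
    rw [← hper p hp, Nat.mod_mod_of_dvd _ (dvd_prod_of_mem _ hp), hper p hp])
  rw [Nat.count_eq_card_filter_range, Nat.count_eq_card_filter_range, ← hk] at h2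
  rw [h2, hk, prod_div_distrib, ← Nat.cast_prod, ← Nat.cast_prod, ← hN]
  push_cast
  have : (((range N).filter (fun s => ∀ p ∈ X, h p s)).card : ℝ) ≤ ((∏ p ∈ X, u p : ℕ) : ℝ) := by
    exact_mod_cast h1
  have hN0' : (N:ℝ) ≠ 0 := by positivity
  calc (k:ℝ) * _ ≤ k * ((∏ p ∈ X, u p : ℕ) : ℝ) := by gcongr
    _ = _ := by push_cast; field_simp

/-- a bad residue exists -/
lemma bad_res {p : ℕ} (hp : p.Prime) {a q : ℤ} (hq : ¬ (p:ℤ) ∣ q) :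
    ∃ s ∈ range p, (p:ℤ) ∣ a + q * (s:ℤ) := by
  have := Fact.mk hp
  have hq' : (q : ZMod p) ≠ 0 := by rwa [Ne, ZMod.intCast_zmod_eq_zero_iff_dvd]
  refine ⟨(-(a : ZMod p) / q).val, mem_range.2 (ZMod.val_lt _), ?_⟩
  rw [← ZMod.intCast_zmod_eq_zero_iff_dvd]
  push_cast
  rw [ZMod.natCast_zmod_val]
  field_simp
  ring

lemma nuBound {g q' r' : ℕ} (hg : 0 < g) (hq : 0 < q') (hr : 0 < r') (hcop : Nat.Coprime q' r') (c : ℤ)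
    (F : Finset (ℤ × ℤ)) (hF : ∀ x ∈ F, 0 ≤ x.1 ∧ x.1 < (g * q' : ℕ) ∧ IsCoprime x.1 ((g * q' : ℕ) : ℤ) ∧
      IsCoprime x.2 ((g * r' : ℕ) : ℤ) ∧ x.1 * r' - x.2 * q' = c) :
    (F.card : ℝ) ≤ g * ∏ p ∈ g.primeFactors,
      (if p ∣ q' * r' ∨ (p:ℤ) ∣ c then 1 - 1 / (p:ℝ) else 1 - 2 / (p:ℝ)) := by
  classical
  have hnn : ∀ p ∈ g.primeFactors, 0 ≤ (if p ∣ q' * r' ∨ (p:ℤ) ∣ c then 1 - 1 / (p:ℝ) else 1 - 2 / (p:ℝ)) := by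
    intro p hp
    have h2 : (2:ℝ) ≤ p := by exact_mod_cast (Nat.prime_of_mem_primeFactors hp).two_le
    split_ifs
    · rw [sub_nonneg, div_le_one (by linarith)]; linarith
    · rw [sub_nonneg, div_le_one (by linarith)]; linarith
  rcases F.eq_empty_or_nonempty with hE | ⟨⟨a0, b0⟩, hab⟩
  · rw [hE]; simp only [card_empty, Nat.cast_zero]
    exact mul_nonneg (by positivity) (prod_nonneg hnn)
  obtain ⟨_, _, ca0, cb0, habc⟩ := hF _ hab
  simp only at ca0 cb0 habc
  let h : ℕ → ℕ → Prop := fun p s => ¬ (p:ℤ) ∣ a0 + q' * (s:ℤ) ∧ ¬ (p:ℤ) ∣ b0 + r' * (s:ℤ)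
  let u : ℕ → ℕ := fun p => if p ∣ q' * r' ∨ (p:ℤ) ∣ c then p - 1 else p - 2
  have hcq : IsCoprime (q':ℤ) (r':ℤ) := Nat.isCoprime_iff_coprime.2 hcop
  have key : (F.card : ℝ) ≤ (((range g).filter (fun s => ∀ p ∈ g.primeFactors, h p s)).card : ℝ) := by
    have hgz : (g:ℤ) ≠ 0 := by positivity
    -- choose k
    have hk : ∀ x ∈ F, ∃ k : ℤ, x.1 = a0 + q' * k ∧ x.2 = b0 + r' * k := by
      intro x hx
      obtain ⟨_, _, _, _, hx5⟩ := hF x hx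
      have e : (x.1 - a0) * r' = (x.2 - b0) * q' := by linarith
      have d : (q':ℤ) ∣ x.1 - a0 := by
        apply hcq.dvd_of_dvd_mul_right
        rw [e]; exact dvd_mul_left _ _
      obtain ⟨k, hk⟩ := d
      refine ⟨k, by linarith, ?_⟩
      rw [hk] at e
      have hq0 : (q':ℤ) ≠ 0 := by positivity
      have : (r' * k) * (q':ℤ) = (x.2 - b0) * q' := by linarith
      have := mul_right_cancel₀ hq0 this
      linarith
    choose! k hk1 hk2 using hk
    have hcong : ∀ x, ((k x % g).toNat : ℤ) = k x % g := fun x => Int.toNat_of_nonneg (Int.emod_nonneg _ hgz)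
    have : F.card ≤ ((range g).filter (fun s => ∀ p ∈ g.primeFactors, h p s)).card := by
      apply card_le_card_of_injOn (fun x => (k x % g).toNat)
      · intro x hx
        have hx := mem_coe.1 hx
        obtain ⟨_, _, cx, cy, _⟩ := hF x hx
        refine mem_coe.2 (mem_filter.2 ⟨mem_range.2 ?_, ?_⟩)
        · zify; rw [hcong]; exact Int.emod_lt_of_pos _ (by positivity)
        · intro p hp
          have hpp := Nat.prime_of_mem_primeFactors hp
          have hpg : (p:ℤ) ∣ g := by exact_mod_cast Nat.dvd_of_mem_primeFactors hp
          have hnu : ¬ IsUnit (p:ℤ) := by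
            rw [Int.isUnit_iff_natAbs_eq]; simpa using hpp.one_lt.ne'
          have hgd : ∀ m : ℤ, (p:ℤ) ∣ m * (k x) - m * (k x % g) := fun m => by
            rw [← mul_sub]
            apply Dvd.dvd.mul_left
            exact hpg.trans (Int.dvd_self_sub_emod)
          simp only [h, hcong]
          constructor
          · intro hd
            apply hnu
            have : (p:ℤ) ∣ x.1 := by
              rw [hk1 x hx]
              rw [show a0 + q' * k x = (a0 + q' * (k x % g)) + (q' * k x - q' * (k x % g)) by ring]
              exact dvd_add hd (hgd q')
            exact cx.isUnit_of_dvd' this (by push_cast; exact hpg.mul_right _)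
          · intro hd
            apply hnu
            have : (p:ℤ) ∣ x.2 := by
              rw [hk2 x hx]
              rw [show b0 + r' * k x = (b0 + r' * (k x % g)) + (r' * k x - r' * (k x % g)) by ring]
              exact dvd_add hd (hgd r')
            exact cy.isUnit_of_dvd' this (by push_cast; exact hpg.mul_right _)
      · intro x hx y hy hxy
        have hx := mem_coe.1 hx
        have hy := mem_coe.1 hy
        have hz : k x % g = k y % g := by rw [← hcong x, ← hcong y]; exact_mod_cast hxy
        obtain ⟨x1, x2, _, _, _⟩ := hF x hx
        obtain ⟨y1, y2, _, _, _⟩ := hF y hy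
        have hd : (g:ℤ) ∣ k y - k x := Int.ModEq.dvd hz
        have hd2 : ((g * q' : ℕ) : ℤ) ∣ y.1 - x.1 := by
          rw [hk1 x hx, hk1 y hy]
          push_cast
          rw [show a0 + q' * k y - (a0 + q' * k x) = (k y - k x) * q' by ring]
          exact mul_dvd_mul_right hd (q':ℤ)
        have he : y.1 - x.1 = 0 := Int.eq_zero_of_abs_lt_dvd hd2 (by rw [abs_lt]; constructor <;> linarith)
        have hkk : k x = k y := by
          rw [hk1 x hx, hk1 y hy] at he
          have hq0 : (q':ℤ) ≠ 0 := by positivity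
          have : (q':ℤ) * k x = q' * k y := by linarith
          exact mul_left_cancel₀ hq0 this
        apply Prod.ext
        · linarith
        · rw [hk2 x hx, hk2 y hy, hkk]
    exact_mod_cast this
  have hper : ∀ p ∈ g.primeFactors, ∀ s, h p (s % p) ↔ h p s := by
    intro p _ s
    have hd : ∀ m n : ℤ, (p:ℤ) ∣ n + m * ((s % p : ℕ) : ℤ) ↔ (p:ℤ) ∣ n + m * (s:ℤ) := by
      intro m n
      apply dvd_iff_dvd_of_dvd_sub
      have e : n + m * ((s % p : ℕ) : ℤ) - (n + m * (s:ℤ)) = - (m * ((s:ℤ) - (s:ℤ) % p)) := by push_cast; ring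
      rw [e, dvd_neg]
      exact Dvd.dvd.mul_left Int.dvd_self_sub_emod _
    simp only [h, hd]
  have hcardU : ∀ p ∈ g.primeFactors, ((range p).filter (h p)).card ≤ u p := by
    intro p hp
    have hpp := Nat.prime_of_mem_primeFactors hp
    have hsplit := card_filter_add_card_filter_not (s := range p) (h p)
    rw [card_range] at hsplit
    have hpz : Prime (p:ℤ) := Nat.prime_iff_prime_int.1 hpp
    have hone : 1 ≤ ((range p).filter (fun s => ¬ h p s)).card := by
      apply card_pos.2
      have : ¬ (p:ℤ) ∣ q' ∨ ¬ (p:ℤ) ∣ r' := by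
        by_contra hcon
        push Not at hcon
        exact hpz.not_isUnit (hcq.isUnit_of_dvd' hcon.1 hcon.2)
      rcases this with hh | hh
      · obtain ⟨s, hs, hd⟩ := bad_res hpp (a := a0) hh
        exact ⟨s, mem_filter.2 ⟨hs, fun hhs => hhs.1 hd⟩⟩
      · obtain ⟨s, hs, hd⟩ := bad_res hpp (a := b0) hh
        exact ⟨s, mem_filter.2 ⟨hs, fun hhs => hhs.2 hd⟩⟩
    simp only [u]
    split_ifs with hc
    · omega
    · push Not at hc
      have hq1 : ¬ (p:ℤ) ∣ q' := fun hd => hc.1 (Dvd.dvd.mul_right (by exact_mod_cast hd) _)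
      have hr1 : ¬ (p:ℤ) ∣ r' := fun hd => hc.1 (Dvd.dvd.mul_left (by exact_mod_cast hd) _)
      obtain ⟨s, hs, hd⟩ := bad_res hpp (a := a0) hq1
      obtain ⟨s', hs', hd'⟩ := bad_res hpp (a := b0) hr1
      have hne : s ≠ s' := by
        rintro rfl
        apply hc.2
        rw [← habc]
        rw [show a0 * r' - b0 * q' = (a0 + q' * (s:ℤ)) * r' - (b0 + r' * (s:ℤ)) * q' by ring]
        exact dvd_sub (hd.mul_right (r':ℤ)) (hd'.mul_right (q':ℤ))
      have : ({s, s'} : Finset ℕ) ⊆ (range p).filter (fun s => ¬ h p s) := by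
        intro z hz
        rw [mem_insert, mem_singleton] at hz
        rcases hz with rfl | rfl
        · exact mem_filter.2 ⟨hs, fun hhs => hhs.1 hd⟩
        · exact mem_filter.2 ⟨hs', fun hhs => hhs.2 hd'⟩
      have := card_le_card this
      rw [card_pair hne] at this
      omega
  have := crt_count h u g.primeFactors g (fun p hp => Nat.prime_of_mem_primeFactors hp) hper hcardU
    (Nat.prod_primeFactors_dvd g)
  refine key.trans (this.trans (le_of_eq ?_))
  congr 1
  apply prod_congr rfl
  intro p hp
  have h2 := (Nat.prime_of_mem_primeFactors hp).two_le
  have hp0 : (p:ℝ) ≠ 0 := by positivity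
  simp only [u]
  split_ifs
  · rw [Nat.cast_sub (by omega)]; field_simp; norm_num
  · rw [Nat.cast_sub (by omega)]; field_simp; norm_num

lemma mult_count {L : ℝ} (x : ℝ) (hL : 0 ≤ L) {d : ℕ} (hd : 0 < d) (J : Finset ℤ)
    (hJ : ∀ c : ℤ, c ∈ J ↔ x < c ∧ c < x + L) :
    |((J.filter (fun c => (d:ℤ) ∣ c)).card : ℝ) - L / d| ≤ 1 := by
  have hd' : (0:ℝ) < d := by positivity
  have e : (J.filter (fun c => (d:ℤ) ∣ c)).card = (Finset.Ioo ⌊x / d⌋ ⌈(x + L) / d⌉).card := by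
    symm
    apply card_bij (fun k _ => (d:ℤ) * k)
    · intro k hk
      obtain ⟨h1, h2⟩ := mem_Ioo.1 hk
      rw [Int.floor_lt, div_lt_iff₀ hd'] at h1
      rw [Int.lt_ceil, lt_div_iff₀ hd'] at h2
      refine mem_filter.2 ⟨(hJ _).2 ?_, dvd_mul_right _ _⟩
      push_cast; constructor <;> linarith
    · intro k _ k' _ hkk
      exact mul_left_cancel₀ (by positivity) hkk
    · intro c hc
      obtain ⟨h1, k, rfl⟩ := mem_filter.1 hc
      have := (hJ _).1 h1
      push_cast at this
      refine ⟨k, mem_Ioo.2 ⟨?_, ?_⟩, rfl⟩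
      · rw [Int.floor_lt, div_lt_iff₀ hd']; linarith
      · rw [Int.lt_ceil, lt_div_iff₀ hd']; linarith
  rw [e, Int.card_Ioo]
  have c1 := Int.ceil_lt_add_one ((x + L) / d)
  have c2 := Int.le_ceil ((x + L) / d)
  have f1 := Int.lt_floor_add_one (x / d)
  have f2 := Int.floor_le (x / d)
  have e2 : (x + L) / d = x / d + L / d := by ring
  have hLd : 0 ≤ L / d := by positivity
  set m := ⌈(x + L) / d⌉ - ⌊x / d⌋ - 1 with hm
  have hmr : (m:ℝ) = ⌈(x + L) / d⌉ - ⌊x / d⌋ - 1 := by rw [hm]; push_cast; ring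
  rcases le_total 0 m with h | h
  · have : ((m.toNat : ℕ) : ℝ) = m := by
      have := Int.toNat_of_nonneg h
      exact_mod_cast this
    rw [this, abs_le]
    constructor <;> linarith
  · rw [Int.toNat_of_nonpos h]
    have : (m:ℝ) ≤ 0 := by exact_mod_cast h
    rw [abs_le]; push_cast
    constructor <;> linarith

lemma sieve_count {L : ℝ} (x : ℝ) (hL : 0 ≤ L) (J : Finset ℤ) (hJ : ∀ c : ℤ, c ∈ J ↔ x < c ∧ c < x + L)
    (X : Finset ℕ) (hX : ∀ p ∈ X, p.Prime) : ∀ d : ℕ, 0 < d → (∀ p ∈ X, Nat.Coprime p d) →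
    |((J.filter (fun c => (d:ℤ) ∣ c ∧ ∀ p ∈ X, ¬ (p:ℤ) ∣ c)).card : ℝ) - L / d * ∏ p ∈ X, (1 - 1 / (p:ℝ))| ≤
      2 ^ X.card := by
  induction X using Finset.induction_on with
  | empty =>
    intro d hd _
    simpa using mult_count x hL hd J hJ
  | insert p X hpX ih =>
    intro d hd hcop
    have hp := hX p (mem_insert_self _ _)
    have hXX : ∀ q ∈ X, q.Prime := fun q hq => hX q (mem_insert_of_mem hq)
    have i1 := ih hXX d hd (fun q hq => hcop q (mem_insert_of_mem hq))
    have i2 := ih hXX (p * d) (Nat.mul_pos hp.pos hd) (fun q hq => by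
      apply Nat.Coprime.mul_right _ (hcop q (mem_insert_of_mem hq))
      rw [Nat.coprime_primes (hXX q hq) hp]
      rintro rfl; exact hpX hq)
    have hpd : IsCoprime (p:ℤ) (d:ℤ) := Nat.isCoprime_iff_coprime.2 (hcop p (mem_insert_self _ _))
    have split : (J.filter (fun c => (d:ℤ) ∣ c ∧ ∀ q ∈ X, ¬ (q:ℤ) ∣ c)).card =
        (J.filter (fun c => ((p * d : ℕ):ℤ) ∣ c ∧ ∀ q ∈ X, ¬ (q:ℤ) ∣ c)).card +
        (J.filter (fun c => (d:ℤ) ∣ c ∧ ∀ q ∈ insert p X, ¬ (q:ℤ) ∣ c)).card := by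
      rw [← card_filter_add_card_filter_not (fun c => (p:ℤ) ∣ c), filter_filter, filter_filter]
      congr 2
      · apply filter_congr
        intro c _
        constructor
        · rintro ⟨⟨h1, h2⟩, h3⟩
          refine ⟨?_, h2⟩
          push_cast
          exact hpd.mul_dvd h3 h1
        · rintro ⟨h1, h2⟩
          push_cast at h1
          exact ⟨⟨(dvd_mul_left _ _).trans h1, h2⟩, (dvd_mul_right _ _).trans h1⟩
      · apply filter_congr
        intro c _
        simp only [mem_insert, forall_eq_or_imp]
        tauto
    have hs : ((J.filter (fun c => (d:ℤ) ∣ c ∧ ∀ q ∈ X, ¬ (q:ℤ) ∣ c)).card : ℝ) =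
        (J.filter (fun c => ((p * d : ℕ):ℤ) ∣ c ∧ ∀ q ∈ X, ¬ (q:ℤ) ∣ c)).card +
        (J.filter (fun c => (d:ℤ) ∣ c ∧ ∀ q ∈ insert p X, ¬ (q:ℤ) ∣ c)).card := by exact_mod_cast split
    rw [prod_insert hpX, card_insert_of_notMem hpX, pow_succ]
    have hd0 : (d:ℝ) ≠ 0 := by positivity
    have hp0 : (p:ℝ) ≠ 0 := by have := hp.pos; positivity
    have e : L / d * ((1 - 1 / (p:ℝ)) * ∏ p ∈ X, (1 - 1 / (p:ℝ))) =
        L / d * (∏ p ∈ X, (1 - 1 / (p:ℝ))) - L / ((p * d : ℕ) : ℝ) * ∏ p ∈ X, (1 - 1 / (p:ℝ)) := by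
      push_cast; field_simp
    rw [e]
    rw [abs_le] at i1 i2 ⊢
    constructor <;> linarith [i1.1, i1.2, i2.1, i2.2]

end QDS

namespace QDS
open Finset

lemma nset_eq {g q' r' : ℕ} (hg : 0 < g) (hq : 0 < q') (hr : 0 < r') (hcop : Nat.Coprime q' r') :
    nset (g * q') (g * r') = (q' * r').primeFactors := by
  ext p
  unfold nset
  rw [mem_filter, mem_union, Nat.factorization_mul hg.ne' hq.ne', Nat.factorization_mul hg.ne' hr.ne']
  simp only [Finsupp.add_apply, Nat.mem_primeFactors, Nat.mul_ne_zero_iff, ne_eq]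
  constructor
  · rintro ⟨h1, h2⟩
    have hp : p.Prime := by tauto
    refine ⟨hp, ?_, by omega, by omega⟩
    by_contra hcon
    rw [hp.dvd_mul, not_or] at hcon
    rw [Nat.factorization_eq_zero_of_not_dvd hcon.1, Nat.factorization_eq_zero_of_not_dvd hcon.2] at h2
    exact h2 rfl
  · rintro ⟨hp, h1, _⟩
    rw [hp.dvd_mul] at h1
    have hcon : ¬ (p ∣ q' ∧ p ∣ r') := fun h => by
      have := Nat.dvd_gcd h.1 h.2
      rw [hcop] at this
      exact hp.one_lt.ne' (Nat.dvd_one.1 this)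
    rcases h1 with h | h
    · have h2 : ¬ p ∣ r' := fun hh => hcon ⟨h, hh⟩
      refine ⟨Or.inl ⟨hp, h.mul_left _, by omega, by omega⟩, ?_⟩
      rw [Nat.factorization_eq_zero_of_not_dvd h2]
      have := hp.factorization_pos_of_dvd hq.ne' h
      omega
    · have h2 : ¬ p ∣ q' := fun hh => hcon ⟨hh, h⟩
      refine ⟨Or.inr ⟨hp, h.mul_left _, by omega, by omega⟩, ?_⟩
      rw [Nat.factorization_eq_zero_of_not_dvd h2]
      have := hp.factorization_pos_of_dvd hr.ne' h
      omega

lemma phi_phi {g q' r' : ℕ} (hg : 0 < g) (hq : 0 < q') (hr : 0 < r') (hcop : Nat.Coprime q' r') :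
    ((Nat.totient (g * q') : ℝ) / (g * q' : ℕ)) * ((Nat.totient (g * r') : ℝ) / (g * r' : ℕ)) =
    (∏ p ∈ g.primeFactors.filter (fun p => p ∣ q' * r'), (1 - 1 / (p:ℝ))) *
    (∏ p ∈ g.primeFactors.filter (fun p => ¬ p ∣ q' * r'), (1 - 1 / (p:ℝ)) ^ 2) *
    ∏ p ∈ (q' * r').primeFactors, (1 - 1 / (p:ℝ)) := by
  have hgq : g * q' ≠ 0 := by positivity
  have hgr : g * r' ≠ 0 := by positivity
  have hqr : q' * r' ≠ 0 := by positivity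
  rw [phi_div hgq, phi_div hgr]
  set T := (g * (q' * r')).primeFactors with hT
  have ext1 : ∀ (m : ℕ) (f : ℕ → ℝ), m ≠ 0 → m ∣ g * (q' * r') →
      ∏ p ∈ m.primeFactors, f p = ∏ p ∈ T, if p ∣ m then f p else 1 := by
    intro m f hm hd
    rw [← prod_filter]
    congr 1
    ext p
    rw [mem_filter, hT, Nat.mem_primeFactors, Nat.mem_primeFactors]
    constructor
    · rintro ⟨a, b, c⟩; exact ⟨⟨a, b.trans hd, by positivity⟩, b⟩
    · rintro ⟨⟨a, _, _⟩, b⟩; exact ⟨a, b, hm⟩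
  rw [ext1 _ _ hgq (by use r'; ring), ext1 _ _ hgr (by use q'; ring), ext1 _ _ hqr (by use g; ring), prod_filter, prod_filter,
    ext1 _ _ hg.ne' (by use q' * r'), ext1 _ _ hg.ne' (by use q' * r'), ← prod_mul_distrib, ← prod_mul_distrib,
    ← prod_mul_distrib]
  apply prod_congr rfl
  intro p hp
  have hpp := Nat.prime_of_mem_primeFactors hp
  have hcon : ¬ (p ∣ q' ∧ p ∣ r') := fun h => by
    have := Nat.dvd_gcd h.1 h.2
    rw [hcop] at this
    exact hpp.one_lt.ne' (Nat.dvd_one.1 this)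
  simp only [hpp.dvd_mul]
  by_cases h1 : p ∣ g <;> by_cases h2 : p ∣ q' <;> by_cases h3 : p ∣ r' <;> simp [h1, h2, h3] <;> first | (exfalso; tauto) | ring

lemma scale_prod {t : ℝ} (ht : 1 ≤ t) (X : Finset ℕ) (x : ℕ → ℝ) (hx : ∀ p ∈ X, 0 ≤ x p) :
    t * (∏ p ∈ X, (1 + x p) - 1) ≤ ∏ p ∈ X, (1 + t * x p) - 1 := by
  induction X using Finset.induction_on with
  | empty => simp
  | insert p X hp ih =>
    rw [prod_insert hp, prod_insert hp]
    have h1 := ih fun q hq => hx q (mem_insert_of_mem hq)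
    have hxp := hx p (mem_insert_self _ _)
    have hle : ∏ q ∈ X, (1 + x q) ≤ ∏ q ∈ X, (1 + t * x q) := by
      apply Finset.prod_le_prod
      · intro q hq; have := hx q (mem_insert_of_mem hq); linarith
      · intro q hq
        have := hx q (mem_insert_of_mem hq)
        have := le_mul_of_one_le_left this ht
        linarith
    have h2 : t * x p * ∏ q ∈ X, (1 + x q) ≤ t * x p * ∏ q ∈ X, (1 + t * x q) :=
      mul_le_mul_of_nonneg_left hle (by positivity)
    linarith

lemma bigPart {t : ℝ} (ht : 1 ≤ t) (X : Finset ℕ) (hX : ∀ p ∈ X, p.Prime) (hXt : ∀ p ∈ X, ¬ (p:ℝ) ≤ t ^ 2) :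
    1 ≤ (∏ p ∈ X, (1 - 1 / (p:ℝ))) * (1 + 1 / t * ∏ p ∈ X, kap t p) := by
  have h1 : 1 ≤ (∏ p ∈ X, (1 - 1 / (p:ℝ))) * ∏ p ∈ X, (1 + 2 / (p:ℝ)) := by
    rw [← prod_mul_distrib]
    apply one_le_prodR
    intro p hp
    have h2 : (2:ℝ) ≤ p := by exact_mod_cast (hX p hp).two_le
    have hp0 : (0:ℝ) < p := by linarith
    have e : (1 - 1 / (p:ℝ)) * (1 + 2 / (p:ℝ)) = 1 + (p - 2) / p ^ 2 := by field_simp; ring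
    rw [e]
    have : 0 ≤ ((p:ℝ) - 2) / p ^ 2 := div_nonneg (by linarith) (by positivity)
    linarith
  refine h1.trans (mul_le_mul_of_nonneg_left ?_ (prod_nonneg fun p hp => (one_sub_inv_mem (hX p hp)).1))
  have h3 := scale_prod ht X (fun p => 2 / (p:ℝ)) (fun p _ => by positivity)
  have h4 : ∏ p ∈ X, (1 + t * (2 / (p:ℝ))) ≤ ∏ p ∈ X, kap t p := by
    apply Finset.prod_le_prod
    · intro p _; positivity
    · intro p hp
      have hgt := hXt p hp
      rw [kap, if_neg hgt]
      push Not at hgt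
      have hp0 : (0:ℝ) < p := by exact_mod_cast (hX p hp).pos
      have hs : t ≤ Real.sqrt p := Real.le_sqrt_of_sq_le hgt.le
      have hsp : 0 < Real.sqrt p := by linarith
      have e : t * (2 / (p:ℝ)) = t / Real.sqrt p * (2 / Real.sqrt p) := by
        rw [div_mul_div_comm, Real.mul_self_sqrt hp0.le]; ring
      rw [e]
      have : t / Real.sqrt p ≤ 1 := (div_le_one hsp).2 hs
      have := mul_le_mul_of_nonneg_right this (by positivity : 0 ≤ 2 / Real.sqrt p)
      linarith
  have ht0 : 0 < t := by linarith
  have h5 : t * ∏ p ∈ X, (1 + 2 / (p:ℝ)) ≤ t * (1 + 1 / t * ∏ p ∈ X, kap t p) := by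
    have : t * (1 + 1 / t * ∏ p ∈ X, kap t p) = t + ∏ p ∈ X, kap t p := by field_simp
    rw [this]; linarith
  exact le_of_mul_le_mul_left h5 ht0

lemma smallPart {t : ℝ} (X : Finset ℕ) (hX : ∀ p ∈ X, p.Prime) :
    (2:ℝ) ^ (X.filter (fun p : ℕ => (p:ℝ) ≤ t ^ 2)).card ≤ (∏ p ∈ X, (1 - 1 / (p:ℝ))) * ∏ p ∈ X, kap t p := by
  rw [← prod_const, prod_filter, ← prod_mul_distrib]
  apply Finset.prod_le_prod
  · intro p _; split_ifs <;> norm_num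
  · intro p hp
    have h2 : (2:ℝ) ≤ p := by exact_mod_cast (hX p hp).two_le
    have hp0 : (0:ℝ) < p := by linarith
    have h3 : 1 / (p:ℝ) ≤ 1 / 2 := one_div_le_one_div_of_le (by norm_num) h2
    unfold kap
    split_ifs
    · linarith
    · have hs1 : 1 ≤ Real.sqrt p := Real.one_le_sqrt.2 (by linarith)
      have e : (1:ℝ) / p = 1 / Real.sqrt p * (1 / Real.sqrt p) := by
        rw [div_mul_div_comm, Real.mul_self_sqrt hp0.le]; ring
      rw [e] at h3 ⊢
      have e3 : 2 / Real.sqrt p = 2 * (1 / Real.sqrt p) := by ring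
      rw [e3]
      have z0 : 0 ≤ 1 / Real.sqrt p := by positivity
      have z1 : 1 / Real.sqrt p ≤ 1 := (div_le_one (by linarith)).2 hs1
      generalize 1 / Real.sqrt p = z at *
      nlinarith

lemma g2Sum {ε : ℝ} (hε : 0 < ε) : ∃ C : ℝ, 1 ≤ C ∧ ∀ X : Finset ℕ, (∀ p ∈ X, p.Prime) →
    ∏ p ∈ X, ((p:ℝ) ^ (-(1 + ε)) + (1 - 2 / (p:ℝ))) ≤ C * ∏ p ∈ X, (1 - 1 / (p:ℝ)) ^ 2 := by
  obtain ⟨C, hC, h⟩ := euler (c := 4) (ε := 1) (s := 1 + ε) (by norm_num) one_pos (by linarith)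
  refine ⟨C, hC, ?_⟩
  intro X hX
  have h1 := h 1 le_rfl X hX
  rw [Real.one_rpow, mul_one] at h1
  refine le_trans ?_ (mul_le_mul_of_nonneg_right h1 (prod_nonneg fun p _ => sq_nonneg _))
  rw [← prod_mul_distrib]
  apply Finset.prod_le_prod
  · intro p hp
    have h2 : (2:ℝ) ≤ p := by exact_mod_cast (hX p hp).two_le
    have : 2 / (p:ℝ) ≤ 1 := (div_le_one (by linarith)).2 h2
    have : 0 ≤ (p:ℝ) ^ (-(1 + ε)) := by positivity
    linarith
  · intro p hp
    have h2 : (2:ℝ) ≤ p := by exact_mod_cast (hX p hp).two_le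
    rw [if_neg (by linarith), zero_add]
    have h3 : 1 / (p:ℝ) ≤ 1 / 2 := one_div_le_one_div_of_le (by norm_num) h2
    have h0 : 0 ≤ 1 / (p:ℝ) := by positivity
    have hz : 0 ≤ (p:ℝ) ^ (-(1 + ε)) := by positivity
    rw [show 2 / (p:ℝ) = 2 * (1 / (p:ℝ)) by ring]
    generalize 1 / (p:ℝ) = z at *
    generalize (p:ℝ) ^ (-(1 + ε)) = w at *
    have h5 : 1 / 4 ≤ (1 - z) ^ 2 := by nlinarith
    have h6 := mul_le_mul_of_nonneg_left h5 hz
    nlinarith [sq_nonneg z]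

end QDS

namespace QDS
open Finset

lemma fiberBound {g q' r' : ℕ} (hg : 0 < g) (hq : 0 < q') (hr : 0 < r') (hcop : Nat.Coprime q' r') (c : ℤ)
    (F : Finset (ℤ × ℤ)) (hF : ∀ x ∈ F, 0 ≤ x.1 ∧ x.1 < (g * q' : ℕ) ∧ IsCoprime x.1 ((g * q' : ℕ) : ℤ) ∧
      IsCoprime x.2 ((g * r' : ℕ) : ℤ) ∧ x.1 * r' - x.2 * q' = c) (hc : F.Nonempty → c ≠ 0)
    (Y : Finset ℕ) (hY : Y ⊆ (q' * r').primeFactors) :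
    (F.card : ℝ) ≤ g * (∏ p ∈ g.primeFactors.filter (fun p => p ∣ q' * r'), (1 - 1 / (p:ℝ))) *
      ∑ U ∈ (g.primeFactors.filter (fun p => ¬ p ∣ q' * r')).powerset,
        (∏ p ∈ U, 1 / (p:ℝ)) * (∏ p ∈ g.primeFactors.filter (fun p => ¬ p ∣ q' * r') \ U, (1 - 2 / (p:ℝ))) *
        (if c ≠ 0 ∧ (((∏ p ∈ U, p : ℕ) : ℤ) ∣ c ∧ ∀ p ∈ Y, ¬ (p:ℤ) ∣ c) then (1:ℝ) else 0) := by
  have hpr : ∀ p ∈ g.primeFactors, p.Prime := fun p hp => Nat.prime_of_mem_primeFactors hp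
  have h2p : ∀ p : ℕ, p.Prime → 0 ≤ 1 - 2 / (p:ℝ) := by
    intro p hp
    have h2 : (2:ℝ) ≤ p := by exact_mod_cast hp.two_le
    rw [sub_nonneg, div_le_one (by linarith)]; exact h2
  set G2 := g.primeFactors.filter (fun p => ¬ p ∣ q' * r') with hG2
  have hA : 0 ≤ (g:ℝ) * (∏ p ∈ g.primeFactors.filter (fun p => p ∣ q' * r'), (1 - 1 / (p:ℝ))) :=
    mul_nonneg (Nat.cast_nonneg _) (prod_nonneg fun p hp => (one_sub_inv_mem (hpr p (mem_filter.1 hp).1)).1)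
  have hw : ∀ U ∈ G2.powerset, 0 ≤ (∏ p ∈ U, 1 / (p:ℝ)) * (∏ p ∈ G2 \ U, (1 - 2 / (p:ℝ))) := by
    intro U _
    exact mul_nonneg (prod_nonneg fun p _ => by positivity)
      (prod_nonneg fun p hp => h2p p (hpr p (mem_filter.1 (mem_sdiff.1 hp).1).1))
  rcases F.eq_empty_or_nonempty with hE | hne
  · rw [hE, card_empty, Nat.cast_zero]
    exact mul_nonneg hA (sum_nonneg fun U hU => mul_nonneg (hw U hU) (by split_ifs <;> norm_num))
  have hc0 := hc hne
  obtain ⟨⟨a, b⟩, hab⟩ := hne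
  obtain ⟨_, _, ha, hb, e⟩ := hF _ hab
  simp only at ha hb e
  have hndiv : ∀ p ∈ (q' * r').primeFactors, ¬ (p:ℤ) ∣ c := by
    intro p hp hpc
    have hpp := Nat.prime_of_mem_primeFactors hp
    have hpz : Prime (p:ℤ) := Nat.prime_iff_prime_int.1 hpp
    have hcon : ¬ (p ∣ q' ∧ p ∣ r') := fun h => by
      have := Nat.dvd_gcd h.1 h.2
      rw [hcop] at this
      exact hpp.one_lt.ne' (Nat.dvd_one.1 this)
    rcases (hpp.dvd_mul).1 (Nat.dvd_of_mem_primeFactors hp) with h | h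
    · have h1 : (p:ℤ) ∣ a * r' := by
        rw [show a * r' = c + b * q' by linarith]
        exact dvd_add hpc (Dvd.dvd.mul_left (by exact_mod_cast h) _)
      rcases hpz.dvd_or_dvd h1 with h2 | h2
      · exact hpz.not_isUnit (ha.isUnit_of_dvd' h2 (by exact_mod_cast h.mul_left g))
      · exact hcon ⟨h, by exact_mod_cast h2⟩
    · have h1 : (p:ℤ) ∣ b * q' := by
        rw [show b * q' = a * r' - c by linarith]
        exact dvd_sub (Dvd.dvd.mul_left (by exact_mod_cast h) _) hpc
      rcases hpz.dvd_or_dvd h1 with h2 | h2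
      · exact hpz.not_isUnit (hb.isUnit_of_dvd' h2 (by exact_mod_cast h.mul_left g))
      · exact hcon ⟨by exact_mod_cast h2, h⟩
  refine (nuBound hg hq hr hcop c F hF).trans ?_
  rw [mul_assoc]
  refine mul_le_mul_of_nonneg_left ?_ (Nat.cast_nonneg _)
  rw [← prod_filter_mul_prod_filter_not g.primeFactors (fun p => p ∣ q' * r')]
  refine mul_le_mul (le_of_eq ?_) ?_ ?_ (prod_nonneg fun p hp => (one_sub_inv_mem (hpr p (mem_filter.1 hp).1)).1)
  · exact prod_congr rfl fun p hp => if_pos (Or.inl (mem_filter.1 hp).2)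
  · have e1 : ∏ p ∈ G2, (if p ∣ q' * r' ∨ (p:ℤ) ∣ c then 1 - 1 / (p:ℝ) else 1 - 2 / (p:ℝ)) =
        ∏ p ∈ G2, ((if (p:ℤ) ∣ c then 1 / (p:ℝ) else 0) + (1 - 2 / (p:ℝ))) := by
      apply prod_congr rfl
      intro p hp
      have := (mem_filter.1 hp).2
      by_cases h : (p:ℤ) ∣ c
      · simp only [h, or_true, if_true]; ring
      · simp only [h, this, or_false, if_false, zero_add]
    rw [e1, prod_add]
    apply sum_le_sum
    intro U hU
    by_cases hall : ∀ p ∈ U, (p:ℤ) ∣ c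
    · have hdv : ((∏ p ∈ U, p : ℕ) : ℤ) ∣ c := by
        rw [Nat.cast_prod]
        apply Finset.prod_dvd_of_coprime
        · intro p hp p' hp' hne
          have i1 := hpr p (mem_filter.1 (mem_powerset.1 hU hp)).1
          have i2 := hpr p' (mem_filter.1 (mem_powerset.1 hU hp')).1
          exact Nat.isCoprime_iff_coprime.2 ((Nat.coprime_primes i1 i2).2 hne)
        · exact hall
      rw [if_pos ⟨hc0, hdv, fun p hp => hndiv p (hY hp)⟩, mul_one, prod_congr rfl fun p hp => if_pos (hall p hp)]
    · push Not at hall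
      obtain ⟨p, hp, hpc⟩ := hall
      rw [prod_eq_zero hp (if_neg hpc), zero_mul]
      exact mul_nonneg (hw U hU) (by split_ifs <;> norm_num)
  · apply prod_nonneg
    intro p hp
    have hp' := hpr p (mem_filter.1 hp).1
    split_ifs
    · exact (one_sub_inv_mem hp').1
    · exact h2p p hp'

lemma dcount {L x ε : ℝ} (hε : 0 < ε) (hL : 0 ≤ L) (hx0 : x ≤ 0) (hxL : -L ≤ x) (J : Finset ℤ)
    (hJ : ∀ c : ℤ, c ∈ J ↔ x < c ∧ c < x + L)
    (Y : Finset ℕ) (hY : ∀ p ∈ Y, p.Prime) (d : ℕ) (hd : 0 < d) (hcop : ∀ p ∈ Y, Nat.Coprime p d) :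
    ((J.filter (fun c => c ≠ 0 ∧ ((d:ℤ) ∣ c ∧ ∀ p ∈ Y, ¬ (p:ℤ) ∣ c))).card : ℝ) ≤
      L / d * ∏ p ∈ Y, (1 - 1 / (p:ℝ)) + 2 ^ Y.card * (L / d) ^ ε := by
  have hP : 0 ≤ ∏ p ∈ Y, (1 - 1 / (p:ℝ)) := prod_nonneg fun p hp => (one_sub_inv_mem (hY p hp)).1
  rcases (J.filter (fun c => c ≠ 0 ∧ ((d:ℤ) ∣ c ∧ ∀ p ∈ Y, ¬ (p:ℤ) ∣ c))).eq_empty_or_nonempty with hE | ⟨c, hc⟩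
  · rw [hE, card_empty, Nat.cast_zero]
    positivity
  · obtain ⟨hcJ, hc0, hdc, _⟩ := mem_filter.1 hc
    have h1 := (hJ c).1 hcJ
    have hdpos : (0:ℝ) < d := by exact_mod_cast hd
    have h2 : (d:ℝ) ≤ |(c:ℝ)| := by
      have := Int.le_of_dvd (abs_pos.2 hc0) ((dvd_abs _ _).2 hdc)
      exact_mod_cast this
    have h3 : |(c:ℝ)| ≤ L := abs_le.2 ⟨by linarith, by linarith⟩
    have h4 : 1 ≤ L / d := (one_le_div hdpos).2 (h2.trans h3)
    have h5 : 1 ≤ (L / d) ^ ε := Real.one_le_rpow h4 hε.le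
    have h6 := (abs_le.1 (sieve_count x hL J hJ Y hY d hd hcop)).2
    have h7 : ((J.filter (fun c => c ≠ 0 ∧ ((d:ℤ) ∣ c ∧ ∀ p ∈ Y, ¬ (p:ℤ) ∣ c))).card : ℝ) ≤
        ((J.filter (fun c => (d:ℤ) ∣ c ∧ ∀ p ∈ Y, ¬ (p:ℤ) ∣ c)).card : ℝ) := by
      refine Nat.cast_le.2 (card_le_card ?_)
      intro z hz
      rw [mem_filter] at hz ⊢
      exact ⟨hz.1, hz.2.2⟩
    have h8 : (2:ℝ) ^ Y.card * 1 ≤ 2 ^ Y.card * (L / d) ^ ε := mul_le_mul_of_nonneg_left h5 (by positivity)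
    linarith

lemma cntBound {ε : ℝ} (hε : 0 < ε) (hε1 : ε < 1) : ∃ C : ℝ, 1 ≤ C ∧ ∀ (g q' r' : ℕ), 0 < g → 0 < q' → 0 < r' →
    Nat.Coprime q' r' → ∀ t L x : ℝ, 1 ≤ t → t ≤ L → x ≤ 0 → -L ≤ x → ∀ F : Finset (ℤ × ℤ),
    (∀ y ∈ F, 0 ≤ y.1 ∧ y.1 < (g * q' : ℕ) ∧ IsCoprime y.1 ((g * q' : ℕ) : ℤ) ∧
      IsCoprime y.2 ((g * r' : ℕ) : ℤ) ∧ y.1 * r' - y.2 * q' ≠ 0 ∧ x < ((y.1 * r' - y.2 * q' : ℤ) : ℝ) ∧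
      ((y.1 * r' - y.2 * q' : ℤ) : ℝ) < x + L) →
    (F.card : ℝ) ≤ L * g * (((Nat.totient (g * q') : ℝ) / (g * q' : ℕ)) * ((Nat.totient (g * r') : ℝ) / (g * r' : ℕ))) *
      (1 + C * (kapn t (g * q') (g * r') * t ^ (-1 + ε))) := by
  obtain ⟨C0, hC0, hg2⟩ := g2Sum hε
  refine ⟨1 + C0, by linarith, ?_⟩
  intro g q' r' hg hq hr hcop t L x ht hL hx0 hxL F hF
  have hL1 : 1 ≤ L := ht.trans hL
  set J : Finset ℤ := Finset.Ioo ⌊x⌋ ⌈x + L⌉ with hJd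
  have hJ : ∀ c : ℤ, c ∈ J ↔ x < c ∧ c < x + L := by
    intro c; rw [hJd, Finset.mem_Ioo, Int.floor_lt, Int.lt_ceil]
  set n := (q' * r').primeFactors with hn
  set Y := n.filter (fun p : ℕ => (p:ℝ) ≤ t ^ 2) with hYd
  set G2 := g.primeFactors.filter (fun p => ¬ p ∣ q' * r') with hG2
  have hnp : ∀ p ∈ n, p.Prime := fun p hp => Nat.prime_of_mem_primeFactors hp
  have hYp : ∀ p ∈ Y, p.Prime := fun p hp => hnp p (mem_filter.1 hp).1
  have hGp : ∀ p ∈ G2, p.Prime := fun p hp => Nat.prime_of_mem_primeFactors (mem_filter.1 hp).1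
  have h2p : ∀ p : ℕ, p.Prime → 0 ≤ 1 - 2 / (p:ℝ) := by
    intro p hp
    have h2 : (2:ℝ) ≤ p := by exact_mod_cast hp.two_le
    rw [sub_nonneg, div_le_one (by linarith)]; exact h2
  rw [phi_phi hg hq hr hcop, ← hG2, ← hn]
  set A := ∏ p ∈ g.primeFactors.filter (fun p => p ∣ q' * r'), (1 - 1 / (p:ℝ)) with hA
  set B := ∏ p ∈ G2, (1 - 1 / (p:ℝ)) ^ 2 with hB
  set Pn := ∏ p ∈ n, (1 - 1 / (p:ℝ)) with hPn
  set PY := ∏ p ∈ Y, (1 - 1 / (p:ℝ)) with hPY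
  have hA0 : 0 ≤ A := prod_nonneg fun p hp => (one_sub_inv_mem (Nat.prime_of_mem_primeFactors (mem_filter.1 hp).1)).1
  have hB0 : 0 ≤ B := prod_nonneg fun p hp => sq_nonneg _
  have hPn0 : 0 ≤ Pn := prod_nonneg fun p hp => (one_sub_inv_mem (hnp p hp)).1
  have hPY0 : 0 ≤ PY := prod_nonneg fun p hp => (one_sub_inv_mem (hYp p hp)).1
  have hkap : kapn t (g * q') (g * r') = ∏ p ∈ n, kap t p := by rw [kapn, nset_eq hg hq hr hcop]
  rw [hkap]
  set κ := ∏ p ∈ n, kap t p with hκ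
  set w : Finset ℕ → ℝ := fun U => ∏ p ∈ G2 \ U, (1 - 2 / (p:ℝ)) with hw
  have hw0 : ∀ U, 0 ≤ w U := fun U => prod_nonneg fun p hp => h2p p (hGp p (mem_sdiff.1 hp).1)
  have s1 : (F.card : ℝ) ≤ g * A * ∑ U ∈ G2.powerset, (∏ p ∈ U, 1 / (p:ℝ)) * w U *
      (L / ((∏ p ∈ U, p : ℕ) : ℝ) * PY + 2 ^ Y.card * (L / ((∏ p ∈ U, p : ℕ) : ℝ)) ^ ε) := by
    have hmaps : ∀ y ∈ F, y.1 * r' - y.2 * q' ∈ J := fun y hy => (hJ _).2 (hF y hy).2.2.2.2.2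
    rw [card_eq_sum_card_fiberwise hmaps, Nat.cast_sum]
    have := fun c : ℤ => fiberBound hg hq hr hcop c (F.filter (fun y => y.1 * r' - y.2 * q' = c))
      (by
        intro y hy
        obtain ⟨h1, h2⟩ := mem_filter.1 hy
        obtain ⟨a1, a2, a3, a4, _⟩ := hF y h1
        exact ⟨a1, a2, a3, a4, h2⟩)
      (by
        rintro ⟨y, hy⟩
        obtain ⟨h1, h2⟩ := mem_filter.1 hy
        rw [← h2]; exact (hF y h1).2.2.2.2.1) Y (filter_subset _ _)
    refine (sum_le_sum fun c _ => this c).trans ?_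
    rw [← mul_sum, sum_comm]
    refine mul_le_mul_of_nonneg_left ?_ (by positivity)
    apply sum_le_sum
    intro U hU
    rw [← mul_sum]
    refine mul_le_mul_of_nonneg_left ?_ (mul_nonneg (prod_nonneg fun p _ => by positivity) (hw0 U))
    rw [sum_boole]
    have hUp := fun p (hp : p ∈ U) => mem_powerset.1 hU hp
    apply dcount hε (by linarith) hx0 hxL J hJ Y hYp
    · exact prod_pos fun p hp => (hGp p (hUp p hp)).pos
    · intro p hp
      apply Nat.Coprime.prod_right
      intro p' hp'
      rw [Nat.coprime_primes (hYp p hp) (hGp p' (hUp p' hp'))]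
      rintro rfl
      exact (mem_filter.1 (hUp p hp')).2 (Nat.dvd_of_mem_primeFactors (mem_filter.1 hp).1)
  have s2 : ∑ U ∈ G2.powerset, (∏ p ∈ U, 1 / (p:ℝ)) * w U *
      (L / ((∏ p ∈ U, p : ℕ) : ℝ) * PY + 2 ^ Y.card * (L / ((∏ p ∈ U, p : ℕ) : ℝ)) ^ ε) =
      L * PY * B + 2 ^ Y.card * L ^ ε * ∏ p ∈ G2, ((p:ℝ) ^ (-(1 + ε)) + (1 - 2 / (p:ℝ))) := by
    have e1 : B = ∏ p ∈ G2, ((1 / (p:ℝ)) ^ 2 + (1 - 2 / (p:ℝ))) :=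
      prod_congr rfl fun p _ => by ring
    rw [e1, prod_add, prod_add, mul_sum, mul_sum, ← sum_add_distrib]
    apply sum_congr rfl
    intro U hU
    have hUp := fun p (hp : p ∈ U) => mem_powerset.1 hU hp
    have i1 : ∏ p ∈ U, 1 / (p:ℝ) = (((∏ p ∈ U, p : ℕ) : ℝ))⁻¹ := by
      rw [Nat.cast_prod, ← prod_inv_distrib]; exact prod_congr rfl fun p _ => one_div _
    have i2 : ∏ p ∈ U, (p:ℝ) ^ (-(1 + ε)) = ((∏ p ∈ U, p : ℕ) : ℝ) ^ (-(1 + ε)) := by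
      rw [Nat.cast_prod, Real.finsetProd_rpow _ _ (fun p _ => Nat.cast_nonneg _)]
    have hdpos : (0:ℝ) < ((∏ p ∈ U, p : ℕ) : ℝ) := by
      exact_mod_cast prod_pos fun p hp => (hGp p (hUp p hp)).pos
    rw [prod_pow, i1, i2]
    generalize ((∏ p ∈ U, p : ℕ) : ℝ) = d at *
    rw [Real.div_rpow (by linarith) hdpos.le, Real.rpow_neg hdpos.le, Real.rpow_add hdpos, Real.rpow_one]
    have : 0 < d ^ ε := by positivity
    field_simp
    rfl
  rw [s2] at s1
  have s3 := hg2 G2 hGp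
  rw [← hB] at s3
  have s4 : L ^ ε ≤ L * t ^ (-1 + ε) := by
    have : L ^ ε = L * L ^ (-1 + ε) := by
      rw [Real.rpow_add (by linarith), Real.rpow_neg_one]; field_simp
    rw [this]
    exact mul_le_mul_of_nonneg_left (Real.rpow_le_rpow_of_nonpos (by linarith) hL (by linarith)) (by linarith)
  have s5 : PY ≤ Pn * (1 + t ^ (-1 + ε) * κ) := by
    have b := bigPart ht (n.filter (fun p : ℕ => ¬ (p:ℝ) ≤ t ^ 2)) (fun p hp => hnp p (mem_filter.1 hp).1)
      (fun p hp => (mem_filter.1 hp).2)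
    have e : Pn = PY * ∏ p ∈ n.filter (fun p : ℕ => ¬ (p:ℝ) ≤ t ^ 2), (1 - 1 / (p:ℝ)) :=
      (prod_filter_mul_prod_filter_not n _ _).symm
    have m := prod_monoR (κ := kap t) (filter_subset (fun p : ℕ => ¬ (p:ℝ) ≤ t ^ 2) n) (fun P _ => one_le_kap t P)
    have k0 : 0 ≤ ∏ p ∈ n.filter (fun p : ℕ => ¬ (p:ℝ) ≤ t ^ 2), kap t p :=
      prod_nonneg fun p _ => zero_le_one.trans (one_le_kap t p)
    have tt : 1 / t ≤ t ^ (-1 + ε) := by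
      rw [one_div, ← Real.rpow_neg_one]; exact Real.rpow_le_rpow_of_exponent_le ht (by linarith)
    have b2 := mul_le_mul_of_nonneg_left b hPY0
    rw [mul_one, ← mul_assoc, ← e] at b2
    refine b2.trans (mul_le_mul_of_nonneg_left ?_ hPn0)
    have := mul_le_mul tt m k0 (by positivity)
    linarith
  have s6 : (2:ℝ) ^ Y.card ≤ Pn * κ := smallPart n hnp
  have hκ0 : 0 ≤ κ := prod_nonneg fun p _ => zero_le_one.trans (one_le_kap t p)
  have hτ : 0 < t ^ (-1 + ε) := by positivity
  refine s1.trans ?_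
  have s7 : L * PY * B ≤ L * (Pn * (1 + t ^ (-1 + ε) * κ)) * B := by gcongr
  have s8 : 2 ^ Y.card * L ^ ε * ∏ p ∈ G2, ((p:ℝ) ^ (-(1 + ε)) + (1 - 2 / (p:ℝ))) ≤
      Pn * κ * (L * t ^ (-1 + ε)) * (C0 * B) := by
    refine mul_le_mul (mul_le_mul s6 s4 (by positivity) (by positivity)) s3 ?_ (by positivity)
    exact prod_nonneg fun p hp => add_nonneg (by positivity) (h2p p (hGp p hp))
  have := mul_le_mul_of_nonneg_left (add_le_add s7 s8) (by positivity : 0 ≤ (g:ℝ) * A)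
  refine this.trans (le_of_eq ?_)
  ring

end QDS

namespace QDS
open Finset MeasureTheory

def As (ψ : ℕ → ℝ) (q : ℕ) : Set ℝ := {α | ∃ a : ℤ, |α - a / q| < ψ q / q ∧ Int.gcd a q = 1}

noncomputable def NN (ψ : ℕ → ℝ) (q : ℕ) : ℝ → ℝ := (As ψ q).indicator 1

noncomputable def lam (ψ : ℕ → ℝ) (q : ℕ) : ℝ := 2 * (Nat.totient q * ψ q / q)

lemma As_meas (ψ : ℕ → ℝ) (q : ℕ) : MeasurableSet (As ψ q) := by
  have : As ψ q = ⋃ a : ℤ, {α : ℝ | |α - a / q| < ψ q / q ∧ Int.gcd a q = 1} := by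
    ext α; simp [As]
  rw [this]
  apply MeasurableSet.iUnion
  intro a
  by_cases h : Int.gcd a q = 1
  · simp only [h, and_true]
    exact measurableSet_lt (by fun_prop) (by fun_prop)
  · simp [h]

lemma NN_meas (ψ : ℕ → ℝ) (q : ℕ) : Measurable (NN ψ q) := measurable_one.indicator (As_meas ψ q)

lemma NN_nonneg (ψ : ℕ → ℝ) (q : ℕ) (α : ℝ) : 0 ≤ NN ψ q α := Set.indicator_nonneg (fun _ _ => zero_le_one) _

lemma NN_le_one (ψ : ℕ → ℝ) (q : ℕ) (α : ℝ) : NN ψ q α ≤ 1 := by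
  unfold NN; apply Set.indicator_le' <;> simp

lemma As_periodic (ψ : ℕ → ℝ) {q : ℕ} (hq : 0 < q) (α : ℝ) : α + 1 ∈ As ψ q ↔ α ∈ As ψ q := by
  have hq0 : (q:ℝ) ≠ 0 := by positivity
  constructor
  · rintro ⟨a, h1, h2⟩
    refine ⟨a - q, ?_, ?_⟩
    · have : α - ((a - q : ℤ) : ℝ) / q = α + 1 - a / q := by push_cast; field_simp; ring
      rwa [this]
    · rw [← h2]; simp
  · rintro ⟨a, h1, h2⟩
    refine ⟨a + q, ?_, ?_⟩
    · have : α + 1 - ((a + q : ℤ) : ℝ) / q = α - a / q := by push_cast; field_simp; ring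
      rwa [this]
    · rw [← h2]; simp

lemma NN_periodic (ψ : ℕ → ℝ) {q : ℕ} (hq : 0 < q) : Function.Periodic (NN ψ q) 1 := by
  intro α
  unfold NN
  by_cases h : α ∈ As ψ q
  · rw [Set.indicator_of_mem h, Set.indicator_of_mem ((As_periodic ψ hq α).2 h)]; simp
  · rw [Set.indicator_of_notMem h, Set.indicator_of_notMem (fun h' => h ((As_periodic ψ hq α).1 h'))]

lemma ii_of_bdd {f : ℝ → ℝ} (hf : Measurable f) {M : ℝ} (hb : ∀ x, |f x| ≤ M) (a b : ℝ) :
    IntervalIntegrable f volume a b := by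
  refine (intervalIntegrable_const (c := M)).mono_fun hf.aestronglyMeasurable ?_
  refine Filter.Eventually.of_forall fun x => ?_
  have := hb x
  simp only [Real.norm_eq_abs]
  exact this.trans (le_abs_self _)

lemma mem_near {ψ : ℕ → ℝ} {q : ℕ} (hq : 0 < q) (h2 : ψ q ≤ 1 / 2) (a : ℕ) {s : ℝ}
    (hs : |s| < 1 / (2 * q)) : ((a:ℝ) / q + s ∈ As ψ q) ↔ (|s| < ψ q / q ∧ q.Coprime a) := by
  have hq0 : (0:ℝ) < q := by positivity
  constructor
  · rintro ⟨b, h1, hb⟩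
    have hb1 : ψ q / q ≤ 1 / (2 * q) := by
      rw [div_le_div_iff₀ hq0 (by positivity)]; nlinarith
    have hab : (a:ℤ) = b := by
      have e : (a:ℝ) / q + s - b / q = (a - b) / q + s := by ring
      rw [e] at h1
      have h3 : |((a:ℝ) - b) / q| < 1 / q := by
        have : ((a:ℝ) - b) / q = ((a - b) / q + s) - s := by ring
        rw [this]
        refine (abs_sub _ _).trans_lt ?_
        have : 1 / (q:ℝ) = 1 / (2 * q) + 1 / (2 * q) := by field_simp; ring
        linarith
      rw [abs_div, abs_of_pos hq0, div_lt_div_iff_of_pos_right hq0] at h3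
      have h4 : |(a:ℤ) - b| < 1 := by exact_mod_cast h3
      have := Int.abs_lt_one_iff.1 h4
      omega
    subst hab
    refine ⟨by simpa using h1, ?_⟩
    rw [Nat.coprime_comm]; simpa using hb
  · rintro ⟨h1, h3⟩
    refine ⟨a, by simpa using h1, ?_⟩
    rw [Nat.coprime_comm] at h3; simpa using h3

lemma unfold_int {ψ : ℕ → ℝ} {q : ℕ} (hq : 0 < q) (h0 : 0 ≤ ψ q) (h2 : ψ q ≤ 1 / 2) {f : ℝ → ℝ} (hf : Measurable f)
    (hb : ∀ x, |f x| ≤ 1) (hper : Function.Periodic f 1) :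
    ∫ α in (0:ℝ)..1, NN ψ q α * f α =
      ∑ a ∈ (range q).filter (fun a => q.Coprime a), ∫ s in (-(ψ q / q))..(ψ q / q), f ((a:ℝ) / q + s) := by
  have hq0 : (0:ℝ) < q := by positivity
  have hper' : Function.Periodic (fun α => NN ψ q α * f α) 1 := (NN_periodic ψ hq).mul hper
  have hmeas : Measurable (fun α => NN ψ q α * f α) := (NN_meas ψ q).mul hf
  have hbd : ∀ α, |NN ψ q α * f α| ≤ 1 := by
    intro α
    rw [abs_mul, abs_of_nonneg (NN_nonneg ψ q α)]
    exact mul_le_one₀ (NN_le_one ψ q α) (abs_nonneg _) (hb α)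
  set η : ℝ := 1 / (2 * q) with hη
  have hη2 : 2 * η = 1 / q := by rw [hη]; field_simp
  have hηpos : 0 < η := by positivity
  have hδη : ψ q / q ≤ η := by
    rw [hη, div_le_div_iff₀ hq0 (by positivity)]; nlinarith
  have hδ0 : 0 ≤ ψ q / q := by positivity
  have e1 := hper'.intervalIntegral_add_eq 0 (-η)
  rw [zero_add] at e1
  have e2 : ∫ α in (-η)..(-η + 1), NN ψ q α * f α =
      ∑ a ∈ range q, ∫ α in ((a:ℝ) / q - η)..((a:ℝ) / q + η), NN ψ q α * f α := by
    have := intervalIntegral.sum_integral_adjacent_intervals (f := fun α => NN ψ q α * f α) (μ := volume)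
      (a := fun k : ℕ => (k:ℝ) / q - η) (n := q) (fun k _ => ii_of_bdd hmeas hbd _ _)
    simp only [Nat.cast_zero, zero_div, zero_sub, div_self hq0.ne'] at this
    rw [show -η + 1 = 1 - η by ring, ← this]
    apply sum_congr rfl
    intro a _
    congr 1
    push_cast
    rw [add_div, ← hη2]; ring
  rw [e1, e2, sum_filter]
  apply sum_congr rfl
  intro a _
  have e3 : ∫ α in ((a:ℝ) / q - η)..((a:ℝ) / q + η), NN ψ q α * f α =
      ∫ s in (-η)..η, NN ψ q ((a:ℝ) / q + s) * f ((a:ℝ) / q + s) := by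
    rw [intervalIntegral.integral_comp_add_left (fun α => NN ψ q α * f α)]; rfl
  rw [e3]
  have e4 : ∫ s in (-η)..η, NN ψ q ((a:ℝ) / q + s) * f ((a:ℝ) / q + s) =
      ∫ s in (-η)..η, (if q.Coprime a then (Set.Ioo (-(ψ q / q)) (ψ q / q)).indicator (fun s => f ((a:ℝ) / q + s)) s else 0) := by
    rw [intervalIntegral.integral_of_le (by linarith), intervalIntegral.integral_of_le (by linarith),
      integral_Ioc_eq_integral_Ioo, integral_Ioc_eq_integral_Ioo]
    apply setIntegral_congr_fun measurableSet_Ioo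
    intro s hs
    have hs' : |s| < 1 / (2 * q) := abs_lt.2 hs
    have key := mem_near hq h2 a hs'
    simp only
    by_cases hc : q.Coprime a
    · rw [if_pos hc]
      by_cases hsδ : |s| < ψ q / q
      · rw [Set.indicator_of_mem (Set.mem_Ioo.2 (abs_lt.1 hsδ)), NN, Set.indicator_of_mem (key.2 ⟨hsδ, hc⟩)]; simp
      · rw [Set.indicator_of_notMem (fun h => hsδ (abs_lt.2 (Set.mem_Ioo.1 h))), NN, Set.indicator_of_notMem (fun h => hsδ (key.1 h).1), zero_mul]
    · rw [if_neg hc, NN, Set.indicator_of_notMem (fun h => hc (key.1 h).2), zero_mul]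
  rw [e4]
  split_ifs with hc
  · rw [intervalIntegral.integral_of_le (by linarith), intervalIntegral.integral_of_le (by linarith),
      setIntegral_indicator measurableSet_Ioo, integral_Ioc_eq_integral_Ioo]
    congr 2
    rw [Set.inter_eq_right]
    intro s hs
    exact ⟨by linarith [hs.1], by linarith [hs.2]⟩
  · simp

lemma int_NN {ψ : ℕ → ℝ} {q : ℕ} (hq : 0 < q) (h0 : 0 ≤ ψ q) (h2 : ψ q ≤ 1 / 2) :
    ∫ α in (0:ℝ)..1, NN ψ q α = lam ψ q := by
  have := unfold_int hq h0 h2 (f := fun _ => 1) measurable_const (by simp) (by intro x; rfl)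
  simp only [mul_one] at this
  rw [this, sum_congr rfl fun a _ => intervalIntegral.integral_const (1:ℝ), sum_const]
  unfold lam Nat.totient
  simp only [smul_eq_mul, nsmul_eq_mul]
  ring

end QDS

namespace QDS
open Finset MeasureTheory

noncomputable def DD (ψ : ℕ → ℝ) (q r : ℕ) : ℝ := max (r * ψ q) (q * ψ r) / Nat.gcd q r

/-- the pairs counted by a translate -/
lemma pairSet {ψ : ℕ → ℝ} {g q' r' : ℕ} (hg : 0 < g) (hq : 0 < q') (hr : 0 < r') (hcop : Nat.Coprime q' r')
    (hne : q' ≠ r') {s : ℝ} (hs : |s| ≤ ψ (g * r') / (g * r' : ℕ)) :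
    ∃ F : Finset (ℤ × ℤ), ∑ a ∈ (range (g * q')).filter (fun a => (g * q').Coprime a),
      NN ψ (g * r') ((a:ℝ) / (g * q' : ℕ) + s) = F.card ∧
      ∀ y ∈ F, 0 ≤ y.1 ∧ y.1 < (g * q' : ℕ) ∧ IsCoprime y.1 ((g * q' : ℕ) : ℤ) ∧
      IsCoprime y.2 ((g * r' : ℕ) : ℤ) ∧ y.1 * r' - y.2 * q' ≠ 0 ∧
      (-(g * q' * r') * s - q' * ψ (g * r')) < ((y.1 * r' - y.2 * q' : ℤ) : ℝ) ∧
      ((y.1 * r' - y.2 * q' : ℤ) : ℝ) < (-(g * q' * r') * s - q' * ψ (g * r')) + 2 * (q' * ψ (g * r')) := by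
  classical
  have hb : ∀ a : ℕ, ∃ b : ℤ, (a:ℝ) / (g * q' : ℕ) + s ∈ As ψ (g * r') →
      |(a:ℝ) / (g * q' : ℕ) + s - b / (g * r' : ℕ)| < ψ (g * r') / (g * r' : ℕ) ∧ Int.gcd b (g * r' : ℕ) = 1 := by
    intro a
    by_cases h : (a:ℝ) / (g * q' : ℕ) + s ∈ As ψ (g * r')
    · obtain ⟨b, hb⟩ := h; exact ⟨b, fun _ => hb⟩
    · exact ⟨0, fun h' => absurd h' h⟩
  choose b hb using hb
  refine ⟨(((range (g * q')).filter (fun a => (g * q').Coprime a)).filter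
    (fun a : ℕ => (a:ℝ) / (g * q' : ℕ) + s ∈ As ψ (g * r'))).image (fun a : ℕ => ((a:ℤ), b a)), ?_, ?_⟩
  · rw [card_image_of_injective _ (fun x y hxy => by simpa using congrArg Prod.fst hxy)]
    rw [card_eq_sum_ones, Nat.cast_sum, sum_filter (fun a : ℕ => (a:ℝ) / (g * q' : ℕ) + s ∈ As ψ (g * r'))]
    apply sum_congr rfl
    intro a _
    unfold NN
    rw [Set.indicator_apply]
    simp
  · intro y hy
    obtain ⟨a, ha, rfl⟩ := mem_image.1 hy
    obtain ⟨ha1, hmem⟩ := mem_filter.1 ha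
    obtain ⟨ha2, hac⟩ := mem_filter.1 ha1
    obtain ⟨hb1, hb2⟩ := hb a hmem
    have hac' : IsCoprime (a:ℤ) ((g * q' : ℕ) : ℤ) := Nat.isCoprime_iff_coprime.2 hac.symm
    have hbc' : IsCoprime (b a) ((g * r' : ℕ) : ℤ) := Int.isCoprime_iff_gcd_eq_one.2 hb2
    have hg0 : (0:ℝ) < g := by positivity
    have hq0 : (0:ℝ) < q' := by positivity
    have hr0 : (0:ℝ) < r' := by positivity
    have hcopz : IsCoprime (q':ℤ) (r':ℤ) := Nat.isCoprime_iff_coprime.2 hcop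
    refine ⟨Int.natCast_nonneg _, Nat.cast_lt.2 (mem_range.1 ha2), hac', hbc', ?_, ?_⟩
    · intro h0
      simp only at h0
      have e : (a:ℤ) * r' = b a * q' := by linarith
      have h1 : (q':ℤ) ∣ a := hcopz.dvd_of_dvd_mul_right (by rw [e]; exact Dvd.intro_left _ rfl)
      have h2 : (r':ℤ) ∣ b a := hcopz.symm.dvd_of_dvd_mul_right (by rw [← e]; exact Dvd.intro_left _ rfl)
      have u1 := hac'.isUnit_of_dvd' h1 (by push_cast; exact Dvd.intro_left _ rfl)
      have u2 := hbc'.isUnit_of_dvd' h2 (by push_cast; exact Dvd.intro_left _ rfl)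
      have v1 := Int.ofNat_isUnit.1 u1
      have v2 := Int.ofNat_isUnit.1 u2
      rw [Nat.isUnit_iff] at v1 v2
      omega
    · have h1 := abs_lt.1 hb1
      push_cast at h1
      have e : (((a:ℤ) * r' - b a * q' : ℤ) : ℝ) = g * q' * r' * ((a:ℝ) / (g * q') + s - b a / (g * r')) - g * q' * r' * s := by
        push_cast; field_simp; ring
      have e2 : (q':ℝ) * ψ (g * r') = g * q' * r' * (ψ (g * r') / (g * r')) := by field_simp
      have hpos : (0:ℝ) < g * q' * r' := by positivity
      have m1 := mul_lt_mul_of_pos_left h1.1 hpos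
      have m2 := mul_lt_mul_of_pos_left h1.2 hpos
      simp only [e, e2]
      constructor
      · linarith
      · linarith

lemma overlap_aux {ε : ℝ} (hε : 0 < ε) (hε1 : ε < 1) : ∃ C : ℝ, 1 ≤ C ∧ ∀ ψ : ℕ → ℝ, (∀ q, 0 ≤ ψ q) → (∀ q, ψ q ≤ 1 / 2) →
    ∀ g q' r' : ℕ, 0 < g → 0 < q' → 0 < r' → Nat.Coprime q' r' → q' ≠ r' →
      ψ (g * q') / (g * q' : ℕ) ≤ ψ (g * r') / (g * r' : ℕ) →
      (q' * ψ (g * r') ≤ 1 / 2 → ∫ α in (0:ℝ)..1, NN ψ (g * q') α * NN ψ (g * r') α ≤ 0) ∧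
      ∀ t : ℝ, 1 ≤ t → t ≤ 2 * (q' * ψ (g * r')) → ∫ α in (0:ℝ)..1, NN ψ (g * q') α * NN ψ (g * r') α ≤
        lam ψ (g * q') * lam ψ (g * r') * (1 + C * (kapn t (g * q') (g * r') * t ^ (-1 + ε))) := by
  obtain ⟨C, hC, hcnt⟩ := cntBound hε hε1
  refine ⟨C, hC, ?_⟩
  intro ψ h0 h2 g q' r' hg hq hr hcop hne hδ
  have hg0 : (0:ℝ) < g := by positivity
  have hq0 : (0:ℝ) < q' := by positivity
  have hr0 : (0:ℝ) < r' := by positivity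
  set δ := ψ (g * q') / (g * q' : ℕ) with hδd
  have hδ0 : 0 ≤ δ := div_nonneg (h0 _) (Nat.cast_nonneg _)
  have hu := unfold_int (q := g * q') (by positivity) (h0 _) (h2 _) (NN_meas ψ (g * r'))
    (fun x => by rw [abs_of_nonneg (NN_nonneg _ _ _)]; exact NN_le_one _ _ _) (NN_periodic ψ (by positivity : 0 < g * r'))
  have main : ∀ M : ℝ, (∀ s : ℝ, |s| ≤ δ → ∑ a ∈ (range (g * q')).filter (fun a => (g * q').Coprime a),
      NN ψ (g * r') ((a:ℝ) / (g * q' : ℕ) + s) ≤ M) → ∫ α in (0:ℝ)..1, NN ψ (g * q') α * NN ψ (g * r') α ≤ 2 * δ * M := by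
    intro M hM
    have hint : ∀ a : ℕ, IntervalIntegrable (fun s => NN ψ (g * r') ((a:ℝ) / (g * q' : ℕ) + s)) volume (-δ) δ := by
      intro a
      exact ii_of_bdd ((NN_meas ψ _).comp (measurable_const_add _)) (M := 1)
        (fun x => by rw [Function.comp, abs_of_nonneg (NN_nonneg _ _ _)]; exact NN_le_one _ _ _) _ _
    rw [hu, ← intervalIntegral.integral_finsetSum (fun a _ => hint a)]
    have := intervalIntegral.integral_mono_on (a := -δ) (b := δ) (by linarith)
      (IntervalIntegrable.sum _ (fun a _ => hint a)) (intervalIntegrable_const (c := M) (μ := volume))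
      (fun s hs => by simpa only [Finset.sum_apply] using hM s (abs_le.2 hs))
    rw [intervalIntegral.integral_const, smul_eq_mul] at this
    simp only [Finset.sum_apply] at this
    refine this.trans (le_of_eq (by ring))
  have hℓ : ∀ s : ℝ, |s| ≤ δ → (-((g:ℝ) * q' * r') * s - q' * ψ (g * r')) ≤ 0 ∧
      -(2 * (q' * ψ (g * r'))) ≤ (-((g:ℝ) * q' * r') * s - q' * ψ (g * r')) := by
    intro s hs
    have h1 := abs_le.1 (hs.trans hδ)
    have e2 : (q':ℝ) * ψ (g * r') = g * q' * r' * (ψ (g * r') / (g * r' : ℕ)) := by push_cast; field_simp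
    have hpos : (0:ℝ) < g * q' * r' := by positivity
    have m1 := mul_le_mul_of_nonneg_left h1.1 hpos.le
    have m2 := mul_le_mul_of_nonneg_left h1.2 hpos.le
    rw [e2]
    constructor <;> linarith
  constructor
  · intro hsmall
    have := main 0 (fun s hs => by
      obtain ⟨F, hF1, hF2⟩ := pairSet hg hq hr hcop hne (hs.trans hδ)
      rw [hF1]
      have hE : F = ∅ := by
        rw [Finset.eq_empty_iff_forall_notMem]
        intro y hy
        obtain ⟨_, _, _, _, hc, hl, hu⟩ := hF2 y hy
        have := hℓ s hs
        have h3 : |((y.1 * r' - y.2 * q' : ℤ) : ℝ)| < 1 := abs_lt.2 ⟨by linarith, by linarith⟩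
        have h4 : |y.1 * r' - y.2 * q'| < 1 := by exact_mod_cast h3
        exact hc (Int.abs_lt_one_iff.1 h4)
      simp [hE])
    simpa using this
  · intro t ht htD
    refine (main _ (fun s hs => by
      obtain ⟨F, hF1, hF2⟩ := pairSet hg hq hr hcop hne (hs.trans hδ)
      rw [hF1]
      exact hcnt g q' r' hg hq hr hcop t _ _ ht htD (hℓ s hs).1 (hℓ s hs).2 F hF2)).trans (le_of_eq ?_)
    unfold lam
    rw [hδd]
    push_cast
    field_simp

lemma kapn_comm (t : ℝ) (v w : ℕ) : kapn t v w = kapn t w v := by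
  unfold kapn nset
  rw [union_comm]
  congr 1
  ext p
  simp only [mem_filter, ne_comm]

lemma overlap {ε : ℝ} (hε : 0 < ε) (hε1 : ε < 1) : ∃ C : ℝ, 1 ≤ C ∧ ∀ ψ : ℕ → ℝ, (∀ q, 0 ≤ ψ q) → (∀ q, ψ q ≤ 1 / 2) →
    ∀ q r : ℕ, 0 < q → 0 < r → q ≠ r →
      (DD ψ q r ≤ 1 / 2 → ∫ α in (0:ℝ)..1, NN ψ q α * NN ψ r α ≤ 0) ∧
      ∀ t : ℝ, 1 ≤ t → t ≤ 2 * DD ψ q r → ∫ α in (0:ℝ)..1, NN ψ q α * NN ψ r α ≤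
        lam ψ q * lam ψ r * (1 + C * (kapn t q r * t ^ (-1 + ε))) := by
  obtain ⟨C, hC, h⟩ := overlap_aux hε hε1
  refine ⟨C, hC, ?_⟩
  intro ψ h0 h2
  have key : ∀ q r : ℕ, 0 < q → 0 < r → q ≠ r → r * ψ q ≤ q * ψ r →
      (DD ψ q r ≤ 1 / 2 → ∫ α in (0:ℝ)..1, NN ψ q α * NN ψ r α ≤ 0) ∧
      ∀ t : ℝ, 1 ≤ t → t ≤ 2 * DD ψ q r → ∫ α in (0:ℝ)..1, NN ψ q α * NN ψ r α ≤
        lam ψ q * lam ψ r * (1 + C * (kapn t q r * t ^ (-1 + ε))) := by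
    intro q r hq hr hne hle
    have hD : DD ψ q r = (q:ℝ) * ψ r / Nat.gcd q r := by rw [DD, max_eq_right hle]
    have hδ : ψ q / q ≤ ψ r / r := by
      rw [div_le_div_iff₀ (by positivity) (by positivity)]; linarith
    obtain ⟨q', r', hcop, e1, e2⟩ := Nat.exists_coprime q r
    have hg : 0 < Nat.gcd q r := Nat.gcd_pos_of_pos_left _ hq
    set g := Nat.gcd q r with hgd
    have hg0 : (0:ℝ) < g := by positivity
    clear_value g
    rw [mul_comm] at e1 e2
    subst e1 e2
    have hq' : 0 < q' := Nat.pos_of_mul_pos_left hq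
    have hr' : 0 < r' := Nat.pos_of_mul_pos_left hr
    have hD2 : DD ψ (g * q') (g * r') = q' * ψ (g * r') := by
      rw [hD]; push_cast; field_simp
    rw [hD2]
    exact h ψ h0 h2 g q' r' hg hq' hr' hcop (fun hh => hne (by rw [hh])) hδ
  intro q r hq hr hne
  rcases le_total (r * ψ q) (q * ψ r) with hle | hle
  · exact key q r hq hr hne hle
  · have := key r q hr hq hne.symm hle
    have e : DD ψ r q = DD ψ q r := by rw [DD, DD, max_comm, Nat.gcd_comm]
    rw [e] at this
    simp only [kapn_comm _ r q, mul_comm (NN ψ r _), mul_comm (lam ψ r)] at this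
    exact this

end QDS

namespace QDS
open Finset MeasureTheory

lemma one_le_kapn (t : ℝ) (v w : ℕ) : 1 ≤ kapn t v w := one_le_prodR _ fun P _ => one_le_kap t P

lemma excess_sum {ε : ℝ} (hε : 0 < ε) (hε1 : ε ≤ 1 / 8) : ∃ C : ℝ, 1 ≤ C ∧ ∀ ψ : ℕ → ℝ, (∀ q, 0 ≤ ψ q) →
    ∀ S : Finset ℕ, (∀ v ∈ S, v ≠ 0) → (∀ v ∈ S, 0 < ψ v) → ∀ (E : Finset (ℕ × ℕ)), E ⊆ S ×ˢ S →
    ∀ (j i : ℕ × ℕ → ℕ), (∀ p ∈ E, 2 * DD ψ p.1 p.2 ≤ 2 ^ (j p + 1)) →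
      (∀ p ∈ E, 2 ^ i p ≤ kapn (2 ^ j p) p.1 p.2 ∧ kapn (2 ^ j p) p.1 p.2 ≤ 2 ^ (i p + 1)) →
    ∀ R : ℝ, 1 ≤ R → ∑ v ∈ S, muw ψ v ≤ R →
    ∑ p ∈ E, muw ψ p.1 * muw ψ p.2 * (kapn (2 ^ j p) p.1 p.2 * (2 ^ j p) ^ (-1 + ε)) ≤ C * R ^ (1 + 2 * ε) := by
  classical
  obtain ⟨C, hC, hst⟩ := star (r := 1 / 2 + ε) (ε := ε) (by linarith) (by linarith) hε 6
  set a : ℝ := (2:ℝ) ^ (-(ε / 2)) with ha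
  have ha0 : 0 < a := by positivity
  have ha1 : a < 1 := Real.rpow_lt_one_of_one_lt_of_neg (by norm_num) (by linarith)
  have hsum : Summable (fun x : ℕ × ℕ => a ^ x.1 * (1 / 2 : ℝ) ^ x.2) :=
    (summable_geometric_of_lt_one ha0.le ha1).mul_of_nonneg (summable_geometric_of_lt_one (by norm_num) (by norm_num))
      (fun n => by positivity) (fun n => by positivity)
  set Z := ∑' x : ℕ × ℕ, a ^ x.1 * (1 / 2 : ℝ) ^ x.2 with hZ
  have hZ0 : 0 ≤ Z := tsum_nonneg fun x => by positivity
  refine ⟨1 + 2 * C * Z, by nlinarith [mul_nonneg (by linarith : 0 ≤ C) hZ0], ?_⟩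
  intro ψ h0 S hS0 hSpos E hES j i hj hi R hR hSR
  have hmu : ∀ v, 0 ≤ muw ψ v := fun v => mul_nonneg (h0 v) (by positivity)
  have hR0 : 0 ≤ R ^ (1 + 2 * ε) := by positivity
  have fib : ∀ x : ℕ × ℕ, ∑ p ∈ E.filter (fun p => (j p, i p) = x),
      muw ψ p.1 * muw ψ p.2 * (kapn (2 ^ j p) p.1 p.2 * (2 ^ j p) ^ (-1 + ε)) ≤
      2 * C * R ^ (1 + 2 * ε) * (a ^ x.1 * (1 / 2 : ℝ) ^ x.2) := by
    rintro ⟨J, I⟩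
    set t : ℝ := 2 ^ J with ht
    set K : ℝ := 2 ^ I with hK
    have ht1 : 1 ≤ t := one_le_pow₀ (by norm_num)
    have hK1 : 1 ≤ K := one_le_pow₀ (by norm_num)
    set E' := E.filter (fun p => (j p, i p) = (J, I)) with hE'
    have hmem : ∀ p ∈ E', p ∈ E ∧ j p = J ∧ i p = I := by
      intro p hp
      obtain ⟨h1, h2⟩ := mem_filter.1 hp
      exact ⟨h1, by simpa using congrArg Prod.fst h2, by simpa using congrArg Prod.snd h2⟩
    have hDt : ∀ p ∈ E', max (p.2 * ψ p.1) (p.1 * ψ p.2) ≤ t * Nat.gcd p.1 p.2 := by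
      intro p hp
      obtain ⟨h1, h2, h3⟩ := hmem p hp
      have := hj p h1
      rw [h2, pow_succ] at this
      have hg : 0 < Nat.gcd p.1 p.2 := Nat.gcd_pos_of_pos_left _ (Nat.pos_of_ne_zero (hS0 _ (mem_product.1 (hES h1)).1))
      have hg' : (0:ℝ) < Nat.gcd p.1 p.2 := by exact_mod_cast hg
      have h4 : DD ψ p.1 p.2 ≤ t := by rw [ht]; linarith
      rw [DD, div_le_iff₀ hg'] at h4
      exact h4
    have hstar := hst t K ht1 hK1 ψ h0 S hS0 hSpos E' ((filter_subset _ _).trans hES)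
      (fun p hp => (le_max_right _ _).trans (hDt p hp)) (fun p hp => (le_max_left _ _).trans (hDt p hp))
      (fun p hp => by
        obtain ⟨h1, h2, h3⟩ := hmem p hp
        have := (hi p h1).1
        rwa [h2, h3] at this)
    have s1 : ∑ p ∈ E', muw ψ p.1 * muw ψ p.2 * (kapn (2 ^ j p) p.1 p.2 * (2 ^ j p) ^ (-1 + ε)) ≤
        me (muw ψ) E' * (2 * K * t ^ (-1 + ε)) := by
      unfold me
      rw [sum_mul]
      apply sum_le_sum
      intro p hp
      obtain ⟨h1, h2, h3⟩ := hmem p hp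
      have := (hi p h1).2
      rw [h2, h3, pow_succ] at this
      rw [h2]
      refine mul_le_mul_of_nonneg_left ?_ (mul_nonneg (hmu _) (hmu _))
      refine mul_le_mul_of_nonneg_right ?_ (by positivity)
      rw [hK]; linarith
    refine s1.trans ((mul_le_mul_of_nonneg_right hstar (by positivity)).trans ?_)
    have hW : (∑ v ∈ S, muw ψ v) ^ (2 * (1 / 2 + ε)) ≤ R ^ (1 + 2 * ε) := by
      rw [show 2 * (1 / 2 + ε) = 1 + 2 * ε by ring]
      exact Real.rpow_le_rpow (sum_nonneg fun v _ => hmu v) hSR (by linarith)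
    have hT : (t ^ (2 + ε) / K ^ 6) ^ (1 - (1 / 2 + ε)) * (2 * K * t ^ (-1 + ε)) ≤ 2 * (t ^ (-(ε / 2)) * K⁻¹) := by
      have t0 : 0 < t := by linarith
      have K0 : 0 < K := by linarith
      rw [Real.div_rpow (by positivity) (by positivity), ← Real.rpow_mul t0.le]
      have k1 : K ^ 2 ≤ (K ^ 6) ^ (1 - (1 / 2 + ε)) := by
        rw [← Real.rpow_natCast, ← Real.rpow_natCast, ← Real.rpow_mul K0.le]
        apply Real.rpow_le_rpow_of_exponent_le hK1
        push_cast; linarith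
      have k2 : K / (K ^ 6) ^ (1 - (1 / 2 + ε)) ≤ K⁻¹ := by
        calc K / (K ^ 6) ^ (1 - (1 / 2 + ε)) ≤ K / K ^ 2 := div_le_div_of_nonneg_left K0.le (by positivity) k1
          _ = K⁻¹ := by field_simp
      have k3 : t ^ ((2 + ε) * (1 - (1 / 2 + ε))) * t ^ (-1 + ε) ≤ t ^ (-(ε / 2)) := by
        rw [← Real.rpow_add t0]
        apply Real.rpow_le_rpow_of_exponent_le ht1
        nlinarith
      calc t ^ ((2 + ε) * (1 - (1 / 2 + ε))) / (K ^ 6) ^ (1 - (1 / 2 + ε)) * (2 * K * t ^ (-1 + ε)) =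
          2 * ((t ^ ((2 + ε) * (1 - (1 / 2 + ε))) * t ^ (-1 + ε)) * (K / (K ^ 6) ^ (1 - (1 / 2 + ε)))) := by ring
        _ ≤ 2 * (t ^ (-(ε / 2)) * K⁻¹) := by
          refine mul_le_mul_of_nonneg_left (mul_le_mul k3 k2 (by positivity) (by positivity)) (by norm_num)
    have e1 : t ^ (-(ε / 2)) = a ^ J := by
      rw [ht, ha, ← Real.rpow_natCast, ← Real.rpow_natCast, ← Real.rpow_mul (by norm_num), ← Real.rpow_mul (by norm_num), mul_comm]
    have e2 : K⁻¹ = (1 / 2 : ℝ) ^ I := by rw [hK, one_div, inv_pow]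
    rw [e1, e2] at hT
    calc C * (t ^ (2 + ε) / K ^ 6) ^ (1 - (1 / 2 + ε)) * (∑ v ∈ S, muw ψ v) ^ (2 * (1 / 2 + ε)) * (2 * K * t ^ (-1 + ε))
        = C * (((t ^ (2 + ε) / K ^ 6) ^ (1 - (1 / 2 + ε)) * (2 * K * t ^ (-1 + ε))) * (∑ v ∈ S, muw ψ v) ^ (2 * (1 / 2 + ε))) := by ring
      _ ≤ C * ((2 * (a ^ J * (1 / 2 : ℝ) ^ I)) * R ^ (1 + 2 * ε)) := by
        refine mul_le_mul_of_nonneg_left (mul_le_mul hT hW ?_ (by positivity)) (by linarith)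
        exact Real.rpow_nonneg (sum_nonneg fun v _ => hmu v) _
      _ = 2 * C * R ^ (1 + 2 * ε) * (a ^ J * (1 / 2 : ℝ) ^ I) := by ring
  have hmaps : ∀ p ∈ E, (j p, i p) ∈ E.image (fun p => (j p, i p)) := fun p hp => mem_image_of_mem _ hp
  rw [← sum_fiberwise_of_maps_to hmaps]
  refine (sum_le_sum fun x _ => fib x).trans ?_
  rw [← mul_sum]
  have h5 : ∑ x ∈ E.image (fun p => (j p, i p)), a ^ x.1 * (1 / 2 : ℝ) ^ x.2 ≤ Z :=
    hsum.sum_le_tsum _ (fun x _ => by positivity)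
  have h6 := mul_le_mul_of_nonneg_left h5 (by positivity : 0 ≤ 2 * C * R ^ (1 + 2 * ε))
  nlinarith

lemma lam_eq (ψ : ℕ → ℝ) (q : ℕ) : lam ψ q = 2 * muw ψ q := by unfold lam muw; ring

lemma ii_NN (ψ : ℕ → ℝ) (q : ℕ) (a b : ℝ) : IntervalIntegrable (NN ψ q) volume a b :=
  ii_of_bdd (NN_meas ψ q) (M := 1) (fun x => by rw [abs_of_nonneg (NN_nonneg _ _ _)]; exact NN_le_one _ _ _) _ _

lemma ii_NN2 (ψ : ℕ → ℝ) (q r : ℕ) (a b : ℝ) : IntervalIntegrable (fun α => NN ψ q α * NN ψ r α) volume a b :=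
  ii_of_bdd ((NN_meas ψ q).mul (NN_meas ψ r)) (M := 1) (fun x => by
    rw [Pi.mul_apply, abs_of_nonneg (mul_nonneg (NN_nonneg _ _ _) (NN_nonneg _ _ _))]
    exact mul_le_one₀ (NN_le_one _ _ _) (NN_nonneg _ _ _) (NN_le_one _ _ _)) _ _

lemma cov {ψ : ℕ → ℝ} (h0 : ∀ q, 0 ≤ ψ q) (h2 : ∀ q, ψ q ≤ 1 / 2) {q r : ℕ} (hq : 0 < q) (hr : 0 < r) :
    IntervalIntegrable (fun α => (NN ψ q α - lam ψ q) * (NN ψ r α - lam ψ r)) volume 0 1 ∧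
    ∫ α in (0:ℝ)..1, (NN ψ q α - lam ψ q) * (NN ψ r α - lam ψ r) =
      (∫ α in (0:ℝ)..1, NN ψ q α * NN ψ r α) - lam ψ q * lam ψ r := by
  have e : (fun α => (NN ψ q α - lam ψ q) * (NN ψ r α - lam ψ r)) =
      fun α => (NN ψ q α * NN ψ r α - lam ψ r * NN ψ q α) - (lam ψ q * NN ψ r α - lam ψ q * lam ψ r) := by
    ext α; ring
  have i1 := (ii_NN2 ψ q r 0 1)
  have i2 := (ii_NN ψ q 0 1).const_mul (lam ψ r)
  have i3 := (ii_NN ψ r 0 1).const_mul (lam ψ q)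
  have i4 : IntervalIntegrable (fun _ : ℝ => lam ψ q * lam ψ r) volume 0 1 := intervalIntegrable_const
  rw [e]
  refine ⟨(i1.sub i2).sub (i3.sub i4), ?_⟩
  rw [intervalIntegral.integral_sub (i1.sub i2) (i3.sub i4), intervalIntegral.integral_sub i1 i2,
    intervalIntegral.integral_sub i3 i4, intervalIntegral.integral_const_mul, intervalIntegral.integral_const_mul,
    int_NN hq (h0 _) (h2 _), int_NN hr (h0 _) (h2 _), intervalIntegral.integral_const, smul_eq_mul]
  ring

lemma variance {ε : ℝ} (hε : 0 < ε) (hε1 : ε ≤ 1 / 8) : ∃ C : ℝ, 1 ≤ C ∧ ∀ ψ : ℕ → ℝ, (∀ q, 0 ≤ ψ q) → (∀ q, ψ q ≤ 1 / 2) →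
    ∀ S : Finset ℕ, (∀ v ∈ S, v ≠ 0) → ∀ R : ℝ, 1 ≤ R → ∑ v ∈ S, lam ψ v ≤ R →
    ∫ α in (0:ℝ)..1, (∑ v ∈ S, (NN ψ v α - lam ψ v)) ^ 2 ≤ C * R ^ (1 + 2 * ε) := by
  classical
  obtain ⟨C1, hC1, hov⟩ := overlap hε (by linarith)
  obtain ⟨C2, hC2, hex⟩ := excess_sum hε hε1
  refine ⟨1 + 4 * C1 * C2, by nlinarith, ?_⟩
  intro ψ h0 h2 S0 hS0 R hR hSR
  have hlam0 : ∀ v, 0 ≤ lam ψ v := fun v => by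
    have := h0 v
    unfold lam; positivity
  set S := S0.filter (fun v => 0 < ψ v) with hS
  have hSpos : ∀ v ∈ S, 0 < ψ v := fun v hv => (mem_filter.1 hv).2
  have hSne : ∀ v ∈ S, v ≠ 0 := fun v hv => hS0 v (mem_filter.1 hv).1
  have hzero : ∀ v ∈ S0, v ∉ S → lam ψ v = 0 ∧ ∀ α, NN ψ v α = 0 := by
    intro v hv hvS
    have : ψ v = 0 := by
      by_contra hne
      exact hvS (mem_filter.2 ⟨hv, lt_of_le_of_ne (h0 v) (Ne.symm hne)⟩)
    refine ⟨by simp [lam, this], fun α => ?_⟩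
    unfold NN
    apply Set.indicator_of_notMem
    rintro ⟨a, h1, _⟩
    rw [this, zero_div] at h1
    exact absurd h1 (not_lt.2 (abs_nonneg _))
  have eS : ∀ α, ∑ v ∈ S0, (NN ψ v α - lam ψ v) = ∑ v ∈ S, (NN ψ v α - lam ψ v) := by
    intro α
    symm
    apply sum_subset (filter_subset _ _)
    intro v hv hvS
    obtain ⟨a, b⟩ := hzero v hv hvS
    rw [a, b, sub_zero]
  have hSR' : ∑ v ∈ S, lam ψ v ≤ R := (sum_le_sum_of_subset_of_nonneg (filter_subset _ _) fun v _ _ => hlam0 v).trans hSR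
  simp only [eS]
  have esq : ∀ α, (∑ v ∈ S, (NN ψ v α - lam ψ v)) ^ 2 =
      ∑ p ∈ S ×ˢ S, (NN ψ p.1 α - lam ψ p.1) * (NN ψ p.2 α - lam ψ p.2) := by
    intro α; rw [sq, sum_mul_sum, sum_product]
  simp only [esq]
  have hpos : ∀ p ∈ S ×ˢ S, 0 < p.1 ∧ 0 < p.2 := fun p hp =>
    ⟨Nat.pos_of_ne_zero (hSne _ (mem_product.1 hp).1), Nat.pos_of_ne_zero (hSne _ (mem_product.1 hp).2)⟩
  rw [intervalIntegral.integral_finsetSum (fun p hp => (cov h0 h2 (hpos p hp).1 (hpos p hp).2).1)]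
  have hj : ∀ p : ℕ × ℕ, ∃ n : ℕ, 1 ≤ 2 * DD ψ p.1 p.2 → 2 ^ n ≤ 2 * DD ψ p.1 p.2 ∧ 2 * DD ψ p.1 p.2 ≤ 2 ^ (n + 1) := by
    intro p
    by_cases h : 1 ≤ 2 * DD ψ p.1 p.2
    · obtain ⟨n, hn⟩ := exists_nat_pow_near h (by norm_num : (1:ℝ) < 2)
      exact ⟨n, fun _ => ⟨hn.1, hn.2.le⟩⟩
    · exact ⟨0, fun h' => absurd h' h⟩
  choose j hj using hj
  have hi : ∀ p : ℕ × ℕ, ∃ n : ℕ, 2 ^ n ≤ kapn (2 ^ j p) p.1 p.2 ∧ kapn (2 ^ j p) p.1 p.2 ≤ 2 ^ (n + 1) := by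
    intro p
    obtain ⟨n, hn⟩ := exists_nat_pow_near (one_le_kapn (2 ^ j p) p.1 p.2) (by norm_num : (1:ℝ) < 2)
    exact ⟨n, hn.1, hn.2.le⟩
  choose i hi using hi
  set E := (S ×ˢ S).filter (fun p => 1 ≤ 2 * DD ψ p.1 p.2) with hE
  have hw0 : ∀ p : ℕ × ℕ, 0 ≤ muw ψ p.1 * muw ψ p.2 * (kapn (2 ^ j p) p.1 p.2 * (2 ^ j p) ^ (-1 + ε)) := by
    intro p
    have := zero_le_one.trans (one_le_kapn (2 ^ j p) p.1 p.2)
    have a1 : 0 ≤ muw ψ p.1 := mul_nonneg (h0 _) (by positivity)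
    have a2 : 0 ≤ muw ψ p.2 := mul_nonneg (h0 _) (by positivity)
    positivity
  have term : ∀ p ∈ S ×ˢ S, ∫ α in (0:ℝ)..1, (NN ψ p.1 α - lam ψ p.1) * (NN ψ p.2 α - lam ψ p.2) ≤
      (if p.1 = p.2 then lam ψ p.1 else 0) + (if 1 ≤ 2 * DD ψ p.1 p.2 then 4 * C1 *
        (muw ψ p.1 * muw ψ p.2 * (kapn (2 ^ j p) p.1 p.2 * (2 ^ j p) ^ (-1 + ε))) else 0) := by
    intro p hp
    obtain ⟨hp1, hp2⟩ := hpos p hp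
    rw [(cov h0 h2 hp1 hp2).2]
    have hll : 0 ≤ lam ψ p.1 * lam ψ p.2 := mul_nonneg (hlam0 _) (hlam0 _)
    have hnn : 0 ≤ (if 1 ≤ 2 * DD ψ p.1 p.2 then 4 * C1 *
        (muw ψ p.1 * muw ψ p.2 * (kapn (2 ^ j p) p.1 p.2 * (2 ^ j p) ^ (-1 + ε))) else 0) := by
      split_ifs
      · exact mul_nonneg (by linarith) (hw0 p)
      · exact le_rfl
    by_cases heq : p.1 = p.2
    · rw [if_pos heq]
      have : ∫ α in (0:ℝ)..1, NN ψ p.1 α * NN ψ p.2 α ≤ lam ψ p.1 := by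
        rw [← int_NN hp1 (h0 _) (h2 _)]
        apply intervalIntegral.integral_mono_on (by norm_num) (ii_NN2 _ _ _ _ _) (ii_NN _ _ _ _)
        intro x _
        exact mul_le_of_le_one_right (NN_nonneg _ _ _) (NN_le_one _ _ _)
      linarith
    · rw [if_neg heq]
      obtain ⟨o1, o2⟩ := hov ψ h0 h2 p.1 p.2 hp1 hp2 heq
      by_cases hD : 1 ≤ 2 * DD ψ p.1 p.2
      · rw [if_pos hD]
        have := o2 (2 ^ j p) (one_le_pow₀ (by norm_num)) (hj p hD).1
        have e : lam ψ p.1 * lam ψ p.2 * (1 + C1 * (kapn (2 ^ j p) p.1 p.2 * (2 ^ j p) ^ (-1 + ε))) =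
            lam ψ p.1 * lam ψ p.2 + 4 * C1 * (muw ψ p.1 * muw ψ p.2 * (kapn (2 ^ j p) p.1 p.2 * (2 ^ j p) ^ (-1 + ε))) := by
          rw [lam_eq, lam_eq]; ring
        linarith
      · rw [if_neg hD]
        have := o1 (by linarith)
        linarith
  refine (sum_le_sum term).trans ?_
  rw [sum_add_distrib, ← sum_filter (fun p : ℕ × ℕ => 1 ≤ 2 * DD ψ p.1 p.2), ← mul_sum]
  have d1 : ∑ p ∈ S ×ˢ S, (if p.1 = p.2 then lam ψ p.1 else 0) = ∑ v ∈ S, lam ψ v := by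
    rw [sum_product]
    apply sum_congr rfl
    intro v hv
    simp [hv]
  have hRR : R ≤ R ^ (1 + 2 * ε) := by
    conv_lhs => rw [← Real.rpow_one R]
    exact Real.rpow_le_rpow_of_exponent_le hR (by linarith)
  have hmuR : ∑ v ∈ S, muw ψ v ≤ R := by
    have : ∑ v ∈ S, lam ψ v = 2 * ∑ v ∈ S, muw ψ v := by rw [mul_sum]; exact sum_congr rfl fun v _ => lam_eq ψ v
    linarith
  have d2 := hex ψ h0 S hSne hSpos E (filter_subset _ _) j i (fun p hp => (hj p (mem_filter.1 hp).2).2) (fun p _ => hi p) R hR hmuR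
  have d3 := mul_le_mul_of_nonneg_left d2 (by linarith : 0 ≤ 4 * C1)
  rw [d1]
  calc _ ≤ R ^ (1 + 2 * ε) + 4 * C1 * (C2 * R ^ (1 + 2 * ε)) := by linarith
    _ = _ := by ring

end QDS

namespace QDS
open Finset MeasureTheory Filter

lemma chain (f : ℕ → ℝ) (k j : ℕ) (hj : j < 2 ^ k) :
    (f j - f 0) ^ 2 ≤ k * ∑ i ∈ range k, ∑ m ∈ range (2 ^ (k - i)), (f ((m + 1) * 2 ^ i) - f (m * 2 ^ i)) ^ 2 := by
  have e : f j - f 0 = ∑ i ∈ range k, (f (j / 2 ^ i * 2 ^ i) - f (j / 2 ^ (i + 1) * 2 ^ (i + 1))) := by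
    have := sum_range_sub' (fun i => f (j / 2 ^ i * 2 ^ i)) k
    rw [this]
    simp [Nat.div_eq_of_lt hj]
  rw [e]
  refine (sq_sum_le_card_mul_sum_sq).trans ?_
  rw [card_range]
  refine mul_le_mul_of_nonneg_left (sum_le_sum ?_) (Nat.cast_nonneg _)
  intro i hi
  have hik := mem_range.1 hi
  have hdd : j / 2 ^ (i + 1) = j / 2 ^ i / 2 := by rw [pow_succ, Nat.div_div_eq_div_mul]
  set n := j / 2 ^ i with hn
  rcases Nat.even_or_odd' n with ⟨c, hc | hc⟩
  · have : j / 2 ^ (i + 1) * 2 ^ (i + 1) = n * 2 ^ i := by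
      rw [hdd, hc, pow_succ, Nat.mul_div_cancel_left _ (by norm_num)]; ring
    rw [this, sub_self]
    simpa using sum_nonneg fun m _ => sq_nonneg _
  · have : j / 2 ^ (i + 1) * 2 ^ (i + 1) = (2 * c) * 2 ^ i := by
      rw [hdd, hc, pow_succ, show (2 * c + 1) / 2 = c by omega]; ring
    rw [this, hc]
    refine single_le_sum (f := fun m => (f ((m + 1) * 2 ^ i) - f (m * 2 ^ i)) ^ 2) (fun m _ => sq_nonneg _) (mem_range.2 ?_)
    have h1 : n < 2 ^ (k - i) := by
      rw [hn, Nat.div_lt_iff_lt_mul (by positivity), ← pow_add]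
      rwa [Nat.sub_add_cancel hik.le]
    omega

lemma ae_event (h : ℕ → ℝ → ℝ) (hm : ∀ k, Measurable (h k)) (hnn : ∀ k x, 0 ≤ h k x) (hb : ∀ k, ∃ M, ∀ x, |h k x| ≤ M)
    (hper : ∀ k, Function.Periodic (h k) 1) (b : ℕ → ℝ) (hbs : Summable b) (hint : ∀ k, ∫ x in (0:ℝ)..1, h k x ≤ b k) :
    ∀ᵐ α : ℝ, ∀ᶠ k in atTop, h k α ≤ 1 := by
  rw [← Measure.restrict_univ (μ := (volume : Measure ℝ)), ← iUnion_Ioc_intCast ℝ, ae_restrict_iUnion_iff]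
  intro n
  have hle : ∀ k, ∫⁻ x in Set.Ioc (n:ℝ) (n + 1), ENNReal.ofReal (h k x) ≤ ENNReal.ofReal (b k) := by
    intro k
    obtain ⟨M, hM⟩ := hb k
    have i1 := (ii_of_bdd (hm k) hM (n:ℝ) (n + 1)).1
    rw [← ofReal_integral_eq_lintegral_ofReal i1 (Eventually.of_forall fun x => hnn k x)]
    apply ENNReal.ofReal_le_ofReal
    rw [← intervalIntegral.integral_of_le (by linarith), (hper k).intervalIntegral_add_eq n 0, zero_add]
    exact hint k
  have hfin : ∫⁻ x in Set.Ioc (n:ℝ) (n + 1), ∑' k, ENNReal.ofReal (h k x) ≠ ⊤ := by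
    rw [lintegral_tsum fun k => (hm k).ennreal_ofReal.aemeasurable]
    refine ne_top_of_le_ne_top ?_ (ENNReal.tsum_le_tsum hle)
    exact hbs.tsum_ofReal_ne_top
  have hae := ae_lt_top (Measurable.tsum fun k => (hm k).ennreal_ofReal) hfin
  filter_upwards [hae] with x hx
  have := ENNReal.tendsto_atTop_zero_of_tsum_ne_top hx.ne
  have h1 := this.eventually_lt_const (by norm_num : (0:ENNReal) < 1)
  filter_upwards [h1] with k hk
  by_contra hcon
  push Not at hcon
  have : ENNReal.ofReal 1 ≤ ENNReal.ofReal (h k x) := ENNReal.ofReal_le_ofReal hcon.le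
  rw [ENNReal.ofReal_one] at this
  exact absurd hk (not_lt.2 this)

lemma lam_nonneg {ψ : ℕ → ℝ} (h0 : ∀ q, 0 ≤ ψ q) (q : ℕ) : 0 ≤ lam ψ q := by
  have := h0 q
  unfold lam; positivity

lemma lam_le_one {ψ : ℕ → ℝ} (h0 : ∀ q, 0 ≤ ψ q) (h2 : ∀ q, ψ q ≤ 1 / 2) (q : ℕ) : lam ψ q ≤ 1 := by
  unfold lam
  rcases Nat.eq_zero_or_pos q with rfl | hq
  · simp
  · have hq0 : (0:ℝ) < q := by positivity
    have h1 : (Nat.totient q : ℝ) ≤ q := by exact_mod_cast Nat.totient_le q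
    have h3 : (Nat.totient q : ℝ) * ψ q ≤ q * (1 / 2) := mul_le_mul h1 (h2 q) (h0 q) hq0.le
    have : (Nat.totient q : ℝ) * ψ q / q ≤ 1 / 2 := by rw [div_le_iff₀ hq0]; linarith
    linarith

noncomputable def PP (ψ : ℕ → ℝ) (Q : ℕ) : ℝ := ∑ q ∈ Icc 1 Q, lam ψ q
noncomputable def SN (ψ : ℕ → ℝ) (α : ℝ) (Q : ℕ) : ℝ := ∑ q ∈ Icc 1 Q, NN ψ q α

lemma PP_mono {ψ : ℕ → ℝ} (h0 : ∀ q, 0 ≤ ψ q) : Monotone (PP ψ) := fun _ _ h =>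
  sum_le_sum_of_subset_of_nonneg (Icc_subset_Icc_right h) fun q _ _ => lam_nonneg h0 q

lemma SN_mono {ψ : ℕ → ℝ} (α : ℝ) : Monotone (SN ψ α) := fun _ _ h =>
  sum_le_sum_of_subset_of_nonneg (Icc_subset_Icc_right h) fun q _ _ => NN_nonneg ψ q α

lemma exQ {ψ : ℕ → ℝ} (h0 : ∀ q, 0 ≤ ψ q) (h2 : ∀ q, ψ q ≤ 1 / 2) (hΨ : Tendsto (PP ψ) atTop atTop) :
    ∃ q : ℕ → ℕ, q 0 = 0 ∧ Monotone q ∧ (∀ j : ℕ, (j:ℝ) ≤ PP ψ (q j) ∧ PP ψ (q j) ≤ j + 1) ∧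
      ∀ (j Q : ℕ), (j:ℝ) ≤ PP ψ Q → q j ≤ Q := by
  classical
  have hex : ∀ j : ℕ, ∃ Q, (j:ℝ) ≤ PP ψ Q := fun j => (hΨ.eventually_ge_atTop (j:ℝ)).exists
  refine ⟨fun j => Nat.find (hex j), ?_, ?_, ?_, ?_⟩
  · simp [PP]
  · intro a b hab
    apply Nat.find_min'
    have := Nat.find_spec (hex b)
    have h1 : (a:ℝ) ≤ b := by exact_mod_cast hab
    exact h1.trans this
  · intro j
    refine ⟨Nat.find_spec (hex j), ?_⟩
    simp only
    rcases Nat.eq_zero_or_pos (Nat.find (hex j)) with hz | hp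
    · rw [hz]; simp [PP]; positivity
    · obtain ⟨n, hn⟩ := Nat.exists_eq_succ_of_ne_zero hp.ne'
      have h1 := Nat.find_min (hex j) (m := n) (by omega)
      push Not at h1
      rw [hn, PP, Nat.succ_eq_add_one, sum_Icc_succ_top (by omega)]
      have h3 := lam_le_one h0 h2 (n + 1)
      unfold PP at h1
      linarith
  · intro j Q h
    exact Nat.find_min' _ h

end QDS

namespace QDS
open Finset MeasureTheory Filter

noncomputable def Bk (ψ : ℕ → ℝ) (s : Finset ℕ) (α : ℝ) : ℝ := ∑ v ∈ s, (NN ψ v α - lam ψ v)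

lemma Bk_meas (ψ : ℕ → ℝ) (s : Finset ℕ) : Measurable (Bk ψ s) := by
  unfold Bk
  exact Finset.measurable_fun_sum _ fun v _ => (NN_meas ψ v).sub_const _

lemma Bk_sq_le {ψ : ℕ → ℝ} (h0 : ∀ q, 0 ≤ ψ q) (h2 : ∀ q, ψ q ≤ 1 / 2) (s : Finset ℕ) (α : ℝ) :
    Bk ψ s α ^ 2 ≤ (s.card : ℝ) ^ 2 := by
  rw [sq_le_sq, abs_of_nonneg (Nat.cast_nonneg (α := ℝ) _)]
  refine (abs_sum_le_sum_abs _ _).trans ((sum_le_card_nsmul s _ 1 ?_).trans (by simp))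
  intro v _
  have := NN_nonneg ψ v α
  have := NN_le_one ψ v α
  have := lam_nonneg h0 v
  have := lam_le_one h0 h2 v
  exact abs_le.2 ⟨by linarith, by linarith⟩

lemma Bk_per (ψ : ℕ → ℝ) (s : Finset ℕ) (hs : ∀ v ∈ s, 0 < v) : Function.Periodic (Bk ψ s) 1 := by
  intro α
  exact sum_congr rfl fun v hv => by rw [NN_periodic ψ (hs v hv) α]

lemma diff_eq (ψ : ℕ → ℝ) (α : ℝ) {a b : ℕ} (hab : a ≤ b) :
    (SN ψ α b - PP ψ b) - (SN ψ α a - PP ψ a) = Bk ψ (Ioc a b) α := by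
  have e : ∀ (g : ℕ → ℝ) (n : ℕ), ∑ q ∈ Icc 1 n, g q = ∑ q ∈ Ioc 0 n, g q := by
    intro g n; congr 1
  unfold SN PP Bk
  rw [sum_sub_distrib, e, e, e, e, ← sum_Ioc_consecutive _ (Nat.zero_le a) hab, ← sum_Ioc_consecutive _ (Nat.zero_le a) hab]
  ring

lemma main_ae {ε : ℝ} (hε : 0 < ε) (hε1 : ε ≤ 1 / 8) {ψ : ℕ → ℝ} (h0 : ∀ q, 0 ≤ ψ q) (h2 : ∀ q, ψ q ≤ 1 / 2)
    (hΨ : Tendsto (PP ψ) atTop atTop) :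
    ∀ᵐ α : ℝ, ∀ᶠ Q in atTop, |SN ψ α Q - PP ψ Q| ≤ 6 * PP ψ Q ^ (1 / 2 + 2 * ε) := by
  obtain ⟨C, hC, hvar⟩ := variance hε hε1
  obtain ⟨q, hq0, hqm, hq, hqmin⟩ := exQ h0 h2 hΨ
  set bl : ℕ → ℕ → Finset ℕ := fun i m => Ioc (q (m * 2 ^ i)) (q ((m + 1) * 2 ^ i)) with hbl
  set w : ℕ → ℝ := fun k => ((2:ℝ) ^ k) ^ (-(1 + 4 * ε)) with hw
  have hw0 : ∀ k, 0 < w k := fun k => by rw [hw]; positivity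
  set G : ℕ → ℝ → ℝ := fun k α => ∑ i ∈ range k, ∑ m ∈ range (2 ^ (k - i)), Bk ψ (bl i m) α ^ 2 with hG
  have hG0 : ∀ k α, 0 ≤ G k α := fun k α => sum_nonneg fun i _ => sum_nonneg fun m _ => sq_nonneg _
  have hblpos : ∀ i m, ∀ v ∈ bl i m, 0 < v := fun i m v hv => by
    have := (mem_Ioc.1 hv).1; omega
  have hBint : ∀ i m, IntervalIntegrable (fun α => Bk ψ (bl i m) α ^ 2) volume 0 1 := fun i m =>
    ii_of_bdd ((Bk_meas ψ _).pow_const 2) (fun x => by rw [abs_of_nonneg (sq_nonneg _)]; exact Bk_sq_le h0 h2 _ x) _ _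
  have hmass : ∀ i m, ∑ v ∈ bl i m, lam ψ v ≤ (2:ℝ) ^ (i + 1) := by
    intro i m
    have hle : q (m * 2 ^ i) ≤ q ((m + 1) * 2 ^ i) := hqm (Nat.mul_le_mul_right _ (Nat.le_succ m))
    have e : ∑ v ∈ bl i m, lam ψ v = PP ψ (q ((m + 1) * 2 ^ i)) - PP ψ (q (m * 2 ^ i)) := by
      have e' : ∀ n : ℕ, PP ψ n = ∑ q ∈ Ioc 0 n, lam ψ q := by intro n; unfold PP; congr 1
      rw [e', e', ← sum_Ioc_consecutive _ (Nat.zero_le _) hle]; ring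
    have a1 := (hq ((m + 1) * 2 ^ i)).2
    have a2 := (hq (m * 2 ^ i)).1
    push_cast at a1 a2
    have a3 : (1:ℝ) ≤ 2 ^ i := one_le_pow₀ (by norm_num)
    rw [e, pow_succ]
    linarith
  have hBv : ∀ k i m, i < k → ∫ α in (0:ℝ)..1, Bk ψ (bl i m) α ^ 2 ≤ C * (2 ^ (i + 1) * ((2:ℝ) ^ k) ^ (2 * ε)) := by
    intro k i m hik
    have := hvar ψ h0 h2 (bl i m) (fun v hv => (hblpos i m v hv).ne') (2 ^ (i + 1)) (one_le_pow₀ (by norm_num)) (hmass i m)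
    refine this.trans (mul_le_mul_of_nonneg_left ?_ (by linarith))
    rw [Real.rpow_add (by positivity), Real.rpow_one]
    refine mul_le_mul_of_nonneg_left ?_ (by positivity)
    apply Real.rpow_le_rpow (by positivity) _ (by linarith)
    exact pow_le_pow_right₀ (by norm_num) hik
  have hGint : ∀ k, ∫ α in (0:ℝ)..1, G k α ≤ k * (2 * C * (2 ^ k * ((2:ℝ) ^ k) ^ (2 * ε))) := by
    intro k
    have i1 : ∀ i, IntervalIntegrable (fun α => ∑ m ∈ range (2 ^ (k - i)), Bk ψ (bl i m) α ^ 2) volume 0 1 := by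
      intro i
      have := IntervalIntegrable.sum (range (2 ^ (k - i))) (fun m _ => hBint i m)
      have e : (fun α => ∑ m ∈ range (2 ^ (k - i)), Bk ψ (bl i m) α ^ 2) = ∑ m ∈ range (2 ^ (k - i)), (fun α => Bk ψ (bl i m) α ^ 2) := by
        funext x
        rw [Finset.sum_apply]
      rw [e]
      exact this
    rw [hG]
    simp only
    rw [intervalIntegral.integral_finsetSum fun i _ => i1 i]
    refine (sum_le_card_nsmul (range k) _ (2 * C * (2 ^ k * ((2:ℝ) ^ k) ^ (2 * ε))) ?_).trans (by simp)
    intro i hi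
    have hik := mem_range.1 hi
    rw [intervalIntegral.integral_finsetSum fun m _ => hBint i m]
    refine (sum_le_card_nsmul _ _ _ fun m _ => hBv k i m hik).trans (le_of_eq ?_)
    rw [card_range, nsmul_eq_mul]
    push_cast
    have : (2:ℝ) ^ k = 2 ^ (k - i) * 2 ^ i := by rw [← pow_add, Nat.sub_add_cancel hik.le]
    generalize ((2:ℝ) ^ k) ^ (2 * ε) = z
    rw [this, pow_succ]; ring
  set ρ : ℝ := (2:ℝ) ^ (-(2 * ε)) with hρ
  have hρ0 : 0 < ρ := by positivity
  have hρ1 : ρ < 1 := Real.rpow_lt_one_of_one_lt_of_neg (by norm_num) (by linarith)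
  have hmain := ae_event (fun k α => k * w k * G k α) ?_ ?_ ?_ ?_ (fun k => 2 * C * ((k:ℝ) ^ 2 * ρ ^ k)) ?_ ?_
  rotate_left
  · intro k
    refine Measurable.const_mul ?_ _
    exact Finset.measurable_fun_sum _ fun i _ => Finset.measurable_fun_sum _ fun m _ => (Bk_meas ψ _).pow_const 2
  · intro k x
    exact mul_nonneg (mul_nonneg (Nat.cast_nonneg _) (hw0 k).le) (hG0 k x)
  · intro k
    refine ⟨k * w k * ∑ i ∈ range k, ∑ m ∈ range (2 ^ (k - i)), ((bl i m).card : ℝ) ^ 2, fun x => ?_⟩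
    have hkw : 0 ≤ k * w k := mul_nonneg (Nat.cast_nonneg _) (hw0 k).le
    rw [abs_of_nonneg (mul_nonneg hkw (hG0 k x))]
    exact mul_le_mul_of_nonneg_left (sum_le_sum fun i _ => sum_le_sum fun m _ => Bk_sq_le h0 h2 _ x) hkw
  · intro k x
    simp only [hG]
    congr 1
    refine sum_congr rfl fun i _ => sum_congr rfl fun m _ => ?_
    rw [Bk_per ψ _ (hblpos i m) x]
  · refine Summable.mul_left _ ?_
    exact summable_pow_mul_geometric_of_norm_lt_one 2 (by rw [Real.norm_eq_abs, abs_of_pos hρ0]; exact hρ1)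
  · intro k
    rw [intervalIntegral.integral_const_mul]
    refine (mul_le_mul_of_nonneg_left (hGint k) (mul_nonneg (Nat.cast_nonneg _) (hw0 k).le)).trans (le_of_eq ?_)
    have e : w k * (2 ^ k * ((2:ℝ) ^ k) ^ (2 * ε)) = ρ ^ k := by
      have p : (0:ℝ) < 2 ^ k := by positivity
      rw [hw]
      simp only
      have : (2:ℝ) ^ k * ((2:ℝ) ^ k) ^ (2 * ε) = ((2:ℝ) ^ k) ^ (1 + 2 * ε) := by rw [Real.rpow_add p, Real.rpow_one]
      rw [this, ← Real.rpow_add p, hρ, ← Real.rpow_natCast, ← Real.rpow_natCast, ← Real.rpow_mul (by norm_num),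
        ← Real.rpow_mul (by norm_num)]
      congr 1; ring
    calc k * w k * (k * (2 * C * (2 ^ k * ((2:ℝ) ^ k) ^ (2 * ε)))) = 2 * C * (k ^ 2 * (w k * (2 ^ k * ((2:ℝ) ^ k) ^ (2 * ε)))) := by ring
      _ = _ := by rw [e]
  filter_upwards [hmain] with α hα
  obtain ⟨K0, hK0⟩ := eventually_atTop.1 hα
  filter_upwards [hΨ.eventually_ge_atTop ((2:ℝ) ^ K0)] with Q hQ
  set P := PP ψ Q with hP
  have hP1 : 1 ≤ P := (one_le_pow₀ (by norm_num)).trans hQ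
  set j := ⌊P⌋₊ with hj
  have hj1 : (j:ℝ) ≤ P := Nat.floor_le (by linarith)
  have hj2 : P < j + 1 := Nat.lt_floor_add_one P
  set k := Nat.log 2 (j + 1) + 1 with hk
  have hk1 : j + 1 < 2 ^ k := Nat.lt_pow_succ_log_self (by norm_num) _
  have hk2 : 2 ^ k ≤ 2 * (j + 1) := by
    have := Nat.pow_log_le_self 2 (Nat.succ_ne_zero j)
    rw [hk, pow_succ]; simp only [Nat.succ_eq_add_one] at this; omega
  have hk2' : (2:ℝ) ^ k ≤ 4 * P := by
    have : ((2 ^ k : ℕ) : ℝ) ≤ ((2 * (j + 1) : ℕ) : ℝ) := by exact_mod_cast hk2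
    push_cast at this
    linarith
  have hkK : K0 ≤ k := by
    have h1 : (2:ℝ) ^ K0 ≤ ((j + 1 : ℕ) : ℝ) := by push_cast; linarith
    have h3 : 2 ^ K0 ≤ j + 1 := by exact_mod_cast h1
    have := Nat.le_log_of_pow_le (by norm_num) h3
    omega
  have hH := hK0 k hkK
  set f : ℕ → ℝ := fun n => SN ψ α (q n) - PP ψ (q n) with hf
  have hf0 : f 0 = 0 := by simp [hf, hq0, SN, PP]
  have hfb : ∀ n, n < 2 ^ k → |f n| ≤ 4 * P ^ (1 / 2 + 2 * ε) := by
    intro n hn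
    have hc := chain f k n hn
    have e : ∀ i m, f ((m + 1) * 2 ^ i) - f (m * 2 ^ i) = Bk ψ (bl i m) α := fun i m =>
      diff_eq ψ α (hqm (Nat.mul_le_mul_right _ (Nat.le_succ m)))
    simp only [e] at hc
    rw [hf0, sub_zero] at hc
    have p2 : (0:ℝ) < 2 ^ k := by positivity
    have h3 : k * G k α ≤ ((2:ℝ) ^ k) ^ (1 + 4 * ε) := by
      have e2 : w k * ((2:ℝ) ^ k) ^ (1 + 4 * ε) = 1 := by
        rw [hw]; simp only; rw [← Real.rpow_add p2]; simp
      have := mul_le_mul_of_nonneg_right hH (by positivity : 0 ≤ ((2:ℝ) ^ k) ^ (1 + 4 * ε))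
      calc (k:ℝ) * G k α = (w k * ((2:ℝ) ^ k) ^ (1 + 4 * ε)) * (k * G k α) := by rw [e2, one_mul]
        _ = k * w k * G k α * ((2:ℝ) ^ k) ^ (1 + 4 * ε) := by ring
        _ ≤ 1 * ((2:ℝ) ^ k) ^ (1 + 4 * ε) := this
        _ = _ := one_mul _
    have h4 : ((2:ℝ) ^ k) ^ (1 + 4 * ε) ≤ (4 * P) ^ (1 + 4 * ε) := Real.rpow_le_rpow p2.le hk2' (by linarith)
    have h5 : (4 * P) ^ (1 + 4 * ε) = ((4 * P) ^ (1 / 2 + 2 * ε)) ^ 2 := by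
      rw [← Real.rpow_natCast, ← Real.rpow_mul (by linarith)]; congr 1; push_cast; ring
    have h6 : |f n| ≤ (4 * P) ^ (1 / 2 + 2 * ε) := by
      apply abs_le_of_sq_le_sq _ (by positivity)
      rw [← h5]
      exact hc.trans (h3.trans h4)
    refine h6.trans ?_
    rw [Real.mul_rpow (by norm_num) (by linarith)]
    refine mul_le_mul_of_nonneg_right ?_ (by positivity)
    calc (4:ℝ) ^ (1 / 2 + 2 * ε) ≤ (4:ℝ) ^ (1:ℝ) := Real.rpow_le_rpow_of_exponent_le (by norm_num) (by linarith)
      _ = 4 := Real.rpow_one _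
  have b1 := abs_le.1 (hfb j (by omega))
  have b2 := abs_le.1 (hfb (j + 1) hk1)
  simp only [hf] at b1 b2
  have c1 : q j ≤ Q := hqmin j Q hj1
  have c2 : Q ≤ q (j + 1) := by
    by_contra hcon
    push Not at hcon
    have := PP_mono h0 hcon.le
    have h7 := (hq (j + 1)).1
    push_cast at h7
    linarith
  have d1 := SN_mono (ψ := ψ) α c1
  have d2 := SN_mono (ψ := ψ) α c2
  have d3 := (hq j).1
  have d4 := (hq (j + 1)).2
  push_cast at d4
  have hPp : 1 ≤ P ^ (1 / 2 + 2 * ε) := Real.one_le_rpow hP1 (by linarith)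
  have m1 := PP_mono h0 c1
  have m2 := PP_mono h0 c2
  rw [abs_le]
  constructor <;> linarith

end QDS

lemma QDS.psi_eq (ψ : ℕ → ℝ) (Q : ℕ) : Psi ψ Q = QDS.PP ψ Q := by
  unfold Psi QDS.PP QDS.lam
  rw [Finset.mul_sum]

lemma QDS.a_unique {ψ : ℕ → ℝ} (h2 : ∀ q, ψ q ≤ 1 / 2) {α : ℝ} {q : ℕ} (hq : 1 ≤ q) {a b : ℤ}
    (ha : |α - a / q| < ψ q / q) (hb : |α - b / q| < ψ q / q) : a = b := by
  have hq' : (0:ℝ) < q := by exact_mod_cast hq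
  have h : ψ q / q ≤ (1 / 2) / q := div_le_div_of_nonneg_right (h2 q) hq'.le
  have h1 := abs_lt.1 ha
  have h3 := abs_lt.1 hb
  have e : (1 / 2 : ℝ) / q + (1 / 2) / q = 1 / q := by ring
  have x1 : (a:ℝ) / q < (b + 1) / q := by rw [add_div]; linarith [h1.1, h3.2]
  have x2 : (b:ℝ) / q < (a + 1) / q := by rw [add_div]; linarith [h1.2, h3.1]
  rw [div_lt_div_iff_of_pos_right hq'] at x1 x2
  have y1 : a < b + 1 := by exact_mod_cast x1
  have y2 : b < a + 1 := by exact_mod_cast x2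
  omega

lemma QDS.count_eq {ψ : ℕ → ℝ} (h2 : ∀ q, ψ q ≤ 1 / 2) (α : ℝ) (Q : ℕ) :
    (Ncount ψ α Q : ℝ) = QDS.SN ψ α Q := by
  classical
  have e : Ncount ψ α Q = ((Finset.Icc 1 Q).filter (fun q => α ∈ QDS.As ψ q)).card := by
    have c : ∀ q, ∃ a : ℤ, α ∈ QDS.As ψ q → |α - a / q| < ψ q / q ∧ Int.gcd a q = 1 := by
      intro q
      by_cases h : α ∈ QDS.As ψ q
      · obtain ⟨a, ha⟩ := h
        exact ⟨a, fun _ => ha⟩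
      · exact ⟨0, fun h' => absurd h' h⟩
    choose f hf using c
    have s : {x : ℤ × ℕ | 1 ≤ x.2 ∧ x.2 ≤ Q ∧
        |α - (x.1 : ℝ) / (x.2 : ℝ)| < ψ x.2 / (x.2 : ℝ) ∧ Int.gcd x.1 (x.2 : ℤ) = 1} =
        ((((Finset.Icc 1 Q).filter (fun q => α ∈ QDS.As ψ q)).image fun q => (f q, q) : Finset (ℤ × ℕ)) : Set (ℤ × ℕ)) := by
      ext ⟨a, q⟩
      simp only [Set.mem_ofPred_eq, Finset.coe_image, Set.mem_image, Finset.mem_coe, Finset.mem_filter,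
        Finset.mem_Icc, Prod.mk.injEq]
      constructor
      · rintro ⟨q1, q2, h3, h4⟩
        have hm : α ∈ QDS.As ψ q := ⟨a, h3, h4⟩
        exact ⟨q, ⟨⟨q1, q2⟩, hm⟩, QDS.a_unique h2 q1 (hf q hm).1 h3, rfl⟩
      · rintro ⟨q', ⟨⟨q1, q2⟩, hm⟩, rfl, rfl⟩
        exact ⟨q1, q2, (hf _ hm).1, (hf _ hm).2⟩
    unfold Ncount
    rw [s, Nat.card_coe_set_eq, Set.ncard_coe_finset, Finset.card_image_of_injective]
    intro x y h
    exact (Prod.mk.inj h).2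
  rw [e]
  unfold QDS.SN QDS.NN
  rw [Finset.card_filter]
  push_cast
  refine Finset.sum_congr rfl fun q _ => ?_
  by_cases h : α ∈ QDS.As ψ q <;> simp [h]

/-- Quantitative Duffin–Schaeffer theorem: if `Ψ(Q) → ∞`, then there is a Lebesgue-null
set `B` such that for all `α ∉ B` and all `ε > 0`,
`N(α;Q) = Ψ(Q) + O_ε(Ψ(Q)^{1/2+ε})` for all `Q` sufficiently large in terms of `α`. -/
theorem quantitative_duffin_schaeffer (ψ : ℕ → ℝ)
    (hψ : ∀ q, ψ q ∈ Set.Icc (0 : ℝ) (1 / 2))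
    (hΨ : Tendsto (fun Q : ℕ => Psi ψ Q) atTop atTop) :
    ∃ B : Set ℝ, volume B = 0 ∧
      ∀ ε : ℝ, 0 < ε → ∃ C : ℝ, 0 < C ∧ ∀ α : ℝ, α ∉ B →
        ∀ᶠ Q : ℕ in atTop,
          |(Ncount ψ α Q : ℝ) - Psi ψ Q| ≤ C * Psi ψ Q ^ ((1 : ℝ) / 2 + ε) := by
  have h0 : ∀ q, 0 ≤ ψ q := fun q => (hψ q).1
  have h2 : ∀ q, ψ q ≤ 1 / 2 := fun q => (hψ q).2
  simp only [QDS.psi_eq] at hΨ ⊢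
  have hall : ∀ᵐ α : ℝ, ∀ m : ℕ, ∀ᶠ Q in atTop,
      |QDS.SN ψ α Q - QDS.PP ψ Q| ≤ 6 * QDS.PP ψ Q ^ (1 / 2 + 2 * (1 / ((m:ℝ) + 8))) := by
    rw [ae_all_iff]
    intro m
    refine QDS.main_ae (by positivity) ?_ h0 h2 hΨ
    exact one_div_le_one_div_of_le (by norm_num) (by linarith [Nat.cast_nonneg (α := ℝ) m])
  refine ⟨{α : ℝ | ¬ ∀ m : ℕ, ∀ᶠ Q in atTop,
      |QDS.SN ψ α Q - QDS.PP ψ Q| ≤ 6 * QDS.PP ψ Q ^ (1 / 2 + 2 * (1 / ((m:ℝ) + 8)))}, ae_iff.1 hall, ?_⟩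
  intro ε hε
  refine ⟨6, by norm_num, fun α hα => ?_⟩
  have hα' := not_not.1 hα
  obtain ⟨m, hm⟩ := exists_nat_gt (2 / ε)
  filter_upwards [hα' m, hΨ.eventually_ge_atTop 1] with Q hQ hP
  rw [QDS.count_eq h2]
  refine hQ.trans (mul_le_mul_of_nonneg_left ?_ (by norm_num))
  apply Real.rpow_le_rpow_of_exponent_le hP
  have hm8 : (0:ℝ) < (m:ℝ) + 8 := by positivity
  have : 2 * (1 / ((m:ℝ) + 8)) ≤ ε := by
    rw [mul_one_div, div_le_iff₀ hm8]
    rw [div_lt_iff₀ hε] at hm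
    nlinarith
  linarith
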